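/- A(1/7;n) ∼ 4√2·sin(π/7)·cosh(3π√(8n−1)/28)/√(8n−1) as n → ∞; that is, the quotient A(1/7;n)·√(8n−1)/(4√2·sin(π/7)·cosh(3π√(8n−1)/28)) tends to 1 as n → ∞. -/

import Mathlib

open scoped Classical

/-- The M2-rank of a partition: ⌈ℓ/2⌉ − s, where ℓ is the largest part
(0 for the empty partition) and s is the number of parts. -/
def m2Rank {n : ℕ} (P : n.Partition) : ℤ :=
  (((P.parts.sup + 1) / 2 : ℕ) : ℤ) - (Multiset.card P.parts : ℤ)

/-- A partition has no repeated odd parts. -/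
def NoRepeatedOddParts {n : ℕ} (P : n.Partition) : Prop :=
  ∀ j : ℕ, Odd j → P.parts.count j ≤ 1

/-- `N2 r m n` is the number of partitions of `n` without repeated odd parts whose
M2-rank is congruent to `r` modulo `m`. -/
noncomputable def N2 (r : ℤ) (m n : ℕ) : ℕ :=
  Nat.card {P : n.Partition // NoRepeatedOddParts P ∧ m2Rank P ≡ r [ZMOD (m : ℤ)]}

/-- `Acoef a c n = Σ_{r=0}^{c−1} N2(r,c,n)·e^{2πiar/c}`, the coefficient of `q^n`
in the M2-rank generating function `R2(e^{2πia/c};q)`. -/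
noncomputable def Acoef (a : ℤ) (c n : ℕ) : ℂ :=
  ∑ r ∈ Finset.range c,
    (N2 (r : ℤ) c n : ℂ) * Complex.exp (2 * Real.pi * Complex.I * (a : ℂ) * (r : ℂ) / (c : ℂ))


open scoped Classical

/-! ### q-series -/

lemma prod_norm_le_exp (r c : ℝ) (hr0 : 0 ≤ r) (hr : r < 1) (hc : 0 ≤ c) (f : ℕ → ℂ)
    (hf : ∀ i, ‖f i‖ ≤ 1 + c * r ^ i) (n : ℕ) :
    ‖∏ i ∈ Finset.range n, f i‖ ≤ Real.exp (c / (1 - r)) := by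
  rw [norm_prod]
  have h1 : ∏ i ∈ Finset.range n, ‖f i‖ ≤ ∏ i ∈ Finset.range n, Real.exp (c * r ^ i) := by
    apply Finset.prod_le_prod
    · intro i _; exact norm_nonneg _
    · intro i _
      refine (hf i).trans ?_
      have := Real.add_one_le_exp (c * r ^ i)
      linarith
  refine h1.trans ?_
  rw [← Real.exp_sum]
  apply Real.exp_le_exp.mpr
  rw [← Finset.mul_sum, div_eq_mul_inv]
  apply mul_le_mul_of_nonneg_left _ hc
  rw [← tsum_geometric_of_lt_one hr0 hr]
  exact (summable_geometric_of_lt_one hr0 hr).sum_le_tsum _ (fun i _ => pow_nonneg hr0 i)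

/-- (-q;q²)_n -/
noncomputable def qa (q : ℂ) (n : ℕ) : ℂ := ∏ i ∈ Finset.range n, (1 + q ^ (2 * i + 1))
/-- (zq²;q²)_n -/
noncomputable def qz (z q : ℂ) (n : ℕ) : ℂ := ∏ i ∈ Finset.range n, (1 - z * q ^ (2 * i + 2))
/-- (q²;q²)_n -/
noncomputable def qp (q : ℂ) (n : ℕ) : ℂ := ∏ i ∈ Finset.range n, (1 - q ^ (2 * i + 2))

lemma qp_eq (q : ℂ) (n : ℕ) : qp q n = qz 1 q n := by simp [qp, qz]

lemma qp_succ (q : ℂ) (n : ℕ) : qp q (n + 1) = qp q n * (1 - q ^ (2 * n + 2)) := by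
  simp [qp, Finset.prod_range_succ]
lemma qz_succ (z q : ℂ) (n : ℕ) : qz z q (n + 1) = qz z q n * (1 - z * q ^ (2 * n + 2)) := by
  simp [qz, Finset.prod_range_succ]
lemma qa_succ (q : ℂ) (n : ℕ) : qa q (n + 1) = qa q n * (1 + q ^ (2 * n + 1)) := by
  simp [qa, Finset.prod_range_succ]

lemma one_sub_norm_lower {z q : ℂ} (hz : ‖z‖ ≤ 1) (hq : ‖q‖ < 1) {k : ℕ} (hk : k ≠ 0) :
    1 - ‖q‖ ^ k ≤ ‖1 - z * q ^ k‖ ∧ 0 < 1 - ‖q‖ ^ k := by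
  have h1 : ‖z * q ^ k‖ ≤ ‖q‖ ^ k := by
    rw [norm_mul, norm_pow]
    exact mul_le_of_le_one_left (by positivity) hz
  have h2 : ‖q‖ ^ k < 1 := pow_lt_one₀ (norm_nonneg _) hq hk
  have h3 := norm_sub_norm_le (1 : ℂ) (z * q ^ k)
  rw [norm_one] at h3
  constructor <;> linarith

lemma one_sub_ne {z q : ℂ} (hz : ‖z‖ ≤ 1) (hq : ‖q‖ < 1) {k : ℕ} (hk : k ≠ 0) :
    1 - z * q ^ k ≠ 0 := by
  have := one_sub_norm_lower hz hq hk
  exact norm_pos_iff.mp (by linarith [this.1, this.2])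

lemma one_sub_ne' {q : ℂ} (hq : ‖q‖ < 1) {k : ℕ} (hk : k ≠ 0) : 1 - q ^ k ≠ 0 := by
  simpa using one_sub_ne (z := 1) (by simp) hq hk

lemma qz_ne {z q : ℂ} (hz : ‖z‖ ≤ 1) (hq : ‖q‖ < 1) (n : ℕ) : qz z q n ≠ 0 :=
  Finset.prod_ne_zero_iff.mpr fun _ _ => one_sub_ne hz hq (by omega)

lemma qp_ne {q : ℂ} (hq : ‖q‖ < 1) (n : ℕ) : qp q n ≠ 0 := by
  rw [qp_eq]; exact qz_ne (by simp) hq n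

lemma inv_factor_bound {z q : ℂ} (hz : ‖z‖ ≤ 1) (hq : ‖q‖ < 1) {k i : ℕ} (hk : k ≠ 0)
    (hik : i ≤ k) : ‖(1 - z * q ^ k)⁻¹‖ ≤ 1 + (1 / (1 - ‖q‖)) * ‖q‖ ^ i := by
  obtain ⟨h1, h2⟩ := one_sub_norm_lower hz hq hk
  have hr0 := norm_nonneg q
  set r := ‖q‖
  have h3 : r ^ k ≤ r ^ i := pow_le_pow_of_le_one hr0 hq.le hik
  have h4 : r ^ k ≤ r := by simpa using pow_le_pow_of_le_one hr0 hq.le (Nat.one_le_iff_ne_zero.mpr hk)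
  rw [norm_inv]
  calc ‖1 - z * q ^ k‖⁻¹ ≤ (1 - r ^ k)⁻¹ := by gcongr
    _ = 1 + 1 / (1 - r ^ k) * r ^ k := by field_simp; ring
    _ ≤ 1 + (1 / (1 - r)) * r ^ i := by
        gcongr

lemma prod_inv_bound {q : ℂ} (hq : ‖q‖ < 1) : ∃ B : ℝ, 0 < B ∧ ∀ z : ℂ, ‖z‖ ≤ 1 → ∀ s : ℕ, s ≠ 0 →
    ∀ n : ℕ, ‖(∏ i ∈ Finset.range n, (1 - z * q ^ (s + 2 * i)))⁻¹‖ ≤ B := by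
  refine ⟨Real.exp ((1 / (1 - ‖q‖)) / (1 - ‖q‖)), Real.exp_pos _, fun z hz s hs n => ?_⟩
  rw [← Finset.prod_inv_distrib]
  apply prod_norm_le_exp _ _ (norm_nonneg _) hq
  · have : 0 < 1 - ‖q‖ := by linarith
    positivity
  · intro i
    exact inv_factor_bound hz hq (by omega) (by omega)

lemma qz_inv_bound {q : ℂ} (hq : ‖q‖ < 1) : ∃ B : ℝ, 0 < B ∧ ∀ z : ℂ, ‖z‖ ≤ 1 →
    ∀ n : ℕ, ‖(qz z q n)⁻¹‖ ≤ B := by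
  obtain ⟨B, hB, h⟩ := prod_inv_bound hq
  refine ⟨B, hB, fun z hz n => ?_⟩
  have := h z hz 2 (by norm_num) n
  simpa [qz, add_comm] using this

lemma prod_bound {q : ℂ} (hq : ‖q‖ < 1) : ∃ B : ℝ, 0 < B ∧ ∀ z : ℂ, ‖z‖ ≤ 1 → ∀ s : ℕ,
    ∀ n : ℕ, ‖∏ i ∈ Finset.range n, (1 + z * q ^ (s + 2 * i))‖ ≤ B := by
  refine ⟨Real.exp (1 / (1 - ‖q‖)), Real.exp_pos _, fun z hz s n => ?_⟩
  apply prod_norm_le_exp _ _ (norm_nonneg _) hq zero_le_one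
  intro i
  refine (norm_add_le _ _).trans ?_
  rw [norm_one, norm_mul, norm_pow]
  have : ‖q‖ ^ (s + 2 * i) ≤ ‖q‖ ^ i := pow_le_pow_of_le_one (norm_nonneg _) hq.le (by omega)
  have h0 : 0 ≤ ‖q‖ ^ (s + 2 * i) := by positivity
  nlinarith

/-- the terms of the 1φ1 sum -/
noncomputable def ww (q : ℂ) (s r m : ℕ) : ℂ :=
  q ^ (m * (m - 1) + r * m) * (∏ i ∈ Finset.range m, (1 + q ^ (s + 2 * i))) *
    ((qp q m)⁻¹ * (∏ i ∈ Finset.range m, (1 - q ^ (s + r + 2 * i)))⁻¹)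

lemma ww_bound {q : ℂ} (hq : ‖q‖ < 1) : ∃ C : ℝ, 0 < C ∧ ∀ s r m : ℕ, s ≠ 0 →
    ‖ww q s r m‖ ≤ C * ‖q‖ ^ (r * m) := by
  obtain ⟨A, hA, ha⟩ := prod_bound hq
  obtain ⟨B, hB, hb⟩ := prod_inv_bound hq
  obtain ⟨B', hB', hb'⟩ := qz_inv_bound hq
  refine ⟨A * (B' * B), by positivity, fun s r m hs => ?_⟩
  unfold ww
  rw [norm_mul, norm_mul, norm_mul, norm_pow]
  have h1 := ha 1 (by simp) s m
  have h2 := hb 1 (by simp) (s + r) (by omega) m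
  have h3 := hb' 1 (by simp) m
  simp only [one_mul] at h1 h2
  rw [← qp_eq] at h3
  have h4 : ‖q‖ ^ (m * (m - 1) + r * m) ≤ ‖q‖ ^ (r * m) :=
    pow_le_pow_of_le_one (norm_nonneg _) hq.le (by omega)
  calc _ ≤ ‖q‖ ^ (r * m) * A * (B' * B) := by gcongr
    _ = _ := by ring

lemma ww_summable {q : ℂ} (hq : ‖q‖ < 1) (s r : ℕ) (hs : s ≠ 0) (hr : r ≠ 0) :
    Summable (fun m => ‖ww q s r m‖) := by
  obtain ⟨C, hC, h⟩ := ww_bound hq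
  refine Summable.of_nonneg_of_le (fun _ => norm_nonneg _) (fun m => h s r m hs) ?_
  apply Summable.mul_left
  simp_rw [pow_mul]
  exact summable_geometric_of_lt_one (by positivity) (pow_lt_one₀ (norm_nonneg _) hq hr)

lemma ww_tele {q : ℂ} (hq : ‖q‖ < 1) (s r m : ℕ) (hs : s ≠ 0) :
    ww q s r m - (1 + q ^ r) / (1 - q ^ (s + r)) * ww q s (r + 2) m =
      (-(ww q s r (m + 1) * (1 - q ^ (2 * (m + 1))))) - (-(ww q s r m * (1 - q ^ (2 * m)))) := by
  have e1 : (∏ i ∈ Finset.range m, (1 - q ^ (s + (r + 2) + 2 * i))) * (1 - q ^ (s + r)) =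
      (∏ i ∈ Finset.range m, (1 - q ^ (s + r + 2 * i))) * (1 - q ^ (s + r + 2 * m)) := by
    rw [← Finset.prod_range_succ (fun i => (1 - q ^ (s + r + 2 * i))) m,
      Finset.prod_range_succ']
    simp only [mul_zero, add_zero]
    congr 1
    apply Finset.prod_congr rfl
    intro i _
    ring_nf
  have n1 : ∏ i ∈ Finset.range m, (1 - q ^ (s + (r + 2) + 2 * i)) ≠ 0 :=
    Finset.prod_ne_zero_iff.mpr fun _ _ => one_sub_ne' hq (by omega)
  have n2 : ∏ i ∈ Finset.range m, (1 - q ^ (s + r + 2 * i)) ≠ 0 :=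
    Finset.prod_ne_zero_iff.mpr fun _ _ => one_sub_ne' hq (by omega)
  have n3 : 1 - q ^ (s + r) ≠ 0 := one_sub_ne' hq (by omega)
  have n4 : 1 - q ^ (s + r + 2 * m) ≠ 0 := one_sub_ne' hq (by omega)
  have n5 : 1 - q ^ (2 * m + 2) ≠ 0 := one_sub_ne' hq (by omega)
  have n6 := qp_ne hq m
  have e2 : (∏ i ∈ Finset.range m, (1 - q ^ (s + (r + 2) + 2 * i)))⁻¹ =
      (1 - q ^ (s + r)) * ((∏ i ∈ Finset.range m, (1 - q ^ (s + r + 2 * i))) *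
        (1 - q ^ (s + r + 2 * m)))⁻¹ := by
    rw [← e1]; field_simp
  have e3 : q ^ ((m + 1) * (m + 1 - 1) + r * (m + 1)) =
      q ^ (m * (m - 1) + r * m) * q ^ (2 * m) * q ^ r := by
    rw [← pow_add, ← pow_add]; congr 1
    cases m with
    | zero => simp
    | succ k => simp only [Nat.add_sub_cancel]; ring
  have e4 : q ^ (m * (m - 1) + (r + 2) * m) = q ^ (m * (m - 1) + r * m) * q ^ (2 * m) := by
    rw [← pow_add]; congr 1; ring
  unfold ww
  rw [e2, e3, e4, qp_succ, Finset.prod_range_succ, Finset.prod_range_succ]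
  rw [show 2 * (m + 1) = 2 * m + 2 by ring]
  have e5 : q ^ (s + r + 2 * m) = q ^ (s + 2 * m) * q ^ r := by rw [← pow_add]; ring_nf
  generalize (∏ i ∈ Finset.range m, (1 + q ^ (s + 2 * i))) = A at *
  generalize (∏ i ∈ Finset.range m, (1 - q ^ (s + r + 2 * i))) = C at *
  generalize q ^ (m * (m - 1) + r * m) = T at *
  generalize qp q m = p at *
  clear e1 e2 e3 e4 n1
  have e6 : q ^ (s + 2 * m) = q ^ s * q ^ (2 * m) := pow_add _ _ _
  have e7 : q ^ (s + r) = q ^ s * q ^ r := pow_add _ _ _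
  rw [e7] at n3
  rw [e5, e6] at n4
  rw [e7, e5, e6]
  clear e5 e6 e7
  generalize q ^ (2 * m + 2) = Y at *
  generalize q ^ (2 * m) = X at *
  generalize q ^ r = R at *
  generalize q ^ s = S at *
  have hU : S * R = 1 - (1 - S * R) := by ring
  have hV : (1 - S * X * R) = (1 - X) + X * (1 - S * R) := by ring
  have n4' : (1 - X) + X * (1 - S * R) ≠ 0 := hV ▸ n4
  have k1 : (1 + R) / (1 - S * R) * (T * X * A * (p⁻¹ * ((1 - S * R) * (C * (1 - S * X * R))⁻¹)))
      = (1 + R) * T * X * A / (p * C * (1 - S * X * R)) := by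
    rw [mul_inv]
    generalize 1 - S * R = U at *
    generalize 1 - S * X * R = V at *
    field_simp
  have k2 : T * X * R * (A * (1 + S * X)) * ((p * (1 - Y))⁻¹ * (C * (1 - S * X * R))⁻¹) * (1 - Y)
      = T * X * R * (A * (1 + S * X)) / (p * C * (1 - S * X * R)) := by
    generalize 1 - S * X * R = V at *
    field_simp
  have k3 : T * A * (p⁻¹ * C⁻¹) = T * A * (1 - S * X * R) / (p * C * (1 - S * X * R)) := by
    generalize 1 - S * X * R = V at *
    field_simp
  rw [k1, k2, k3]
  ring

lemma ww_rec {q : ℂ} (hq : ‖q‖ < 1) (s r : ℕ) (hs : s ≠ 0) (hr : r ≠ 0) :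
    ∑' m, ww q s r m = (1 + q ^ r) / (1 - q ^ (s + r)) * ∑' m, ww q s (r + 2) m := by
  have h1 := (ww_summable hq s r hs hr).of_norm
  have h2 := ((ww_summable hq s (r + 2) hs (by omega)).of_norm).mul_left
    ((1 + q ^ r) / (1 - q ^ (s + r)))
  have h3 := (h1.hasSum.sub h2.hasSum).tendsto_sum_nat
  simp_rw [ww_tele hq s r _ hs] at h3
  simp_rw [Finset.sum_range_sub (fun m => (-(ww q s r m * (1 - q ^ (2 * m)))))] at h3
  have h4 : Filter.Tendsto (fun n => -(ww q s r n * (1 - q ^ (2 * n))) -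
      -(ww q s r 0 * (1 - q ^ (2 * 0)))) Filter.atTop (nhds 0) := by
    have t1 := h1.tendsto_atTop_zero
    have t2 : Filter.Tendsto (fun n : ℕ => q ^ (2 * n)) Filter.atTop (nhds 0) := by
      simp_rw [pow_mul]
      apply tendsto_pow_atTop_nhds_zero_of_norm_lt_one
      rw [norm_pow]
      exact pow_lt_one₀ (norm_nonneg _) hq (by norm_num)
    have t3 := (t1.mul (t2.const_sub 1)).neg
    simpa using t3
  have h5 := tendsto_nhds_unique h3 h4
  rw [tsum_mul_left] at h5
  exact sub_eq_zero.mp h5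

lemma ww_iter {q : ℂ} (hq : ‖q‖ < 1) (s r : ℕ) (hs : s ≠ 0) (hr : r ≠ 0) (k : ℕ) :
    ∑' m, ww q s r m = (∏ i ∈ Finset.range k, (1 + q ^ (r + 2 * i))) /
      (∏ i ∈ Finset.range k, (1 - q ^ (s + r + 2 * i))) * ∑' m, ww q s (r + 2 * k) m := by
  induction k with
  | zero => simp
  | succ k ih =>
    rw [ih, ww_rec hq s (r + 2 * k) hs (by omega), Finset.prod_range_succ, Finset.prod_range_succ,
      show s + (r + 2 * k) = s + r + 2 * k by ring, show r + 2 * (k + 1) = r + 2 * k + 2 by ring]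
    rw [mul_div_mul_comm]; ring

lemma ww_lim {q : ℂ} (hq : ‖q‖ < 1) (s r : ℕ) (hs : s ≠ 0) (hr : r ≠ 0) :
    Filter.Tendsto (fun k : ℕ => ∑' m, ww q s (r + 2 * k) m) Filter.atTop (nhds 1) := by
  obtain ⟨C, hC, h⟩ := ww_bound hq
  have hlim : ∑' m : ℕ, (if m = 0 then (1 : ℂ) else 0) = 1 := by simp
  rw [← hlim]
  apply tendsto_tsum_of_dominated_convergence (bound := fun m => C * ‖q‖ ^ m)
  · exact (summable_geometric_of_lt_one (norm_nonneg _) hq).mul_left C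
  · intro m
    by_cases hm : m = 0
    · subst hm; simp [ww, qp]
    · simp only [hm, if_false]
      apply squeeze_zero_norm (a := fun k : ℕ => C * ‖q‖ ^ k)
      · intro k
        refine (h s (r + 2 * k) m hs).trans ?_
        apply mul_le_mul_of_nonneg_left _ hC.le
        apply pow_le_pow_of_le_one (norm_nonneg _) hq.le
        have : 1 ≤ m := Nat.one_le_iff_ne_zero.mpr hm
        nlinarith
      · simpa using (tendsto_pow_atTop_nhds_zero_of_lt_one (norm_nonneg q) hq).const_mul C
  · filter_upwards with k m
    refine (h s (r + 2 * k) m hs).trans ?_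
    apply mul_le_mul_of_nonneg_left _ hC.le
    apply pow_le_pow_of_le_one (norm_nonneg _) hq.le
    have : 1 ≤ r := Nat.one_le_iff_ne_zero.mpr hr
    nlinarith

/-- the infinite product P(q) = (-q;q²)_∞/(q²;q²)_∞ as a limit -/
lemma exists_Pq {q : ℂ} (hq : ‖q‖ < 1) : ∃ P : ℂ,
    Filter.Tendsto (fun k => qa q k / qp q k) Filter.atTop (nhds P) ∧
    ∀ j : ℕ, Filter.Tendsto (fun k => qa q (j + k) / qp q (2 * j + k)) Filter.atTop (nhds P) := by
  have sg : Summable (fun i : ℕ => ‖q‖ ^ i) := summable_geometric_of_lt_one (norm_nonneg _) hq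
  have ha : Multipliable (fun i : ℕ => 1 + q ^ (2 * i + 1)) := by
    apply multipliable_one_add_of_summable
    refine Summable.of_nonneg_of_le (fun _ => norm_nonneg _) (fun i => ?_) sg
    rw [norm_pow]
    exact pow_le_pow_of_le_one (norm_nonneg _) hq.le (by omega)
  have hp : Multipliable (fun i : ℕ => 1 + -q ^ (2 * i + 2)) := by
    apply multipliable_one_add_of_summable
    refine Summable.of_nonneg_of_le (fun _ => norm_nonneg _) (fun i => ?_) sg
    rw [norm_neg, norm_pow]
    exact pow_le_pow_of_le_one (norm_nonneg _) hq.le (by omega)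
  have ta : Filter.Tendsto (qa q) Filter.atTop (nhds (∏' i : ℕ, (1 + q ^ (2 * i + 1)))) :=
    ha.hasProd.tendsto_prod_nat
  have tp : Filter.Tendsto (qp q) Filter.atTop (nhds (∏' i : ℕ, (1 + -q ^ (2 * i + 2)))) := by
    have := hp.hasProd.tendsto_prod_nat
    refine this.congr fun n => ?_
    simp only [← sub_eq_add_neg, qp]
  have hne : (∏' i : ℕ, (1 + -q ^ (2 * i + 2))) ≠ 0 := by
    obtain ⟨B, hB, hb⟩ := qz_inv_bound hq
    intro h0
    rw [h0] at tp
    have h1 : ∀ n, B⁻¹ ≤ ‖qp q n‖ := by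
      intro n
      have := hb 1 (by simp) n
      rw [← qp_eq, norm_inv] at this
      rw [inv_le_comm₀ hB (norm_pos_iff.mpr (qp_ne hq n))]
      exact this
    have h2 := ge_of_tendsto' tp.norm h1
    rw [norm_zero] at h2
    have : 0 < B⁻¹ := by positivity
    linarith
  refine ⟨_, ta.div tp hne, fun j => ?_⟩
  apply Filter.Tendsto.div _ _ hne
  · have := (Filter.tendsto_add_atTop_iff_nat j).mpr ta
    simpa [add_comm] using this
  · have := (Filter.tendsto_add_atTop_iff_nat (2 * j)).mpr tp
    simpa [add_comm] using this

noncomputable def Pq (q : ℂ) : ℂ :=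
  if h : ‖q‖ < 1 then (exists_Pq h).choose else 0

lemma Pq_lim {q : ℂ} (hq : ‖q‖ < 1) (j : ℕ) :
    Filter.Tendsto (fun k => qa q (j + k) / qp q (2 * j + k)) Filter.atTop (nhds (Pq q)) := by
  rw [Pq, dif_pos hq]
  exact (exists_Pq hq).choose_spec.2 j

lemma qa_add (q : ℂ) (j k : ℕ) :
    qa q (j + k) = qa q j * ∏ i ∈ Finset.range k, (1 + q ^ (2 * j + 1 + 2 * i)) := by
  rw [qa, Finset.prod_range_add, qa]; congr 1
  apply Finset.prod_congr rfl; intro i _; ring_nf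

lemma qp_add (q : ℂ) (j k : ℕ) :
    qp q (j + k) = qp q j * ∏ i ∈ Finset.range k, (1 - q ^ (2 * j + 2 + 2 * i)) := by
  rw [qp, Finset.prod_range_add, qp]; congr 1
  apply Finset.prod_congr rfl; intro i _; ring_nf

lemma V_eq {q : ℂ} (hq : ‖q‖ < 1) (j : ℕ) :
    HasSum (fun m => q ^ (m * m + 2 * j * m) * qa q (m + j) / (qp q m * qp q (m + 2 * j))) (Pq q) := by
  have hs : Summable (fun m => ww q (2 * j + 1) (2 * j + 1) m) :=
    (ww_summable hq _ _ (by omega) (by omega)).of_norm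
  have h1 : ∀ m, q ^ (m * m + 2 * j * m) * qa q (m + j) / (qp q m * qp q (m + 2 * j)) =
      qa q j / qp q (2 * j) * ww q (2 * j + 1) (2 * j + 1) m := by
    intro m
    rw [add_comm m j, add_comm m (2 * j), qa_add, qp_add, ww]
    have e : m * (m - 1) + (2 * j + 1) * m = m * m + 2 * j * m := by
      cases m with
      | zero => simp
      | succ k => simp only [Nat.add_sub_cancel]; ring
    have e2 : ∀ i, 2 * (2 * j) + 2 + 2 * i = 2 * j + 1 + (2 * j + 1) + 2 * i := by intro i; ring
    rw [e]; simp_rw [e2]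
    field_simp
  simp_rw [h1]
  have h2 : Pq q = qa q j / qp q (2 * j) * ∑' m, ww q (2 * j + 1) (2 * j + 1) m := by
    have t1 := Pq_lim hq j
    have t2 := ((Pq_lim hq j).mul (ww_lim hq (2 * j + 1) (2 * j + 1) (by omega) (by omega)))
    rw [mul_one] at t2
    refine tendsto_nhds_unique t2 ?_
    apply tendsto_const_nhds.congr
    intro k
    rw [ww_iter hq _ _ (by omega) (by omega) k, qa_add, qp_add]
    have e2 : ∀ i, 2 * (2 * j) + 2 + 2 * i = 2 * j + 1 + (2 * j + 1) + 2 * i := by intro i; ring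
    simp_rw [e2]
    rw [mul_div_mul_comm]; ring
  rw [h2]
  exact hs.hasSum.mul_left _

open scoped Classical

lemma bailey {q : ℂ} (hq : ‖q‖ < 1) (α : ℕ → ℂ) (M : ℝ) (hM : ∀ j, ‖α j‖ ≤ M) :
    HasSum (fun n => q ^ (n * n) * qa q n *
      ∑ j ∈ Finset.range (n + 1), α j / (qp q (n - j) * qp q (n + j)))
      (Pq q * ∑' j, α j * q ^ (j * j)) := by
  obtain ⟨A, hA, ha⟩ := prod_bound hq
  obtain ⟨B, hB, hb⟩ := qz_inv_bound hq
  have ha' : ∀ n, ‖qa q n‖ ≤ A := by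
    intro n
    have := ha 1 (by simp) 1 n
    simpa [qa, add_comm] using this
  have hb' : ∀ n, ‖(qp q n)⁻¹‖ ≤ B := by
    intro n; rw [qp_eq]; exact hb 1 (by simp) n
  have hM0 : 0 ≤ M := (norm_nonneg _).trans (hM 0)
  set F : ℕ × ℕ → ℂ := fun jm => α jm.1 * q ^ (jm.1 * jm.1) *
    (q ^ (jm.2 * jm.2 + 2 * jm.1 * jm.2) * qa q (jm.2 + jm.1) /
      (qp q jm.2 * qp q (jm.2 + 2 * jm.1))) with hF
  have sg : Summable (fun i : ℕ => ‖q‖ ^ i) := summable_geometric_of_lt_one (norm_nonneg _) hq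
  have hsum : Summable F := by
    apply Summable.of_norm
    refine Summable.of_nonneg_of_le (fun _ => norm_nonneg _) (fun jm => ?_)
      ((sg.mul_of_nonneg sg (fun _ => by positivity) (fun _ => by positivity)).mul_left
        (M * A * (B * B)))
    obtain ⟨j, m⟩ := jm
    simp only [hF]
    rw [div_eq_mul_inv, mul_inv]
    simp only [norm_mul, norm_pow]
    have h1 : ‖q‖ ^ (j * j) ≤ ‖q‖ ^ j :=
      pow_le_pow_of_le_one (norm_nonneg _) hq.le (by nlinarith [Nat.le_mul_self j])
    have h2 : ‖q‖ ^ (m * m + 2 * j * m) ≤ ‖q‖ ^ m :=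
      pow_le_pow_of_le_one (norm_nonneg _) hq.le (by nlinarith [Nat.le_mul_self m, Nat.zero_le (2*j*m)])
    have := hM j
    have := ha' (m + j)
    have := hb' m
    have := hb' (m + 2 * j)
    calc _ ≤ M * ‖q‖ ^ j * (‖q‖ ^ m * A * (B * B)) := by gcongr
      _ = _ := by ring
  have h1 : ∑' jm, F jm = Pq q * ∑' j, α j * q ^ (j * j) := by
    rw [hsum.tsum_prod' (fun j => ((V_eq hq j).mul_left (α j * q ^ (j * j))).summable)]
    rw [← tsum_mul_left]
    apply tsum_congr
    intro j
    rw [((V_eq hq j).mul_left (α j * q ^ (j * j))).tsum_eq]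
    ring
  rw [← h1]
  have h2 := (Finset.HasAntidiagonal.sigmaAntidiagonalEquivProd (A := ℕ)).hasSum_iff.mpr hsum.hasSum
  have h3 := h2.sigma (fun n => hasSum_fintype _)
  convert h3 using 1
  funext n
  rw [Finset.mul_sum]
  have : ∀ c : { x // x ∈ Finset.HasAntidiagonal.antidiagonal n},
      (F ∘ Finset.HasAntidiagonal.sigmaAntidiagonalEquivProd) ⟨n, c⟩ = F c.1 := fun c => rfl
  simp_rw [this]
  rw [Finset.sum_coe_sort (Finset.HasAntidiagonal.antidiagonal n) F,
    Finset.Nat.sum_antidiagonal_eq_sum_range_succ_mk]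
  apply Finset.sum_congr rfl
  intro j hj
  obtain ⟨d, rfl⟩ := Nat.exists_eq_add_of_le (Nat.lt_succ_iff.mp (Finset.mem_range.mp hj))
  simp only [hF, Nat.add_sub_cancel_left]
  rw [show j + d + j = d + 2 * j by ring, add_comm d j,
    show (j + d) * (j + d) = j * j + (d * d + 2 * j * d) by ring, pow_add]
  ring

/-- coefficients giving the unit Bailey pair -/
noncomputable def ej (q : ℂ) (j : ℕ) : ℂ :=
  if j = 0 then 1 else (-1) ^ j * q ^ (j * (j - 1)) * (1 + q ^ (2 * j))

noncomputable def cj (z q : ℂ) (j : ℕ) : ℂ :=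
  if j = 0 then 1 else (-1) ^ j * q ^ (j * (j + 1)) * (1 + q ^ (2 * j)) * ((1 - z) * (1 - z⁻¹)) /
    ((1 - z * q ^ (2 * j)) * (1 - z⁻¹ * q ^ (2 * j)))

lemma ej_partial {q : ℂ} (hq : ‖q‖ < 1) (M J : ℕ) (hJ : J ≤ M) :
    ∑ j ∈ Finset.range (J + 1), ej q j / (qp q (M + 1 - j) * qp q (M + 1 + j)) =
      (-1) ^ J * q ^ (J * (J + 1)) /
        (qp q (M - J) * qp q (M + 1 + J) * (1 - q ^ (2 * M + 2))) := by
  have hN : 1 - q ^ (2 * M + 2) ≠ 0 := one_sub_ne' hq (by omega)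
  induction J with
  | zero =>
    simp only [zero_add, Finset.range_one, Finset.sum_singleton, ej, if_true, Nat.sub_zero, add_zero,
      pow_zero, zero_mul, qp_succ]
    have := qp_ne hq M
    field_simp
  | succ J ih =>
    rw [Finset.sum_range_succ, ih (by omega)]
    obtain ⟨d, rfl⟩ := Nat.exists_eq_add_of_le hJ
    have e1 : J + 1 + d - J = d + 1 := by omega
    have e2 : J + 1 + d + 1 - (J + 1) = d + 1 := by omega
    have e3 : J + 1 + d - (J + 1) = d := by omega
    have e4 : J + 1 + d + 1 + (J + 1) = (J + 1 + d + 1 + J) + 1 := by omega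
    rw [e1, e2, e3, e4, qp_succ, qp_succ, ej, if_neg (by omega)]
    have n1 := qp_ne hq d
    have n2 := qp_ne hq (J + 1 + d + 1 + J)
    have n3 : 1 - q ^ (2 * d + 2) ≠ 0 := one_sub_ne' hq (by omega)
    have n4 : 1 - q ^ (2 * (J + 1 + d + 1 + J) + 2) ≠ 0 := one_sub_ne' hq (by omega)
    have f1 : q ^ ((J + 1) * (J + 1 + 1)) = q ^ (J * (J + 1)) * q ^ (2 * J + 2) := by
      rw [← pow_add]; ring_nf
    have f2 : q ^ ((J + 1) * (J + 1 - 1)) = q ^ (J * (J + 1)) := by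
      rw [Nat.add_sub_cancel]; ring_nf
    have f3 : q ^ (2 * (J + 1 + d) + 2) = q ^ (2 * J + 2) * q ^ (2 * d + 2) := by
      rw [← pow_add]; ring_nf
    have f4 : q ^ (2 * (J + 1 + d + 1 + J) + 2) = q ^ (2 * J + 2) * q ^ (2 * J + 2) * q ^ (2 * d + 2) := by
      rw [← pow_add, ← pow_add]; ring_nf
    rw [f1, f2, show 2 * (J + 1) = 2 * J + 2 by ring, pow_succ (-1 : ℂ) J]
    rw [f3] at hN ⊢
    rw [f4] at n4 ⊢
    generalize q ^ (2 * J + 2) = X at *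
    generalize q ^ (2 * d + 2) = Y at *
    generalize qp q d = p1 at *
    generalize qp q (J + 1 + d + 1 + J) = p2 at *
    generalize q ^ (J * (J + 1)) = T at *
    generalize (-1 : ℂ) ^ J = S at *
    have k1 : S * T / (p1 * (1 - Y) * p2 * (1 - X * Y)) =
        S * T * (1 - X * X * Y) / (p1 * (1 - Y) * p2 * (1 - X * Y) * (1 - X * X * Y)) := by
      generalize 1 - X * X * Y = V at *
      generalize 1 - X * Y = U at *
      generalize 1 - Y = W at *
      field_simp
    have k2 : S * -1 * T * (1 + X) / (p1 * (1 - Y) * (p2 * (1 - X * X * Y))) =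
        S * -1 * T * (1 + X) * (1 - X * Y) / (p1 * (1 - Y) * p2 * (1 - X * Y) * (1 - X * X * Y)) := by
      generalize 1 - X * X * Y = V at *
      generalize 1 - X * Y = U at *
      generalize 1 - Y = W at *
      field_simp
    have k3 : S * -1 * (T * X) / (p1 * (p2 * (1 - X * X * Y)) * (1 - X * Y)) =
        S * -1 * (T * X) * (1 - Y) / (p1 * (1 - Y) * p2 * (1 - X * Y) * (1 - X * X * Y)) := by
      generalize 1 - X * X * Y = V at *
      generalize 1 - X * Y = U at *
      generalize 1 - Y = W at *
      field_simp
    rw [k1, k2, k3]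
    ring

lemma ej_total {q : ℂ} (hq : ‖q‖ < 1) (M : ℕ) :
    ∑ j ∈ Finset.range (M + 2), ej q j / (qp q (M + 1 - j) * qp q (M + 1 + j)) = 0 := by
  rw [Finset.sum_range_succ, ej_partial hq M M le_rfl]
  rw [Nat.sub_self, Nat.sub_self, ej, if_neg (by omega)]
  rw [show M + 1 + (M + 1) = (M + 1 + M) + 1 by ring, qp_succ, Nat.add_sub_cancel,
    show 2 * (M + 1) = 2 * M + 2 by ring]
  have f1 : q ^ (2 * (M + 1 + M) + 2) = q ^ (2 * M + 2) * q ^ (2 * M + 2) := by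
    rw [← pow_add]; ring_nf
  have hN : 1 - q ^ (2 * M + 2) ≠ 0 := one_sub_ne' hq (by omega)
  have hN2 : 1 - q ^ (2 * (M + 1 + M) + 2) ≠ 0 := one_sub_ne' hq (by omega)
  rw [f1] at hN2 ⊢
  have n1 := qp_ne hq (M + 1 + M)
  have hN3 : 1 + q ^ (2 * M + 2) ≠ 0 := by
    intro h; apply hN2
    linear_combination (1 - q ^ (2 * M + 2)) * h
  rw [show 1 - q ^ (2 * M + 2) * q ^ (2 * M + 2) = (1 - q ^ (2 * M + 2)) * (1 + q ^ (2 * M + 2)) by ring]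
  rw [show (M + 1) * M = M * (M + 1) by ring, pow_succ (-1 : ℂ) M]
  have : qp q 0 = 1 := by simp [qp]
  rw [this]
  generalize q ^ (2 * M + 2) = X at *
  generalize 1 + X = U at *
  generalize 1 - X = V at *
  field_simp
  ring

lemma cj_total {q z : ℂ} (hq : ‖q‖ < 1) (hz : ‖z‖ = 1) (n : ℕ) :
    ∑ j ∈ Finset.range (n + 1), cj z q j / (qp q (n - j) * qp q (n + j)) =
      1 / (qz z q n * qz z⁻¹ q n) := by
  have hz0 : z ≠ 0 := by intro h; simp [h] at hz
  have hz' : ‖z⁻¹‖ ≤ 1 := by rw [norm_inv, hz, inv_one]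
  induction n with
  | zero => simp [cj, qz, qp]
  | succ M ih =>
    have n1 : 1 - z * q ^ (2 * M + 2) ≠ 0 := one_sub_ne hz.le hq (by omega)
    have n2 : 1 - z⁻¹ * q ^ (2 * M + 2) ≠ 0 := one_sub_ne hz' hq (by omega)
    have key : (1 - z * q ^ (2 * M + 2)) * (1 - z⁻¹ * q ^ (2 * M + 2)) *
        ∑ j ∈ Finset.range (M + 2), cj z q j / (qp q (M + 1 - j) * qp q (M + 1 + j)) =
        ∑ j ∈ Finset.range (M + 1), cj z q j / (qp q (M - j) * qp q (M + j)) +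
        q ^ (2 * M + 2) * ((1 - z) * (1 - z⁻¹)) *
          ∑ j ∈ Finset.range (M + 2), ej q j / (qp q (M + 1 - j) * qp q (M + 1 + j)) := by
      have hc : ∀ j, cj z q j * ((1 - z * q ^ (2 * j)) * (1 - z⁻¹ * q ^ (2 * j))) =
          ej q j * ((1 - z) * (1 - z⁻¹)) * q ^ (2 * j) := by
        intro j
        by_cases hj : j = 0
        · subst hj; simp [cj, ej]
        · have n3 : 1 - z * q ^ (2 * j) ≠ 0 := one_sub_ne hz.le hq (by omega)
          have n4 : 1 - z⁻¹ * q ^ (2 * j) ≠ 0 := one_sub_ne hz' hq (by omega)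
          rw [cj, ej, if_neg hj, if_neg hj]
          have : q ^ (j * (j + 1)) = q ^ (j * (j - 1)) * q ^ (2 * j) := by
            rw [← pow_add]; congr 1
            cases j with
            | zero => simp
            | succ k => simp only [Nat.add_sub_cancel]; ring
          rw [this, div_mul_cancel₀ _ (mul_ne_zero n3 n4)]
          ring
      rw [Finset.mul_sum, Finset.mul_sum]
      rw [Finset.sum_range_succ, Finset.sum_range_succ (n := M + 1)]
      refine Eq.trans ?_ (add_assoc _ _ _)
      rw [← Finset.sum_add_distrib]
      congr 1
      · apply Finset.sum_congr rfl
        intro j hj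
        obtain ⟨d, rfl⟩ := Nat.exists_eq_add_of_le (Nat.lt_succ_iff.mp (Finset.mem_range.mp hj))
        have e1 : j + d + 1 - j = d + 1 := by omega
        have e2 : j + d - j = d := by omega
        have e3 : j + d + 1 + j = (j + d + j) + 1 := by omega
        rw [e1, e2, e3, qp_succ, qp_succ]
        have n5 := qp_ne hq d
        have n6 := qp_ne hq (j + d + j)
        have n7 : 1 - q ^ (2 * d + 2) ≠ 0 := one_sub_ne' hq (by omega)
        have n8 : 1 - q ^ (2 * (j + d + j) + 2) ≠ 0 := one_sub_ne' hq (by omega)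
        have h := hc j
        have f0 : q ^ (2 * (j + d) + 2) = q ^ (2 * j) * q ^ (2 * d + 2) := by
          rw [← pow_add]; ring_nf
        have f4 : q ^ (2 * (j + d + j) + 2) = q ^ (2 * j) * q ^ (2 * j) * q ^ (2 * d + 2) := by
          rw [← pow_add, ← pow_add]; ring_nf
        have hmain : (1 - z * q ^ (2 * (j + d) + 2)) * (1 - z⁻¹ * q ^ (2 * (j + d) + 2)) =
            (1 - q ^ (2 * d + 2)) * (1 - q ^ (2 * (j + d + j) + 2)) +
            q ^ (2 * d + 2) * ((1 - z * q ^ (2 * j)) * (1 - z⁻¹ * q ^ (2 * j))) := by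
          rw [f0, f4]
          linear_combination ((q ^ (2 * j) * q ^ (2 * d + 2)) ^ 2 - q ^ (2 * d + 2) * (q ^ (2 * j)) ^ 2)
            * mul_inv_cancel₀ hz0
        rw [hmain, add_mul]
        congr 1
        · generalize 1 - q ^ (2 * d + 2) = U at *
          generalize 1 - q ^ (2 * (j + d + j) + 2) = V at *
          field_simp
        · rw [f0]
          rw [show ∀ D : ℂ, q ^ (2 * d + 2) * ((1 - z * q ^ (2 * j)) * (1 - z⁻¹ * q ^ (2 * j))) *
            (cj z q j / D) = q ^ (2 * d + 2) * (cj z q j * ((1 - z * q ^ (2 * j)) *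
              (1 - z⁻¹ * q ^ (2 * j)))) / D by intro D; ring, h]
          ring
      · have h := hc (M + 1)
        rw [show 2 * (M + 1) = 2 * M + 2 by ring] at h
        rw [mul_div_assoc', mul_div_assoc', mul_comm _ (cj z q (M + 1)), h]
        ring
    rw [ej_total hq M, mul_zero, add_zero, ih] at key
    rw [qz_succ, qz_succ]
    have n3 := qz_ne hz.le hq M
    have n4 := qz_ne hz' hq M
    generalize 1 - z * q ^ (2 * M + 2) = U at *
    generalize 1 - z⁻¹ * q ^ (2 * M + 2) = V at *
    field_simp
    field_simp at key
    linear_combination key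

open scoped Classical

/-- partial products of (1+xq^k) over odd k -/
noncomputable def qo (x q : ℂ) (L : ℕ) : ℂ := ∏ i ∈ Finset.range L, (1 + x * q ^ (2 * i + 1))

noncomputable def GG (x q : ℂ) (L : ℕ) : ℂ := qo x q L / qz x q L

noncomputable def qs (x q : ℂ) (k L : ℕ) : ℂ := ∏ i ∈ Finset.range L, (1 - x * q ^ (2 * k + 2 + 2 * i))

noncomputable def EE (z x q : ℂ) (k L : ℕ) : ℂ := (z * q ^ (2 * k)) ^ L * qo x q L / qs x q k L

lemma qs_ne {x q : ℂ} (hx : ‖x‖ ≤ 1) (hq : ‖q‖ < 1) (k L : ℕ) : qs x q k L ≠ 0 :=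
  Finset.prod_ne_zero_iff.mpr fun _ _ => one_sub_ne hx hq (by omega)

lemma EE_step {z x q : ℂ} (hzx : z * x = 1) (hx : ‖x‖ ≤ 1) (hq : ‖q‖ < 1) (k L : ℕ) :
    EE z x q k (L + 1) - z * q ^ (2 * k) * EE z x q k L =
      q ^ (2 * k + 1) * (1 + q ^ (2 * k + 1)) / (1 - x * q ^ (2 * k + 2)) * EE z x q (k + 1) L := by
  unfold EE
  have h1 : qs x q k (L + 1) = qs x q k L * (1 - x * q ^ (2 * k + 2 + 2 * L)) := by
    simp [qs, Finset.prod_range_succ]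
  have h2 : qs x q k (L + 1) = qs x q (k + 1) L * (1 - x * q ^ (2 * k + 2)) := by
    rw [qs, Finset.prod_range_succ', qs]
    congr 1
    apply Finset.prod_congr rfl
    intro i _
    ring_nf
  have h3 : qo x q (L + 1) = qo x q L * (1 + x * q ^ (2 * L + 1)) := by
    simp [qo, Finset.prod_range_succ]
  have n1 := qs_ne hx hq k L
  have n2 := qs_ne hx hq (k + 1) L
  have n3 : 1 - x * q ^ (2 * k + 2 + 2 * L) ≠ 0 := one_sub_ne hx hq (by omega)
  have n4 : 1 - x * q ^ (2 * k + 2) ≠ 0 := one_sub_ne hx hq (by omega)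
  have n5 := qs_ne hx hq k (L + 1)
  have e1 : z * q ^ (2 * k) * ((z * q ^ (2 * k)) ^ L * qo x q L / qs x q k L) =
     (z * q ^ (2 * k)) ^ (L + 1) * qo x q L * (1 - x * q ^ (2 * k + 2 + 2 * L)) / qs x q k (L + 1) := by
    rw [h1]
    generalize 1 - x * q ^ (2 * k + 2 + 2 * L) = U at *
    field_simp
    ring
  have e2 : q ^ (2 * k + 1) * (1 + q ^ (2 * k + 1)) / (1 - x * q ^ (2 * k + 2)) *
      ((z * q ^ (2 * (k + 1))) ^ L * qo x q L / qs x q (k + 1) L) =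
      q ^ (2 * k + 1) * (1 + q ^ (2 * k + 1)) * (z * q ^ (2 * (k + 1))) ^ L * qo x q L
        / qs x q k (L + 1) := by
    rw [h2]
    generalize 1 - x * q ^ (2 * k + 2) = U at *
    field_simp
  rw [e1, e2, h3, ← sub_div]
  congr 1
  have e3 : (z * q ^ (2 * k)) ^ (L + 1) * x = z ^ L * q ^ (2 * k * (L + 1)) := by
    rw [mul_pow, pow_succ z, ← pow_mul]
    linear_combination z ^ L * q ^ (2 * k * (L + 1)) * hzx
  have e4 : (z * q ^ (2 * (k + 1))) ^ L = z ^ L * q ^ (2 * k * L) * q ^ (2 * L) := by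
    rw [mul_pow, ← pow_mul, mul_assoc (z ^ L), ← pow_add]; ring_nf
  rw [e4]
  have e5 : (z * q ^ (2 * k)) ^ (L + 1) * (qo x q L * (1 + x * q ^ (2 * L + 1))) -
      (z * q ^ (2 * k)) ^ (L + 1) * qo x q L * (1 - x * q ^ (2 * k + 2 + 2 * L)) =
      ((z * q ^ (2 * k)) ^ (L + 1) * x) * qo x q L * q ^ (2 * L + 1) * (1 + q ^ (2 * k + 1)) := by
    ring
  rw [e5, e3]
  ring

lemma fine {z q : ℂ} (hq : ‖q‖ < 1) (hz : ‖z‖ = 1) :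
    HasSum (fun L => z ^ (L + 1) * (GG z⁻¹ q (L + 1) - GG z⁻¹ q L))
      (Pq q * (∑' j, cj z q j * q ^ (j * j)) - 1) := by
  have hz0 : z ≠ 0 := by intro h; simp [h] at hz
  have hz' : ‖z⁻¹‖ ≤ 1 := by rw [norm_inv, hz, inv_one]
  have hzx : z * z⁻¹ = 1 := mul_inv_cancel₀ hz0
  obtain ⟨A, hA, ha⟩ := prod_bound hq
  obtain ⟨B, hB, hb⟩ := prod_inv_bound hq
  have hr0 : 0 ≤ ‖q‖ := norm_nonneg q
  have sg : Summable (fun i : ℕ => ‖q‖ ^ i) := summable_geometric_of_lt_one (norm_nonneg _) hq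
  set x := z⁻¹ with hx
  have hEb : ∀ k L, ‖EE z x q k L‖ ≤ A * B * ‖q‖ ^ (2 * k * L) := by
    intro k L
    unfold EE
    rw [div_eq_mul_inv, norm_mul, norm_mul, norm_pow, norm_mul, hz, one_mul, norm_pow, ← pow_mul]
    have h1 : ‖qo x q L‖ ≤ A := by
      have := ha x hz' 1 L
      simpa [qo, add_comm] using this
    have h2 : ‖(qs x q k L)⁻¹‖ ≤ B := hb x hz' (2 * k + 2) (by omega) L
    calc _ ≤ ‖q‖ ^ (2 * k * L) * A * B := by gcongr
      _ = _ := by ring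
  have hEb' : ∀ k L, k ≠ 0 → ‖EE z x q k L‖ ≤ A * B * ‖q‖ ^ L := by
    intro k L hk
    refine (hEb k L).trans ?_
    have : ‖q‖ ^ (2 * k * L) ≤ ‖q‖ ^ L := pow_le_pow_of_le_one hr0 hq.le
      (Nat.le_mul_of_pos_left _ (by omega))
    gcongr
  have hEs : ∀ k, k ≠ 0 → Summable (fun L => EE z x q k L) := fun k hk =>
    Summable.of_norm_bounded (sg.mul_left (A * B)) (fun L => hEb' k L hk)
  set S : ℕ → ℂ := fun k => ∑' L, EE z x q k L with hS
  have hSb : ∀ k, k ≠ 0 → ‖S k‖ ≤ A * B * (1 - ‖q‖)⁻¹ := by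
    intro k hk
    have := tsum_of_norm_bounded ((hasSum_geometric_of_lt_one hr0 hq).mul_left (A * B))
      (fun L => hEb' k L hk)
    exact this
  set u : ℕ → ℂ := fun k => q ^ (2 * k + 1) * (1 + q ^ (2 * k + 1)) / (1 - x * q ^ (2 * k + 2)) with hu
  have hub : ∀ k, ‖u k‖ ≤ 2 * B := by
    intro k
    simp only [hu]
    have h1 : ‖(1 - x * q ^ (2 * k + 2))⁻¹‖ ≤ B := by
      have := hb x hz' (2 * k + 2) (by omega) 1
      simpa using this
    have h2 : ‖q ^ (2 * k + 1)‖ ≤ 1 := by rw [norm_pow]; exact pow_le_one₀ hr0 hq.le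
    have h3 : ‖1 + q ^ (2 * k + 1)‖ ≤ 2 := (norm_add_le _ _).trans (by rw [norm_one]; linarith)
    rw [div_eq_mul_inv, norm_mul, norm_mul]
    calc _ ≤ 1 * 2 * B := by gcongr
      _ = _ := by ring
  have hE0 : ∀ k, EE z x q k 0 = 1 := by intro k; simp [EE, qo, qs]
  have hSrec : ∀ k, k ≠ 0 → (1 - z * q ^ (2 * k)) * S k = 1 + u k * S (k + 1) := by
    intro k hk
    have h1 : HasSum (fun L => EE z x q k (L + 1) - z * q ^ (2 * k) * EE z x q k L)
        ((S k - 1) - z * q ^ (2 * k) * S k) := by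
      apply HasSum.sub
      · rw [hasSum_nat_add_iff 1]
        simp [hE0]
        exact (hEs k hk).hasSum
      · exact (hEs k hk).hasSum.mul_left _
    simp_rw [EE_step hzx hz' hq] at h1
    have h2 := h1.unique ((hEs (k + 1) (by omega)).hasSum.mul_left _)
    simp only [hu, hS]
    rw [← h2]; ring
  have h0 : HasSum (fun L => z ^ (L + 1) * (GG x q (L + 1) - GG x q L)) (u 0 * S 1) := by
    have h1 := (hEs 1 one_ne_zero).hasSum.mul_left (u 0)
    refine Eq.subst (motive := fun f => HasSum f (u 0 * S 1)) ?_ h1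
    funext L
    have := EE_step hzx hz' hq 0 L
    simp only [hu]
    rw [show (0 : ℕ) + 1 = 1 from rfl] at this
    rw [this.symm]
    have hqs : ∀ L, qs x q 0 L = qz x q L := by
      intro L; unfold qs qz; apply Finset.prod_congr rfl; intro i _; ring_nf
    simp only [EE, GG, hqs]
    ring
  refine Eq.subst (motive := fun y => HasSum (fun L => z ^ (L + 1) * (GG x q (L + 1) - GG x q L)) y) ?_ h0
  set d : ℕ → ℂ := fun n => q ^ (n * n) * qa q n * (1 / (qz z q n * qz x q n)) with hd
  have hds : HasSum d (Pq q * ∑' j, cj z q j * q ^ (j * j)) := by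
    have hcb : ∃ M : ℝ, ∀ j, ‖cj z q j‖ ≤ M := by
      refine ⟨1 + 1 * 2 * (2 * 2) * (B * B), fun j => ?_⟩
      unfold cj
      split_ifs with hj
      · rw [norm_one]; have : 0 < B * B := by positivity
        linarith
      · rw [div_eq_mul_inv, mul_inv]
        have h1 : ‖(1 - z * q ^ (2 * j))⁻¹‖ ≤ B := by
          have := hb z hz.le (2 * j) (by omega) 1
          simpa using this
        have h2 : ‖(1 - z⁻¹ * q ^ (2 * j))⁻¹‖ ≤ B := by
          have := hb x hz' (2 * j) (by omega) 1
          simpa using this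
        have h3 : ‖q‖ ^ (j * (j + 1)) ≤ 1 := pow_le_one₀ hr0 hq.le
        have h4 : ‖1 + q ^ (2 * j)‖ ≤ 2 := (norm_add_le _ _).trans (by
          rw [norm_one, norm_pow]; linarith [pow_le_one₀ (n := 2 * j) hr0 hq.le])
        have h5 : ‖1 - z‖ ≤ 2 := (norm_sub_le _ _).trans (by rw [norm_one]; linarith)
        have h6 : ‖1 - z⁻¹‖ ≤ 2 := (norm_sub_le _ _).trans (by rw [norm_one]; linarith)
        simp only [norm_mul, norm_pow, norm_neg, norm_one, one_pow, one_mul]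
        calc _ ≤ 1 * 2 * (2 * 2) * (B * B) := by gcongr
          _ ≤ _ := by linarith
    obtain ⟨M, hM⟩ := hcb
    have := bailey hq (cj z q) M hM
    simp_rw [cj_total hq hz] at this
    exact this
  have hdrec : ∀ n, d (n + 1) * (1 - z * q ^ (2 * (n + 1))) = d n * u n := by
    intro n
    simp only [hd, hu]
    rw [qa_succ, qz_succ, qz_succ, show 2 * (n + 1) = 2 * n + 2 by ring,
      show (n + 1) * (n + 1) = n * n + (2 * n + 1) by ring, pow_add q (n * n)]
    have n1 := qz_ne hz.le hq n
    have n2 := qz_ne hz' hq n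
    have n3 : 1 - z * q ^ (2 * n + 2) ≠ 0 := one_sub_ne hz.le hq (by omega)
    have n4 : 1 - x * q ^ (2 * n + 2) ≠ 0 := one_sub_ne hz' hq (by omega)
    generalize 1 - z * q ^ (2 * n + 2) = U at *
    generalize 1 - x * q ^ (2 * n + 2) = V at *
    generalize qz x q n = Y at *
    field_simp
  have hind : ∀ N, 1 + u 0 * S 1 = ∑ n ∈ Finset.range N, d n + d N * (1 + u N * S (N + 1)) := by
    intro N
    induction N with
    | zero => simp [hd, qa, qz]
    | succ N ih =>
      rw [ih, Finset.sum_range_succ]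
      have h1 := hSrec (N + 1) (by omega)
      rw [← h1]
      linear_combination -S (N + 1) * hdrec N
  have hlim : Filter.Tendsto (fun N => ∑ n ∈ Finset.range N, d n + d N * (1 + u N * S (N + 1)))
      Filter.atTop (nhds (Pq q * (∑' j, cj z q j * q ^ (j * j)) + 0)) := by
    apply hds.tendsto_sum_nat.add
    have hd0 := hds.summable.tendsto_atTop_zero
    apply hd0.zero_mul_isBoundedUnder_le
    refine Filter.isBoundedUnder_of ⟨1 + 2 * B * (A * B * (1 - ‖q‖)⁻¹), fun N => ?_⟩
    refine (norm_add_le _ _).trans ?_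
    rw [norm_one, norm_mul]
    have := hub N
    have := hSb (N + 1) (by omega)
    have hp : 0 < (1 - ‖q‖)⁻¹ := inv_pos.mpr (by linarith)
    gcongr
  simp_rw [← hind] at hlim
  have := tendsto_nhds_unique hlim tendsto_const_nhds
  rw [← add_zero (Pq q * _), this]; ring

lemma theta_P {q : ℂ} (hq : ‖q‖ < 1) : Pq q * ∑' j, ej q j * q ^ (j * j) = 1 := by
  have hr0 : 0 ≤ ‖q‖ := norm_nonneg q
  have hb : ∀ j, ‖ej q j‖ ≤ 2 := by
    intro j
    unfold ej
    split_ifs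
    · rw [norm_one]; norm_num
    · simp only [norm_mul, norm_pow, norm_neg, norm_one, one_pow, one_mul]
      have h3 : ‖q‖ ^ (j * (j - 1)) ≤ 1 := pow_le_one₀ hr0 hq.le
      have h4 : ‖1 + q ^ (2 * j)‖ ≤ 2 := (norm_add_le _ _).trans (by
          rw [norm_one, norm_pow]; linarith [pow_le_one₀ (n := 2 * j) hr0 hq.le])
      calc _ ≤ 1 * (2 : ℝ) := by gcongr
        _ = 2 := by ring
  have h1 := bailey hq (ej q) 2 hb
  have h2 := h1.unique (hasSum_single 0 (fun n hn => by
    obtain ⟨M, rfl⟩ := Nat.exists_eq_succ_of_ne_zero hn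
    rw [ej_total hq M, mul_zero]))
  rw [h2]
  simp [ej, qa, qp]

open scoped Classical

lemma hasSum_cg {ι : Type*} {f g : ι → ℂ} {a b : ℂ} (h : HasSum f a) (hf : ∀ i, g i = f i) (ha : b = a) :
    HasSum g b := by
  rw [ha, funext hf]; exact h

open scoped PowerSeries.WithPiTopology in
/-- factor of genFun evaluated -/
lemma factor_coeff (f : ℕ → ℕ → ℂ) (i n : ℕ) :
    PowerSeries.coeff n (1 + ∑' j, f (i + 1) (j + 1) • (PowerSeries.X : PowerSeries ℂ) ^ ((i + 1) * (j + 1))) =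
      if n = 0 then 1 else if (i + 1) ∣ n then f (i + 1) (n / (i + 1)) else 0 := by
  rw [map_add, (Nat.Partition.summable_genFun_term f i).map_tsum _
    (PowerSeries.WithPiTopology.continuous_coeff _ _)]
  simp only [map_smul, PowerSeries.coeff_X_pow, smul_eq_mul, PowerSeries.coeff_one]
  by_cases hn : n = 0
  · subst hn
    simp
  · simp only [hn, if_false, zero_add]
    by_cases hd : (i + 1) ∣ n
    · obtain ⟨c, rfl⟩ := hd
      have hc : c ≠ 0 := by rintro rfl; simp at hn
      obtain ⟨m, rfl⟩ := Nat.exists_eq_succ_of_ne_zero hc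
      rw [if_pos (Dvd.intro _ rfl), tsum_eq_single m]
      · simp
      · intro b hb
        have : ¬ ((i + 1) * (m + 1) = (i + 1) * (b + 1)) := by
          intro h
          have := Nat.eq_of_mul_eq_mul_left (Nat.succ_pos i) h
          omega
        simp only [Nat.succ_eq_add_one, this, if_false, mul_zero]
    · rw [if_neg hd]
      have : ∀ j, ¬ (n = (i + 1) * (j + 1)) := fun j h => hd ⟨_, h⟩
      simp [this]

/-- the power series evaluates absolutely at q to v -/
def HEv (F : PowerSeries ℂ) (q v : ℂ) : Prop :=
  Summable (fun n => ‖PowerSeries.coeff n F * q ^ n‖) ∧ HasSum (fun n => PowerSeries.coeff n F * q ^ n) v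

lemma HEv.one (q : ℂ) : HEv 1 q 1 := by
  have h : ∀ n, n ≠ 0 → PowerSeries.coeff n (1 : PowerSeries ℂ) * q ^ n = 0 := by
    intro n hn; simp [PowerSeries.coeff_one, hn]
  constructor
  · exact (hasSum_single 0 (fun n hn => by rw [h n hn, norm_zero])).summable
  · convert hasSum_single 0 h using 1
    simp

lemma HEv.mul {F G : PowerSeries ℂ} {q v w : ℂ} (hF : HEv F q v) (hG : HEv G q w) :
    HEv (F * G) q (v * w) := by
  have e : ∀ n, PowerSeries.coeff n (F * G) * q ^ n =
      ∑ kl ∈ Finset.HasAntidiagonal.antidiagonal n, (PowerSeries.coeff kl.1 F * q ^ kl.1) *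
        (PowerSeries.coeff kl.2 G * q ^ kl.2) := by
    intro n
    rw [PowerSeries.coeff_mul, Finset.sum_mul]
    apply Finset.sum_congr rfl
    intro kl hkl
    rw [← Finset.HasAntidiagonal.mem_antidiagonal.mp hkl, pow_add]
    ring
  have h1 := summable_norm_sum_mul_antidiagonal_of_summable_norm hF.1 hG.1
  have h2 := tsum_mul_tsum_eq_tsum_sum_antidiagonal_of_summable_norm hF.1 hG.1
  unfold HEv
  simp_rw [e]
  refine ⟨h1, ?_⟩
  rw [← hF.2.tsum_eq, ← hG.2.tsum_eq, h2]
  exact h1.of_norm.hasSum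

lemma HEv.prod (s : Finset ℕ) (F : ℕ → PowerSeries ℂ) (q : ℂ) (v : ℕ → ℂ)
    (h : ∀ i ∈ s, HEv (F i) q (v i)) : HEv (∏ i ∈ s, F i) q (∏ i ∈ s, v i) := by
  induction s using Finset.induction_on with
  | empty => simpa using HEv.one q
  | insert a s ha ih =>
    rw [Finset.prod_insert ha, Finset.prod_insert ha]
    exact (h a (Finset.mem_insert_self _ _)).mul (ih fun i hi => h i (Finset.mem_insert_of_mem hi))

open scoped PowerSeries.WithPiTopology in
lemma HEv.factor (f : ℕ → ℕ → ℂ) (i : ℕ) (q v : ℂ) (hf : f (i + 1) 0 = 1)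
    (hs : Summable (fun j => ‖f (i + 1) j * q ^ ((i + 1) * j)‖))
    (hv : HasSum (fun j => f (i + 1) j * q ^ ((i + 1) * j)) v) :
    HEv (1 + ∑' j, f (i + 1) (j + 1) • (PowerSeries.X : PowerSeries ℂ) ^ ((i + 1) * (j + 1))) q v := by
  unfold HEv
  simp_rw [factor_coeff]
  have hinj : Function.Injective (fun j : ℕ => (i + 1) * j) :=
    fun a b h => Nat.eq_of_mul_eq_mul_left (Nat.succ_pos i) h
  have h0 : ∀ n, n ∉ Set.range (fun j : ℕ => (i + 1) * j) →
      (if n = 0 then 1 else if (i + 1) ∣ n then f (i + 1) (n / (i + 1)) else 0) * q ^ n = 0 := by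
    intro n hn
    have h1 : n ≠ 0 := by rintro rfl; exact hn ⟨0, by simp⟩
    have h2 : ¬ (i + 1) ∣ n := by rintro ⟨c, rfl⟩; exact hn ⟨c, rfl⟩
    simp [h1, h2]
  have h1 : (fun n => (if n = 0 then 1 else if (i + 1) ∣ n then f (i + 1) (n / (i + 1)) else 0) * q ^ n) ∘
      (fun j : ℕ => (i + 1) * j) = fun j => f (i + 1) j * q ^ ((i + 1) * j) := by
    funext j
    by_cases hj : j = 0
    · subst hj; simp [hf]
    · simp [hj]
  constructor
  · rw [← hinj.summable_iff (fun n hn => by rw [h0 n hn, norm_zero])]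
    convert hs using 1
    funext j
    exact congrArg norm (congrFun h1 j)
  · rw [← hinj.hasSum_iff h0, h1]
    exact hv

/-- weights -/
noncomputable def wt (x : ℂ) (L : ℕ) (i c : ℕ) : ℂ :=
  if c = 0 then 1 else if i ≤ 2 * L ∧ (Even i ∨ c ≤ 1) then x ^ c else 0

open scoped PowerSeries.WithPiTopology in
lemma genFun_eval {x q : ℂ} (hx : ‖x‖ ≤ 1) (hq : ‖q‖ < 1) (L : ℕ) :
    HEv (Nat.Partition.genFun (wt x L)) q (GG x q L) := by
  have h1 : Nat.Partition.genFun (wt x L) = ∏ i ∈ Finset.range (2 * L),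
      (1 + ∑' j, wt x L (i + 1) (j + 1) • (PowerSeries.X : PowerSeries ℂ) ^ ((i + 1) * (j + 1))) := by
    refine (Nat.Partition.hasProd_genFun (wt x L)).unique (hasProd_prod_of_ne_finset_one ?_)
    intro i hi
    have : ∀ j, wt x L (i + 1) (j + 1) = 0 := by
      intro j
      rw [wt, if_neg (by omega), if_neg]
      rintro ⟨h, -⟩
      rw [Finset.mem_range] at hi
      omega
    simp [this]
  have h2 : ∏ i ∈ Finset.range (2 * L), (if Even i then (1 + x * q ^ (i + 1)) else (1 - x * q ^ (i + 1))⁻¹) =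
      GG x q L := by
    clear h1
    induction L with
    | zero => simp [GG, qo, qz]
    | succ L ih =>
      rw [show 2 * (L + 1) = 2 * L + 1 + 1 by ring, Finset.prod_range_succ, Finset.prod_range_succ, ih]
      have : ¬ Even (2 * L + 1) := by simp [Nat.even_add_one]
      rw [if_pos (even_two_mul L), if_neg this, GG, GG, qz_succ, qo, qo, Finset.prod_range_succ]
      rw [show 2 * L + 1 + 1 = 2 * L + 2 by ring]
      rw [div_mul_eq_mul_div, div_eq_mul_inv, mul_assoc, div_eq_mul_inv, mul_inv]
      try ring
  rw [h1, ← h2]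
  apply HEv.prod
  intro i hi
  rw [Finset.mem_range] at hi
  have hxq : ‖x * q ^ (i + 1)‖ < 1 := by
    rw [norm_mul, norm_pow]
    exact (mul_le_of_le_one_left (by positivity) hx).trans_lt
      (pow_lt_one₀ (norm_nonneg _) hq (by omega))
  apply HEv.factor
  · simp [wt]
  · apply Summable.of_nonneg_of_le (fun _ => norm_nonneg _) _
      (summable_geometric_of_lt_one (norm_nonneg _) hxq)
    intro j
    unfold wt
    split_ifs with h1 h2
    · subst h1; simp
    · rw [← norm_pow, mul_pow, ← pow_mul]
    · simp; positivity
  · split_ifs with he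
    · have : ∀ j ∉ ({0, 1} : Finset ℕ), wt x L (i + 1) j * q ^ ((i + 1) * j) = 0 := by
        intro j hj
        simp only [Finset.mem_insert, Finset.mem_singleton, not_or] at hj
        rw [wt, if_neg hj.1, if_neg, zero_mul]
        rintro ⟨-, h | h⟩
        · exact (Nat.even_add_one.mp h) he
        · omega
      refine hasSum_cg (hasSum_sum_of_ne_finset_zero this) (fun _ => rfl) ?_
      have h1 : i + 1 ≤ 2 * L := hi
      simp [wt, h1]
    · have he' : Even (i + 1) := Nat.even_add_one.mpr he
      have h1 : ∀ j, wt x L (i + 1) j * q ^ ((i + 1) * j) = (x * q ^ (i + 1)) ^ j := by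
        intro j
        rw [wt]
        have h1 : i + 1 ≤ 2 * L := hi
        by_cases hj : j = 0
        · subst hj; simp
        · rw [if_neg hj, if_pos ⟨h1, Or.inl he'⟩, mul_pow, ← pow_mul]
      simp_rw [h1]
      exact hasSum_geometric_of_norm_lt_one hxq

def lev {n : ℕ} (P : n.Partition) : ℕ := (P.parts.sup + 1) / 2

noncomputable def BB (x : ℂ) (L n : ℕ) : ℂ :=
  ∑ P : n.Partition, if NoRepeatedOddParts P ∧ lev P ≤ L then x ^ (Multiset.card P.parts) else 0

noncomputable def bb (x : ℂ) (L n : ℕ) : ℂ :=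
  ∑ P : n.Partition, if NoRepeatedOddParts P ∧ lev P = L then x ^ (Multiset.card P.parts) else 0

lemma BB_eq (x : ℂ) (L n : ℕ) : PowerSeries.coeff n (Nat.Partition.genFun (wt x L)) = BB x L n := by
  rw [Nat.Partition.coeff_genFun, BB]
  apply Finset.sum_congr rfl
  intro P _
  rw [Finsupp.prod, Multiset.toFinsupp_support]
  simp only [Multiset.toFinsupp_apply]
  have hlev : lev P ≤ L ↔ ∀ b ∈ P.parts, b ≤ 2 * L := by
    rw [← Multiset.sup_le, lev]; omega
  split_ifs with h
  · obtain ⟨h1, h2⟩ := h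
    rw [hlev] at h2
    rw [← Multiset.toFinset_sum_count_eq, ← Finset.prod_pow_eq_pow_sum]
    apply Finset.prod_congr rfl
    intro i hi
    rw [Multiset.mem_toFinset] at hi
    rw [wt, if_neg (Multiset.count_ne_zero.mpr hi), if_pos]
    refine ⟨h2 i hi, ?_⟩
    rcases Nat.even_or_odd i with h | h
    · exact Or.inl h
    · exact Or.inr (h1 i h)
  · rw [hlev, not_and_or] at h
    have : ∃ i ∈ P.parts, ¬ (i ≤ 2 * L ∧ (Even i ∨ P.parts.count i ≤ 1)) := by
      by_contra hcon
      push Not at hcon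
      rcases h with h | h
      · apply h
        intro j hj
        by_cases hjP : j ∈ P.parts
        · rcases (hcon j hjP).2 with h | h
          · exact absurd h (Nat.not_even_iff_odd.mpr hj)
          · exact h
        · rw [Multiset.count_eq_zero_of_notMem hjP]; omega
      · exact h fun b hb => (hcon b hb).1
    obtain ⟨i, hi, hni⟩ := this
    apply Finset.prod_eq_zero (Multiset.mem_toFinset.mpr hi)
    rw [wt, if_neg (Multiset.count_ne_zero.mpr hi), if_neg hni]

lemma bb_zero (x : ℂ) (n : ℕ) : bb x 0 n = BB x 0 n := by simp [bb, BB]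

lemma bb_succ (x : ℂ) (L n : ℕ) : bb x (L + 1) n = BB x (L + 1) n - BB x L n := by
  rw [bb, BB, BB, ← Finset.sum_sub_distrib]
  apply Finset.sum_congr rfl
  intro P _
  by_cases h : NoRepeatedOddParts P
  · simp only [h, true_and]
    by_cases h1 : lev P ≤ L
    · have : ¬ lev P = L + 1 := by omega
      have h2 : lev P ≤ L + 1 := by omega
      simp [h1, this, h2]
    · by_cases h3 : lev P = L + 1
      · simp [h3]
      · have : ¬ lev P ≤ L + 1 := by omega
        simp [h1, h3, this]
  · simp [h]

lemma lev_le {n : ℕ} (P : n.Partition) : lev P ≤ n := by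
  have : P.parts.sup ≤ n := Multiset.sup_le.mpr fun b hb => P.le_of_mem_parts hb
  unfold lev; rcases Nat.eq_zero_or_pos n with h | h <;> omega

/-- number of partitions of n without repeated odd parts -/
noncomputable def cnt (n : ℕ) : ℕ := (Finset.univ.filter fun P : n.Partition => NoRepeatedOddParts P).card

lemma BB_one {L n : ℕ} (h : n ≤ L) : BB 1 L n = cnt n := by
  rw [BB, cnt, Finset.card_eq_sum_ones, Finset.sum_filter]
  push_cast
  apply Finset.sum_congr rfl
  intro P _
  have : lev P ≤ L := (lev_le P).trans h
  simp [this]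

noncomputable def BBr (L n : ℕ) : ℕ := (Finset.univ.filter fun P : n.Partition => NoRepeatedOddParts P ∧ lev P ≤ L).card

lemma BB_one' (L n : ℕ) : BB 1 L n = BBr L n := by
  rw [BB, BBr, Finset.card_eq_sum_ones, Finset.sum_filter]
  push_cast
  simp

lemma cnt_summable {r : ℝ} (hr0 : 0 ≤ r) (hr : r < 1) : Summable (fun n => (cnt n : ℝ) * r ^ n) := by
  have hq : ‖(r : ℂ)‖ < 1 := by simpa [abs_of_nonneg hr0] using hr
  obtain ⟨A, hA, ha⟩ := prod_bound hq
  obtain ⟨B, hB, hb⟩ := qz_inv_bound hq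
  apply summable_of_sum_range_le (c := A * B)
  · intro n; positivity
  · intro N
    have h := (genFun_eval (x := 1) (by simp) hq N)
    have h1 : ‖GG 1 r N‖ ≤ A * B := by
      rw [GG, div_eq_mul_inv, norm_mul]
      have h1 : ‖qo 1 r N‖ ≤ A := by
        have := ha 1 (by simp) 1 N
        simpa [qo, add_comm] using this
      have := hb 1 (by simp) N
      gcongr
    have h2 : HasSum (fun n => (((BBr N n : ℝ) * r ^ n : ℝ) : ℂ)) (GG 1 r N) := by
      convert h.2 using 1
      funext n
      rw [BB_eq, BB_one']
      push_cast; rfl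
    have h3 : Summable (fun n => (BBr N n : ℝ) * r ^ n) := by
      exact_mod_cast h2.summable
    have h4 : ∑' n, (BBr N n : ℝ) * r ^ n ≤ A * B := by
      have h5 := h3.hasSum
      rw [← Complex.hasSum_ofReal] at h5
      have h6 := h5.unique h2
      have := congrArg norm h6
      rw [Complex.norm_real, Real.norm_of_nonneg (tsum_nonneg fun n => by positivity)] at this
      rw [this]; exact h1
    refine le_trans ?_ h4
    refine le_trans ?_ (h3.sum_le_tsum (Finset.range N) (fun n _ => by positivity))
    apply Finset.sum_le_sum
    intro n hn
    have : cnt n = BBr N n := by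
      have h1 := BB_one (Finset.mem_range.mp hn).le
      rw [BB_one'] at h1
      exact_mod_cast h1.symm
    rw [this]

noncomputable def zeta7 : ℂ := Complex.exp (2 * Real.pi * Complex.I / 7)

lemma zeta7_norm : ‖zeta7‖ = 1 := by
  rw [zeta7, show (2 * Real.pi * Complex.I / 7 : ℂ) = ((2 * Real.pi / 7 : ℝ) : ℂ) * Complex.I by push_cast; ring]
  exact Complex.norm_exp_ofReal_mul_I _

lemma zeta7_pow : zeta7 ^ 7 = 1 := by
  rw [zeta7, ← Complex.exp_nat_mul]
  rw [show ((7 : ℕ) : ℂ) * (2 * Real.pi * Complex.I / 7) = 2 * Real.pi * Complex.I by push_cast; ring]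
  exact Complex.exp_two_pi_mul_I

lemma Acoef_eq (n : ℕ) : Acoef 1 7 n =
    ∑ P : n.Partition, if NoRepeatedOddParts P then zeta7 ^ (m2Rank P) else 0 := by
  have hz0 : zeta7 ≠ 0 := by intro h; have := zeta7_norm; simp [h] at this
  have h1 : ∀ r : ℕ, Complex.exp (2 * Real.pi * Complex.I * ((1 : ℤ) : ℂ) * (r : ℂ) / ((7 : ℕ) : ℂ)) =
      zeta7 ^ (r : ℤ) := by
    intro r
    rw [zpow_natCast, zeta7, ← Complex.exp_nat_mul]
    congr 1; push_cast; ring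
  unfold Acoef N2
  simp_rw [h1, Nat.card_eq_fintype_card, Fintype.card_subtype, Finset.card_eq_sum_ones, Finset.sum_filter]
  push_cast
  simp_rw [Finset.sum_mul]
  rw [Finset.sum_comm]
  apply Finset.sum_congr rfl
  intro P _
  by_cases h : NoRepeatedOddParts P
  · simp only [h, true_and, if_true]
    set k := m2Rank P
    have hk : ((k % 7).toNat : ℤ) = k % 7 := Int.toNat_of_nonneg (Int.emod_nonneg _ (by norm_num))
    rw [Finset.sum_eq_single (k % 7).toNat]
    · rw [if_pos, one_mul, hk]
      · conv_rhs => rw [← Int.emod_add_mul_ediv k 7, zpow_add₀ hz0, zpow_mul]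
        have : zeta7 ^ (7 : ℤ) = 1 := by exact_mod_cast zeta7_pow
        rw [this, one_zpow, mul_one]
      · rw [hk]; exact (Int.mod_modEq k 7).symm
    · intro b hb hne
      rw [if_neg, zero_mul]
      intro hcon
      apply hne
      have hb' := Finset.mem_range.mp hb
      have : k % 7 = (b : ℤ) % 7 := hcon
      omega
    · intro hn
      exfalso; apply hn
      rw [Finset.mem_range]
      have := Int.emod_lt_of_pos k (show (0 : ℤ) < 7 by norm_num)
      omega
  · simp [h]

lemma Acoef_gen {q : ℂ} (hq : ‖q‖ < 1) :
    Summable (fun n => ‖Acoef 1 7 n * q ^ n‖) ∧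
    HasSum (fun n => Acoef 1 7 n * q ^ n) (Pq q * ∑' j, cj zeta7 q j * q ^ (j * j)) := by
  have hz := zeta7_norm
  have hz0 : zeta7 ≠ 0 := by intro h; simp [h] at hz
  set z := zeta7
  have hz' : ‖z⁻¹‖ ≤ 1 := by rw [norm_inv, hz, inv_one]
  have hb : ∀ n L, ‖bb z⁻¹ L n‖ ≤ ((Finset.univ.filter fun P : n.Partition => NoRepeatedOddParts P ∧ lev P = L).card : ℝ) := by
    intro n L
    rw [bb, Finset.card_eq_sum_ones, Finset.sum_filter]
    push_cast
    refine (norm_sum_le _ _).trans (Finset.sum_le_sum fun P _ => ?_)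
    split_ifs
    · rw [norm_pow, norm_inv, hz]; simp
    · simp
  have hsum : ∀ n, ∑ L ∈ Finset.range (n + 1), ((Finset.univ.filter fun P : n.Partition => NoRepeatedOddParts P ∧ lev P = L).card : ℝ) = cnt n := by
    intro n
    rw [cnt, ← Nat.cast_sum]
    congr 1
    rw [Finset.card_eq_sum_card_fiberwise (f := lev) (t := Finset.range (n + 1))]
    · apply Finset.sum_congr rfl
      intro L _
      rw [Finset.filter_filter]
    · intro P _
      simp only [Finset.coe_range, Set.mem_Iio]
      exact Nat.lt_succ_of_le (lev_le P)
  have hb0 : ∀ n L, n < L → bb z⁻¹ L n = 0 := by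
    intro n L h
    rw [bb]
    apply Finset.sum_eq_zero
    intro P _
    rw [if_neg]
    rintro ⟨-, h2⟩
    have := lev_le P; omega
  set F : ℕ × ℕ → ℂ := fun nL => z ^ nL.2 * bb z⁻¹ nL.2 nL.1 * q ^ nL.1 with hF
  have hrow : ∀ n, HasSum (fun L => F (n, L)) (Acoef 1 7 n * q ^ n) := by
    intro n
    have h1 : ∀ L ∉ Finset.range (n + 1), F (n, L) = 0 := by
      intro L hL
      simp only [hF]
      rw [hb0 n L (by simpa [Nat.lt_succ_iff] using hL)]; ring
    refine hasSum_cg (hasSum_sum_of_ne_finset_zero h1) (fun _ => rfl) ?_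
    simp only [hF]
    rw [← Finset.sum_mul]
    congr 1
    rw [Acoef_eq]
    simp_rw [bb, Finset.mul_sum]
    rw [Finset.sum_comm]
    apply Finset.sum_congr rfl
    intro P _
    by_cases h : NoRepeatedOddParts P
    · simp only [h, if_true, true_and]
      rw [Finset.sum_eq_single (lev P)]
      · rw [if_pos rfl, m2Rank, zpow_sub₀ hz0, zpow_natCast, zpow_natCast, inv_pow, lev, div_eq_mul_inv]
      · intro b _ hb; rw [if_neg (Ne.symm hb), mul_zero]
      · intro hn; exact absurd (Finset.mem_range.mpr (Nat.lt_succ_of_le (lev_le P))) hn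
    · simp [h]
  have hnorm : ∀ n, Summable (fun L => ‖F (n, L)‖) ∧ ∑' L, ‖F (n, L)‖ ≤ cnt n * ‖q‖ ^ n := by
    intro n
    have h1 : ∀ L ∉ Finset.range (n + 1), ‖F (n, L)‖ = 0 := by
      intro L hL
      simp only [hF]
      rw [hb0 n L (by simpa [Nat.lt_succ_iff] using hL)]; simp
    refine ⟨(hasSum_sum_of_ne_finset_zero h1).summable, ?_⟩
    rw [tsum_eq_sum h1, ← hsum n, Finset.sum_mul]
    apply Finset.sum_le_sum
    intro L _
    simp only [hF, norm_mul, norm_pow, hz, one_pow, one_mul]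
    gcongr
    exact hb n L
  have hcs := cnt_summable (norm_nonneg q) hq
  have hFs : Summable (fun p => ‖F p‖) := by
    rw [summable_prod_of_nonneg (fun _ => norm_nonneg _)]
    exact ⟨fun n => (hnorm n).1, Summable.of_nonneg_of_le (fun n => tsum_nonneg fun _ => norm_nonneg _)
      (fun n => (hnorm n).2) hcs⟩
  have hFt := hFs.of_norm.hasSum
  have hA : HasSum (fun n => Acoef 1 7 n * q ^ n) (∑' p, F p) := hFt.prod_fiberwise hrow
  refine ⟨?_, ?_⟩
  · refine Summable.of_nonneg_of_le (fun _ => norm_nonneg _) (fun n => ?_) hcs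
    rw [← (hrow n).tsum_eq]
    exact (norm_tsum_le_tsum_norm (hnorm n).1).trans (hnorm n).2
  · have hGn : ∀ L, HasSum (fun n => BB z⁻¹ L n * q ^ n) (GG z⁻¹ q L) := by
      intro L
      have := (genFun_eval hz' hq L).2
      simp_rw [BB_eq] at this
      exact this
    have hcol : ∀ L, HasSum (fun n => F (n, L)) (z ^ L * (if L = 0 then 1 else GG z⁻¹ q L - GG z⁻¹ q (L - 1))) := by
      intro L
      simp only [hF]
      cases L with
      | zero =>
        have := hGn 0
        simp only [bb_zero, pow_zero, one_mul, if_true]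
        simpa [GG, qo, qz] using this
      | succ L =>
        rw [if_neg (by omega), Nat.add_sub_cancel]
        have := ((hGn (L + 1)).sub (hGn L)).mul_left (z ^ (L + 1))
        refine hasSum_cg this (fun n => ?_) rfl
        rw [bb_succ]; ring
    have hFt' := ((Equiv.prodComm ℕ ℕ).hasSum_iff.mpr hFt)
    have hB := hFt'.prod_fiberwise hcol
    have hfine := fine hq hz
    have hB' : HasSum (fun L => z ^ L * (if L = 0 then 1 else GG z⁻¹ q L - GG z⁻¹ q (L - 1)))
      (Pq q * ∑' j, cj z q j * q ^ (j * j)) := by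
      rw [← hasSum_nat_add_iff' 1]
      simpa using hfine
    rw [hB.unique hB'] at hA
    exact hA

open scoped Classical
open Filter Topology MeasureTheory

/-- The two-sided Lerch-type term. -/
noncomputable def lz (z q : ℂ) (j : ℤ) : ℂ := (-1) ^ j * q ^ (2 * j ^ 2 + j) / (1 - z * q ^ (2 * j))

lemma lz_pair {z q : ℂ} (hq : ‖q‖ < 1) (hq0 : q ≠ 0) (hz : ‖z‖ = 1) (n : ℕ) (hn : n ≠ 0) :
    cj z q n * q ^ (n * n) = (1 - z) * (lz z q n + lz z q (-n)) := by
  have hz0 : z ≠ 0 := by rintro rfl; simp at hz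
  have h1 : 1 - z * q ^ (2 * n) ≠ 0 := one_sub_ne hz.le hq (by omega)
  have h2 : 1 - z⁻¹ * q ^ (2 * n) ≠ 0 := one_sub_ne (by rw [norm_inv, hz]; simp) hq (by omega)
  have e1 : lz z q n = (-1) ^ n * q ^ (n * n) * q ^ (n * n) * q ^ n / (1 - z * q ^ (2 * n)) := by
    unfold lz
    have : (2 * (n : ℤ) ^ 2 + n) = ((n * n + n * n + n : ℕ) : ℤ) := by push_cast; ring
    rw [this]
    have : (2 * (n : ℤ)) = ((2 * n : ℕ) : ℤ) := by push_cast; ring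
    rw [this]
    simp only [zpow_natCast, pow_add]; ring
  have e2 : lz z q (-n) = (-1) ^ n * q ^ (n * n) * q ^ (n * n) * q ^ n * (-z⁻¹) / (1 - z⁻¹ * q ^ (2 * n)) := by
    unfold lz
    have t1 : (2 * (-(n : ℤ)) ^ 2 + -n) = ((n * n + n * n : ℕ) : ℤ) - (n : ℕ) := by push_cast; ring
    have t2 : (2 * (-(n : ℤ))) = -((2 * n : ℕ) : ℤ) := by push_cast; ring
    have t3 : ((-1 : ℂ) ^ (-(n : ℤ))) = (-1) ^ n := by
      rw [zpow_neg, zpow_natCast, ← inv_pow]; norm_num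
    rw [t1, t2, t3, zpow_sub₀ hq0, zpow_neg]
    simp only [zpow_natCast]
    have hqn : q ^ n ≠ 0 := pow_ne_zero _ hq0
    have hq2 : q ^ (2 * n) = q ^ n * q ^ n := by rw [two_mul, pow_add]
    rw [pow_add]
    rw [hq2] at h1 h2 ⊢
    have h3 : 1 - z * (q ^ n * q ^ n)⁻¹ ≠ 0 := by
      intro h
      apply h2
      field_simp at h ⊢
      linear_combination -h
    have h4 : z - q ^ n * q ^ n ≠ 0 := by
      intro h; apply h2; field_simp; linear_combination h
    have h5 : q ^ n * q ^ n - z ≠ 0 := by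
      intro h; apply h4; linear_combination -h
    rw [div_eq_div_iff h3 h2]
    field_simp
    ring
  rw [e1, e2, cj, if_neg hn]
  have hq2 : q ^ (n * (n + 1)) = q ^ (n * n) * q ^ n := by rw [← pow_add]; ring_nf
  rw [hq2, div_add_div _ _ h1 h2, div_mul_eq_mul_div, mul_div_assoc']
  congr 1
  field_simp
  ring

lemma Lam_eq {z q : ℂ} (hq : ‖q‖ < 1) (hq0 : q ≠ 0) (hz : ‖z‖ = 1) (hz1 : z ≠ 1)
    (hs : Summable (lz z q)) :
    ∑' j, cj z q j * q ^ (j * j) = (1 - z) * ∑' j : ℤ, lz z q j := by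
  have h1 := (hs.hasSum.nat_add_neg).mul_left (1 - z)
  have h0 : HasSum (fun n : ℕ => if n = 0 then (1 : ℂ) else 0) 1 := hasSum_ite_eq 0 1
  have h2 := h1.sub h0
  have hz2 : 1 - z ≠ 0 := sub_ne_zero.mpr (Ne.symm hz1)
  have l0 : lz z q 0 = 1 / (1 - z) := by simp [lz]
  refine (hasSum_cg h2 (fun n => ?_) ?_).tsum_eq
  · by_cases hn : n = 0
    · subst hn
      simp [cj, l0]; field_simp; ring
    · rw [lz_pair hq hq0 hz n hn]; simp [hn]
  · rw [l0]; field_simp; ring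

lemma tet_eq {q : ℂ}
    (hs : Summable (lz 0 q)) :
    ∑' j, ej q j * q ^ (j * j) = ∑' j : ℤ, lz 0 q j := by
  have h1 := hs.hasSum.nat_add_neg
  have h0 : HasSum (fun n : ℕ => if n = 0 then (1 : ℂ) else 0) 1 := hasSum_ite_eq 0 1
  have h2 := h1.sub h0
  have l0 : lz 0 q 0 = 1 := by simp [lz]
  refine (hasSum_cg h2 (fun n => ?_) ?_).tsum_eq
  · by_cases hn : n = 0
    · subst hn
      simp [ej, l0]
    · obtain ⟨m, rfl⟩ := Nat.exists_eq_succ_of_ne_zero hn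
      simp only [ej, lz, hn, if_false]
      have t1 : (2 * ((m.succ : ℕ) : ℤ) ^ 2 + (m.succ : ℕ)) = ((m.succ * m + m.succ * m.succ + 2 * m.succ : ℕ) : ℤ) := by push_cast; ring
      have t2 : (2 * (-((m.succ : ℕ) : ℤ)) ^ 2 + -(m.succ : ℕ)) = ((m.succ * m + m.succ * m.succ : ℕ) : ℤ) := by push_cast; ring
      have t3 : ((-1 : ℂ) ^ (-((m.succ : ℕ) : ℤ))) = (-1) ^ m.succ := by
        rw [zpow_neg, zpow_natCast, ← inv_pow]; norm_num
      rw [t1, t2, t3]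
      simp only [zpow_natCast, pow_add, Nat.succ_sub_one]
      ring
  · rw [l0]; ring

lemma Lam_trivial {z q : ℂ} (hq : ‖q‖ < 1) (hz : ‖z‖ = 1) :
    ‖∑' j, cj z q j * q ^ (j * j)‖ ≤ 8 / (1 - ‖q‖) ^ 3 := by
  set r := ‖q‖ with hr
  have hr0 : 0 ≤ r := norm_nonneg q
  have hb : ∀ j, ‖cj z q j * q ^ (j * j)‖ ≤ 8 / (1 - r) ^ 2 * r ^ j := by
    intro j
    have hjj : r ^ (j * j) ≤ r ^ j := pow_le_pow_of_le_one hr0 hq.le (Nat.le_mul_self j)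
    have hp : (0:ℝ) < 1 - r := by linarith
    rw [norm_mul, norm_pow]
    refine mul_le_mul ?_ hjj (by positivity) (by positivity)
    unfold cj
    split_ifs with hj
    · rw [norm_one, le_div_iff₀ (by positivity)]; nlinarith
    · have hz' : ‖z⁻¹‖ = 1 := by rw [norm_inv, hz]; simp
      obtain ⟨a1, a2⟩ := one_sub_norm_lower (k := 2 * j) hz.le hq (by omega)
      obtain ⟨b1, b2⟩ := one_sub_norm_lower (k := 2 * j) hz'.le hq (by omega)
      have hrj : r ^ (2 * j) ≤ r := by simpa using pow_le_pow_of_le_one hr0 hq.le (show 1 ≤ 2 * j by omega)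
      have c1 : 1 - r ≤ ‖1 - z * q ^ (2 * j)‖ := by linarith
      have c2 : 1 - r ≤ ‖1 - z⁻¹ * q ^ (2 * j)‖ := by linarith
      rw [norm_div]
      refine div_le_div₀ (by norm_num) ?_ (by positivity) ?_
      · simp only [norm_mul, norm_pow, norm_neg, norm_one, one_pow, one_mul]
        have d1 : ‖q‖ ^ (j * (j + 1)) ≤ 1 := pow_le_one₀ hr0 hq.le
        have d2 : ‖1 + q ^ (2 * j)‖ ≤ 2 := by
          refine (norm_add_le _ _).trans ?_
          rw [norm_one, norm_pow]; have : ‖q‖ ^ (2 * j) ≤ 1 := pow_le_one₀ hr0 hq.le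
          linarith
        have d3 : ‖1 - z‖ ≤ 2 := by
          refine (norm_sub_le _ _).trans ?_
          rw [norm_one, hz]; norm_num
        have d4 : ‖1 - z⁻¹‖ ≤ 2 := by
          refine (norm_sub_le _ _).trans ?_
          rw [norm_one, hz']; norm_num
        calc ‖q‖ ^ (j * (j + 1)) * ‖1 + q ^ (2 * j)‖ * (‖1 - z‖ * ‖1 - z⁻¹‖) ≤ 1 * 2 * (2 * 2) := by gcongr
          _ = 8 := by norm_num
      · rw [norm_mul, sq]
        exact mul_le_mul c1 c2 hp.le (norm_nonneg _)
  have hg := (hasSum_geometric_of_lt_one hr0 hq).mul_left (8 / (1 - r) ^ 2)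
  refine (tsum_of_norm_bounded hg hb).trans (le_of_eq ?_)
  have hp : (1:ℝ) - r ≠ 0 := by linarith
  field_simp

open scoped Classical
open Filter Topology MeasureTheory

noncomputable def tauq (q : ℂ) (m : ℕ) : ℂ := (1 / (m : ℂ)) * (-(-q) ^ m / (1 + (-q) ^ m))

lemma inv_exp_sub_le {r σ : ℝ} (hr : r = Real.exp (-σ)) (hσ : 0 < σ) (m : ℕ) (hm : m ≠ 0) :
    r ^ m / (1 - r ^ m) ≤ 1 / (m * σ) := by
  have h1 : r ^ m = (Real.exp (m * σ))⁻¹ := by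
    rw [hr, ← Real.exp_nat_mul, ← Real.exp_neg]; ring_nf
  have hm' : (0:ℝ) < m := by positivity
  have h2 : m * σ + 1 ≤ Real.exp (m * σ) := Real.add_one_le_exp _
  have h3 : 0 < m * σ := by positivity
  rw [h1]
  have h4 : (0:ℝ) < Real.exp (m * σ) - 1 := by linarith
  have : (Real.exp (m * σ))⁻¹ / (1 - (Real.exp (m * σ))⁻¹) = 1 / (Real.exp (m * σ) - 1) := by
    field_simp
  rw [this]
  exact one_div_le_one_div_of_le h3 (by linarith)

lemma one_add_neg_pow_ne {q : ℂ} (hq : ‖q‖ < 1) (m : ℕ) (hm : m ≠ 0) : 1 + (-q) ^ m ≠ 0 := by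
  have := one_sub_ne (z := -1) (q := -q) (by simp) (by simpa using hq) hm
  simpa using this

lemma tau_bound {q : ℂ} {σ : ℝ} (hr : ‖q‖ = Real.exp (-σ)) (hσ : 0 < σ) (m : ℕ) :
    ‖tauq q m‖ ≤ 1 / (σ * m ^ 2) := by
  rcases Nat.eq_zero_or_pos m with rfl | hm
  · simp [tauq]
  have hq : ‖q‖ < 1 := by rw [hr]; exact Real.exp_lt_one_iff.mpr (by linarith)
  obtain ⟨h1, h2⟩ := one_sub_norm_lower (z := -1) (q := -q) (by simp) (by simpa using hq) hm.ne'
  have h3 := inv_exp_sub_le hr hσ m hm.ne'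
  have hm' : (0:ℝ) < m := by positivity
  rw [norm_neg] at h1 h2
  have h4 : ‖-(-q) ^ m / (1 + (-q) ^ m)‖ ≤ ‖q‖ ^ m / (1 - ‖q‖ ^ m) := by
    rw [norm_div, norm_neg, norm_pow, norm_neg]
    have : (1 : ℂ) - -1 * (-q) ^ m = 1 + (-q) ^ m := by ring
    rw [this] at h1
    gcongr
  rw [tauq, norm_mul]
  have : ‖(1 / (m : ℂ))‖ = 1 / m := by simp
  rw [this]
  calc (1 / (m:ℝ)) * ‖-(-q) ^ m / (1 + (-q) ^ m)‖ ≤ (1 / m) * (1 / (m * σ)) := by gcongr; exact h4.trans h3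
    _ = 1 / (σ * m ^ 2) := by field_simp

lemma tau_good {q : ℂ} {σ K : ℝ} (hr : ‖q‖ < 1) (hσ : 0 < σ) (hK : 0 < K) (m : ℕ)
    (hg : K * m * σ ≤ ‖1 + (-q) ^ m‖) :
    ‖tauq q m‖ ≤ 1 / (K * (σ * m ^ 2)) := by
  rcases Nat.eq_zero_or_pos m with rfl | hm
  · simp [tauq]
  have hm' : (0:ℝ) < m := by positivity
  rw [tauq, norm_mul, norm_div, norm_div, norm_neg, norm_pow, norm_neg]
  have h1 : ‖q‖ ^ m ≤ 1 := pow_le_one₀ (norm_nonneg _) hr.le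
  simp only [norm_one, Complex.norm_natCast]
  calc 1 / (m:ℝ) * (‖q‖ ^ m / ‖1 + (-q) ^ m‖) ≤ 1 / m * (1 / (K * m * σ)) := by gcongr
    _ = _ := by field_simp

lemma tau_summable {q : ℂ} {σ : ℝ} (hr : ‖q‖ = Real.exp (-σ)) (hσ : 0 < σ) :
    Summable (fun m => ‖tauq q m‖) := by
  refine Summable.of_nonneg_of_le (fun _ => norm_nonneg _) (tau_bound hr hσ) ?_
  have := (Real.summable_one_div_nat_pow.mpr (show 1 < 2 by norm_num)).mul_left (1 / σ)
  refine this.congr fun m => ?_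
  ring

lemma Pq_partial {q : ℂ} (hq : ‖q‖ < 1) (k : ℕ) :
    qa q k / qp q k = Complex.exp (∑' m, tauq q m * (1 - q ^ (2 * m * k))) := by
  have hterm : ∀ i : ℕ, HasSum (fun m : ℕ => (-(-(q ^ (2 * i + 1))) ^ m + (q ^ (2 * i + 2)) ^ m) / (m : ℂ))
      (Complex.log (1 + q ^ (2 * i + 1)) - Complex.log (1 - q ^ (2 * i + 2))) := by
    intro i
    have a1 : ‖-(q ^ (2 * i + 1))‖ < 1 := by
      rw [norm_neg, norm_pow]; exact pow_lt_one₀ (norm_nonneg _) hq (by omega)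
    have a2 : ‖(q ^ (2 * i + 2))‖ < 1 := by
      rw [norm_pow]; exact pow_lt_one₀ (norm_nonneg _) hq (by omega)
    have b1 := (Complex.hasSum_taylorSeries_neg_log a1).neg
    have b2 := (Complex.hasSum_taylorSeries_neg_log a2)
    refine hasSum_cg (b1.add b2) (fun m => ?_) ?_
    · ring
    · rw [sub_neg_eq_add]; ring
  have hs := hasSum_sum (s := Finset.range k) (fun i _ => hterm i)
  have hs2 : HasSum (fun m => tauq q m * (1 - q ^ (2 * m * k)))
      (∑ i ∈ Finset.range k, (Complex.log (1 + q ^ (2 * i + 1)) - Complex.log (1 - q ^ (2 * i + 2)))) := by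
    refine hasSum_cg hs (fun m => ?_) rfl
    rcases Nat.eq_zero_or_pos m with rfl | hm
    · simp [tauq]
    have hmne := one_add_neg_pow_ne hq m hm.ne'
    have hgeo : (∑ i ∈ Finset.range k, (q ^ (2 * m)) ^ i) * (1 - q ^ (2 * m)) = 1 - q ^ (2 * m * k) := by
      rw [pow_mul q (2 * m) k]
      exact geom_sum_mul_neg _ _
    rw [← Finset.sum_div]
    have e1 : ∀ i ∈ Finset.range k, (-(-(q ^ (2 * i + 1))) ^ m + (q ^ (2 * i + 2)) ^ m) =
        (-(-q) ^ m + q ^ (2 * m)) * (q ^ (2 * m)) ^ i := by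
      intro i _
      have : (-(q ^ (2 * i + 1))) = (-q) * q ^ (2 * i) := by ring
      rw [this, mul_pow, ← pow_mul, ← pow_mul, ← pow_mul]
      ring
    rw [Finset.sum_congr rfl e1, ← Finset.mul_sum, ← hgeo, tauq]
    have e2 : q ^ (2 * m) = (-q) ^ m * (-q) ^ m := by rw [← pow_add, ← two_mul, pow_mul, pow_mul, neg_sq]
    rw [e2]
    have hm' : (m : ℂ) ≠ 0 := by exact_mod_cast hm.ne'
    field_simp
    ring
  rw [hs2.tsum_eq, Complex.exp_sum, qa, qp, ← Finset.prod_div_distrib]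
  refine Finset.prod_congr rfl fun i _ => ?_
  rw [Complex.exp_sub, Complex.exp_log, Complex.exp_log]
  · exact one_sub_ne' hq (by omega)
  · have := one_sub_ne (z := -1) (by simp) hq (show 2 * i + 1 ≠ 0 by omega)
    simpa using this

lemma Pq_exp {q : ℂ} {σ : ℝ} (hr : ‖q‖ = Real.exp (-σ)) (hσ : 0 < σ) :
    Pq q = Complex.exp (∑' m, tauq q m) := by
  have hq : ‖q‖ < 1 := by rw [hr]; exact Real.exp_lt_one_iff.mpr (by linarith)
  have h1 := Pq_lim hq 0
  simp only [mul_zero, zero_add] at h1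
  refine tendsto_nhds_unique h1 ?_
  simp only [Pq_partial hq]
  refine (Complex.continuous_exp.tendsto _).comp ?_
  have hsum := tau_summable hr hσ
  refine tendsto_tsum_of_dominated_convergence (bound := fun m => 2 * ‖tauq q m‖) (hsum.mul_left 2) ?_ ?_
  · intro m
    rcases Nat.eq_zero_or_pos m with rfl | hm
    · simp [tauq]
    have : Tendsto (fun k => (q ^ (2 * m)) ^ k) atTop (nhds 0) :=
      tendsto_pow_atTop_nhds_zero_of_norm_lt_one (by
        rw [norm_pow]; exact pow_lt_one₀ (norm_nonneg _) hq (by omega))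
    simp only [pow_mul]
    simp only [pow_mul] at this
    simpa using (this.const_sub 1).const_mul (tauq q m)
  · refine Eventually.of_forall fun k m => ?_
    rw [norm_mul, mul_comm]
    gcongr
    refine (norm_sub_le _ _).trans ?_
    rw [norm_one, norm_pow]
    have : ‖q‖ ^ (2 * m * k) ≤ 1 := pow_le_one₀ (norm_nonneg _) hq.le
    linarith

open scoped Classical
open Filter Topology MeasureTheory

lemma pow_sub_one_le {a : ℂ} (ha : ‖a‖ ≤ 1) (m : ℕ) : ‖a ^ m - 1‖ ≤ m * ‖a - 1‖ := by
  rw [← geom_sum_mul a m, norm_mul]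
  gcongr
  refine (norm_sum_le _ _).trans ?_
  refine (Finset.sum_le_card_nsmul _ _ 1 fun i _ => ?_).trans (by simp)
  rw [norm_pow]; exact pow_le_one₀ (norm_nonneg _) ha

/-- if `a^m ≈ -1` and `a^(m+d) ≈ -1` then `a^d ≈ 1`. -/
lemma near_step {a : ℂ} {e : ℝ} (he : e ≤ 1 / 2) (m d : ℕ) (h1 : ‖1 + a ^ m‖ < e) (h2 : ‖1 + a ^ (m + d)‖ < e) :
    ‖a ^ d - 1‖ ≤ 4 * e := by
  have h3 : ‖a ^ m‖ * ‖a ^ d - 1‖ ≤ 2 * e := by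
    rw [← norm_mul]
    have : a ^ m * (a ^ d - 1) = (1 + a ^ (m + d)) - (1 + a ^ m) := by ring
    rw [this]
    refine (norm_sub_le _ _).trans (by linarith)
  have h4 : (1:ℝ) / 2 ≤ ‖a ^ m‖ := by
    have : (1:ℝ) - ‖1 + a ^ m‖ ≤ ‖a ^ m‖ := by
      have := norm_sub_le (1 + a ^ m) (a ^ m)
      simp only [add_sub_cancel_right, norm_one] at this
      linarith
    linarith
  nlinarith [norm_nonneg (a ^ d - 1)]

lemma no_gap_one {a : ℂ} (ha : ‖a‖ ≤ 1) {e : ℝ} (he : e * 1000 ≤ 1) (m : ℕ) (hm : m ≤ 30)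
    (h1 : ‖1 + a ^ m‖ < e) (h2 : ‖1 + a ^ (m + 1)‖ < e) : False := by
  have h3 := near_step (by linarith) m 1 h1 h2
  rw [pow_one] at h3
  have h4 := pow_sub_one_le ha m
  have hm' : (m : ℝ) ≤ 30 := by exact_mod_cast hm
  have h5 : (2:ℝ) ≤ ‖1 + a ^ m‖ + ‖a ^ m - 1‖ := by
    have := norm_sub_le (1 + a ^ m) (a ^ m - 1)
    have e1 : (1 + a ^ m) - (a ^ m - 1) = 2 := by ring
    rw [e1] at this; simpa using this
  have : ‖a ^ m - 1‖ ≤ 30 * (4 * e) := h4.trans (by gcongr)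
  linarith

lemma no_gap_two {a : ℂ} (ha : ‖a‖ ≤ 1) {e : ℝ} (he : e * 1000 ≤ 1) (m : ℕ) (hm : m ≤ 30)
    (h1 : ‖1 + a ^ m‖ < e) (h2 : ‖1 + a ^ (m + 2)‖ < e) : ‖1 + a‖ ≤ 61 * e := by
  have h3 := near_step (by linarith) m 2 h1 h2
  have ha2 : ‖a ^ 2‖ ≤ 1 := by rw [norm_pow]; exact pow_le_one₀ (norm_nonneg _) ha
  have h4 : ∀ l : ℕ, l ≤ 15 → ‖(a ^ 2) ^ l - 1‖ ≤ 60 * e := by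
    intro l hl
    have hl' : (l : ℝ) ≤ 15 := by exact_mod_cast hl
    refine (pow_sub_one_le ha2 l).trans ?_
    calc (l:ℝ) * ‖a ^ 2 - 1‖ ≤ 15 * (4 * e) := by gcongr
      _ = _ := by ring
  rcases Nat.even_or_odd' m with ⟨l, rfl | rfl⟩
  · have h5 := h4 l (by omega)
    rw [← pow_mul] at h5
    have h6 : (2:ℝ) ≤ ‖1 + a ^ (2 * l)‖ + ‖a ^ (2 * l) - 1‖ := by
      have := norm_sub_le (1 + a ^ (2 * l)) (a ^ (2 * l) - 1)
      have e1 : (1 + a ^ (2 * l)) - (a ^ (2 * l) - 1) = 2 := by ring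
      rw [e1] at this; simpa using this
    linarith
  · have h5 := h4 l (by omega)
    have e1 : 1 + a = (1 + a ^ (2 * l + 1)) - a * ((a ^ 2) ^ l - 1) := by ring
    rw [e1]
    refine (norm_sub_le _ _).trans ?_
    rw [norm_mul]
    have : ‖a‖ * ‖(a ^ 2) ^ l - 1‖ ≤ 1 * (60 * e) := by gcongr
    linarith

lemma tail_sq (n : ℕ) : ∑ i ∈ Finset.range n, 1 / ((i : ℝ) + 30) ^ 2 ≤ 1 / 29 - 1 / ((n : ℝ) + 29) := by
  induction n with
  | zero => simp
  | succ n ih =>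
    rw [Finset.sum_range_succ]
    have : 1 / ((n : ℝ) + 30) ^ 2 ≤ 1 / ((n : ℝ) + 29) - 1 / ((n : ℝ) + 30) := by
      rw [div_sub_div _ _ (by positivity) (by positivity), div_le_div_iff₀ (by positivity) (by positivity)]
      nlinarith
    push_cast
    have e : (n : ℝ) + 1 + 29 = n + 30 := by ring
    rw [e]; linarith

set_option maxHeartbeats 1000000 in
lemma Pq_upper {q : ℂ} {σ : ℝ} (hr : ‖q‖ = Real.exp (-σ)) (hσ : 0 < σ) (hσ1 : σ ≤ 1 / 10 ^ 7)
    (h1 : 300000 * σ ≤ ‖q - 1‖) :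
    ‖Pq q‖ ≤ Real.exp ((tauq q 2).re + 0.2195 / σ) := by
  have hq : ‖q‖ < 1 := by rw [hr]; exact Real.exp_lt_one_iff.mpr (by linarith)
  have ha : ‖-q‖ ≤ 1 := by rw [norm_neg]; exact hq.le
  have hsum := tau_summable hr hσ
  have hsumc : Summable (tauq q) := hsum.of_norm
  rw [Pq_exp hr hσ, Complex.norm_exp]
  apply Real.exp_le_exp.mpr
  have hsre : Summable fun m => (tauq q m).re := Complex.reCLM.summable hsumc
  rw [Complex.re_tsum hsumc, ← hsre.sum_add_tsum_nat_add 30]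
  -- tail
  have htail : ∑' i, (tauq q (i + 30)).re ≤ (1 / 29) / σ := by
    have hs2 : Summable fun i : ℕ => 1 / ((i : ℝ) + 30) ^ 2 :=
      summable_of_sum_range_le (c := 1 / 29) (fun i => by positivity) (fun n => by
        have := tail_sq n
        have : (0:ℝ) ≤ 1 / ((n : ℝ) + 29) := by positivity
        linarith)
    have hle : ∑' i : ℕ, 1 / ((i : ℝ) + 30) ^ 2 ≤ 1 / 29 :=
      Real.tsum_le_of_sum_range_le (fun i => by positivity) (fun n => by
        have := tail_sq n
        have : (0:ℝ) ≤ 1 / ((n : ℝ) + 29) := by positivity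
        linarith)
    calc ∑' i, (tauq q (i + 30)).re ≤ ∑' i : ℕ, (1 / σ) * (1 / ((i : ℝ) + 30) ^ 2) := by
          refine Summable.tsum_le_tsum (fun i => ?_) ((summable_nat_add_iff 30).mpr hsre)
            (hs2.mul_left _)
          refine (Complex.re_le_norm _).trans ((tau_bound hr hσ _).trans (le_of_eq ?_))
          push_cast
          field_simp
      _ = (1 / σ) * ∑' i : ℕ, 1 / ((i : ℝ) + 30) ^ 2 := tsum_mul_left
      _ ≤ (1 / σ) * (1 / 29) := by gcongr
      _ = _ := by ring
  let B : ℕ → ℝ := fun m => if ‖1 + (-q) ^ m‖ < 100 * m * σ then 1 else 0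
  have hB0 : ∀ m, 0 ≤ B m := fun m => by simp only [B]; split_ifs <;> norm_num
  have hB : ∀ m, 1 ≤ m → (tauq q m).re ≤ (0.01 / m ^ 2 + B m / m ^ 2) * (1 / σ) := by
    intro m hm
    have hm' : (0:ℝ) < m := by positivity
    refine (Complex.re_le_norm _).trans ?_
    simp only [B]
    split_ifs with h
    · refine (tau_bound hr hσ m).trans ?_
      have : 1 / (σ * m ^ 2) = (1 / (m:ℝ) ^ 2) * (1 / σ) := by field_simp
      rw [this]
      gcongr
      have : (0:ℝ) ≤ 0.01 / m ^ 2 := by positivity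
      linarith
    · refine (tau_good (K := 100) hq hσ (by norm_num) m (not_lt.mp h)).trans (le_of_eq ?_)
      field_simp
      norm_num
  have hB1 : B 1 = 0 := by
    simp only [B]
    rw [if_neg]
    rw [pow_one, not_lt, ← sub_eq_add_neg, norm_sub_rev]
    push_cast
    linarith
  have hbad : ∀ m, m ≤ 30 → B m = 1 → ‖1 + (-q) ^ m‖ < 3100 * σ := by
    intro m hm hb
    simp only [B] at hb
    have : ‖1 + (-q) ^ m‖ < 100 * m * σ := by
      by_contra h; rw [if_neg h] at hb; norm_num at hb
    have hm' : (m : ℝ) ≤ 30 := by exact_mod_cast hm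
    nlinarith
  have h01 : ∀ m, B m = 0 ∨ B m = 1 := fun m => by simp only [B]; split_ifs <;> simp
  have he : (3100 * σ) * 1000 ≤ 1 := by norm_num at hσ1; linarith
  have g1 : ∀ m, m + 1 ≤ 30 → B m = 1 → B (m + 1) = 0 := by
    intro m hm hb
    rcases h01 (m + 1) with h | h
    · exact h
    exact (no_gap_one ha he m (by omega) (hbad m (by omega) hb) (hbad _ hm h)).elim
  have g2 : ∀ m, m + 2 ≤ 30 → B m = 1 → B (m + 2) = 0 := by
    intro m hm hb
    rcases h01 (m + 2) with h | h
    · exact h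
    have := no_gap_two ha he m (by omega) (hbad m (by omega) hb) (hbad _ hm h)
    rw [← sub_eq_add_neg, norm_sub_rev] at this
    exfalso
    linarith only [this, h1, hσ]
  have blk : ∀ k : ℕ, 1 ≤ k → k ≤ 9 → B (3 * k) / (3 * k) ^ 2 + B (3 * k + 1) / (3 * k + 1) ^ 2 +
      B (3 * k + 2) / (3 * k + 2) ^ 2 ≤ 1 / (3 * (k:ℝ)) ^ 2 := by
    intro k hk hk2
    have hk' : (0:ℝ) < k := by positivity
    have s1 : B (3 * k) + B (3 * k + 1) + B (3 * k + 2) ≤ 1 := by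
      rcases h01 (3 * k) with a | a
      · rcases h01 (3 * k + 1) with b | b
        · rcases h01 (3 * k + 2) with c | c <;> rw [a, b, c] <;> norm_num
        · have := g1 (3 * k + 1) (by omega) b
          rw [a, b, this]; norm_num
      · have b := g1 (3 * k) (by omega) a
        have c := g2 (3 * k) (by omega) a
        rw [a, b, c]; norm_num
    calc _ ≤ B (3 * k) / (3 * k) ^ 2 + B (3 * k + 1) / (3 * k) ^ 2 + B (3 * k + 2) / (3 * k) ^ 2 := by
          have := hB0 (3 * k + 1)
          have := hB0 (3 * k + 2)
          gcongr <;> linarith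
      _ = (B (3 * k) + B (3 * k + 1) + B (3 * k + 2)) / (3 * k) ^ 2 := by ring
      _ ≤ _ := by gcongr
  have b1 := blk 1 (by norm_num) (by norm_num)
  have b2 := blk 2 (by norm_num) (by norm_num)
  have b3 := blk 3 (by norm_num) (by norm_num)
  have b4 := blk 4 (by norm_num) (by norm_num)
  have b5 := blk 5 (by norm_num) (by norm_num)
  have b6 := blk 6 (by norm_num) (by norm_num)
  have b7 := blk 7 (by norm_num) (by norm_num)
  have b8 := blk 8 (by norm_num) (by norm_num)
  have b9 := blk 9 (by norm_num) (by norm_num)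
  have hhead : ∑ i ∈ Finset.range 30, (tauq q i).re ≤ (tauq q 2).re +
      (∑ i ∈ Finset.range 27, (0.01 / ((i + 3 : ℕ) : ℝ) ^ 2 + B (i + 3) / ((i + 3 : ℕ) : ℝ) ^ 2) + 0.01) * (1 / σ) := by
    rw [show (30:ℕ) = 3 + 27 by norm_num, Finset.sum_range_add]
    have t1 : ∑ x ∈ Finset.range 27, (tauq q (3 + x)).re ≤ ∑ i ∈ Finset.range 27,
        (0.01 / ((i + 3 : ℕ) : ℝ) ^ 2 + B (i + 3) / ((i + 3 : ℕ) : ℝ) ^ 2) * (1 / σ) := by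
      refine Finset.sum_le_sum fun i _ => ?_
      rw [add_comm 3 i]
      exact hB (i + 3) (by omega)
    rw [← Finset.sum_mul] at t1
    have t2 := hB 1 le_rfl
    rw [hB1] at t2
    have t0 : tauq q 0 = 0 := by simp [tauq]
    simp only [Finset.sum_range_succ, Finset.sum_range_zero, t0] at t2 ⊢
    simp only [Finset.sum_range_succ, Finset.sum_range_zero] at t1
    norm_num at t1 t2 ⊢
    linarith
  have hnum : (∑ i ∈ Finset.range 27, (0.01 / ((i + 3 : ℕ) : ℝ) ^ 2 + B (i + 3) / ((i + 3 : ℕ) : ℝ) ^ 2) + 0.01) + 1 / 29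
      ≤ 0.2195 := by
    simp only [Finset.sum_range_succ, Finset.sum_range_zero]
    norm_num at b1 b2 b3 b4 b5 b6 b7 b8 b9 ⊢
    linarith
  have hfin : (∑ i ∈ Finset.range 27, (0.01 / ((i + 3 : ℕ) : ℝ) ^ 2 + B (i + 3) / ((i + 3 : ℕ) : ℝ) ^ 2) + 0.01) * (1 / σ)
      + (1 / 29) / σ ≤ 0.2195 / σ := by
    rw [mul_one_div, ← add_div]
    gcongr
  linarith

open scoped Classical
open Filter Topology MeasureTheory

lemma line_integrable (F : ℂ → ℂ) (y C : ℝ)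
    (hd : ∀ z : ℂ, z.im = y → DifferentiableAt ℂ F z)
    (hb : ∀ z : ℂ, z.im = y → ‖F z‖ ≤ C / (1 + z.re ^ 2)) :
    Integrable (fun x : ℝ => F (x + y * Complex.I)) := by
  have hc : Continuous (fun x : ℝ => F (x + y * Complex.I)) := by
    rw [continuous_iff_continuousAt]
    intro x
    have h1 : ContinuousAt F (x + y * Complex.I) := (hd _ (by simp)).continuousAt
    exact ContinuousAt.comp (f := fun x : ℝ => (x + y * Complex.I : ℂ)) h1 (by fun_prop)
  refine Integrable.mono' (g := fun x : ℝ => C * (1 + x ^ 2)⁻¹) (integrable_inv_one_add_sq.const_mul C)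
    hc.aestronglyMeasurable (Eventually.of_forall fun x => ?_)
  have := hb (x + y * Complex.I) (by simp)
  simpa [div_eq_mul_inv] using this

lemma shift_lemma (F : ℂ → ℂ) (y1 y2 C : ℝ) (h12 : y1 ≤ y2)
    (hd : ∀ z : ℂ, z.im ∈ Set.Icc y1 y2 → DifferentiableAt ℂ F z)
    (hb : ∀ z : ℂ, z.im ∈ Set.Icc y1 y2 → ‖F z‖ ≤ C / (1 + z.re ^ 2)) :
    ∫ x : ℝ, F (x + y1 * Complex.I) = ∫ x : ℝ, F (x + y2 * Complex.I) := by
  have i1 := line_integrable F y1 C (fun z hz => hd z (by rw [hz]; exact ⟨le_rfl, h12⟩))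
    (fun z hz => hb z (by rw [hz]; exact ⟨le_rfl, h12⟩))
  have i2 := line_integrable F y2 C (fun z hz => hd z (by rw [hz]; exact ⟨h12, le_rfl⟩))
    (fun z hz => hb z (by rw [hz]; exact ⟨h12, le_rfl⟩))
  have l1 := intervalIntegral_tendsto_integral i1 tendsto_neg_atTop_atBot tendsto_id
  have l2 := intervalIntegral_tendsto_integral i2 tendsto_neg_atTop_atBot tendsto_id
  have hrect : ∀ T : ℝ, (∫ x : ℝ in (-T)..T, F (x + y1 * Complex.I)) -
      (∫ x : ℝ in (-T)..T, F (x + y2 * Complex.I)) =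
      -(Complex.I * (∫ y : ℝ in y1..y2, F (T + y * Complex.I)) -
        Complex.I * (∫ y : ℝ in y1..y2, F ((-T : ℝ) + y * Complex.I))) := by
    intro T
    have := Complex.integral_boundary_rect_eq_zero_of_differentiableOn F
      ((-T : ℝ) + y1 * Complex.I) (T + y2 * Complex.I) (by
        intro z hz
        apply (hd z _).differentiableWithinAt
        have h := hz.2
        simp only [Set.mem_preimage] at h
        simpa [Set.uIcc_of_le h12] using h)
    simp only [Complex.add_re, Complex.ofReal_re, Complex.mul_re, Complex.I_re, mul_zero, Complex.ofReal_im,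
      Complex.I_im, mul_one, sub_self, add_zero, Complex.add_im, Complex.mul_im, zero_add, smul_eq_mul] at this
    rw [← sub_eq_zero]
    rw [← this]
    ring
  have hv : ∀ s : ℝ → ℝ, (∀ T, (s T) ^ 2 = T ^ 2) →
      Tendsto (fun T : ℝ => ∫ y : ℝ in y1..y2, F ((s T : ℝ) + y * Complex.I)) atTop (𝓝 0) := by
    intro s hs
    have hlim : Tendsto (fun T : ℝ => C / (1 + T ^ 2) * |y2 - y1|) atTop (𝓝 0) := by
      rw [← zero_mul |y2 - y1|]
      apply Tendsto.mul_const
      apply Tendsto.const_div_atTop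
      exact tendsto_atTop_add_const_left _ _ (tendsto_pow_atTop (by norm_num))
    refine squeeze_zero_norm (fun T => ?_) hlim
    apply intervalIntegral.norm_integral_le_of_norm_le_const
    intro y hy
    rw [Set.uIoc_of_le h12] at hy
    have := hb ((s T : ℝ) + y * Complex.I) (by simp; exact ⟨hy.1.le, hy.2⟩)
    simpa [hs] using this
  have l3 := (((hv id (fun T => rfl)).const_mul Complex.I).sub
    ((hv (fun T => -T) (fun T => by ring)).const_mul Complex.I)).neg
  have l4 := l1.sub l2
  have h5 : Tendsto (fun T : ℝ => (∫ x : ℝ in (-T)..T, F (x + y1 * Complex.I)) -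
      (∫ x : ℝ in (-T)..T, F (x + y2 * Complex.I))) atTop (𝓝 0) := by
    have e : (fun T : ℝ => (∫ x : ℝ in (-T)..T, F (x + y1 * Complex.I)) -
      (∫ x : ℝ in (-T)..T, F (x + y2 * Complex.I))) = _ := funext hrect
    rw [e]
    simpa using l3
  exact sub_eq_zero.mp (tendsto_nhds_unique l4 h5)

lemma cauchy_int (a : ℝ) (ha : a ≠ 0) : Integrable (fun u : ℝ => a / (u ^ 2 + a ^ 2)) ∧
    ∫ u : ℝ, a / (u ^ 2 + a ^ 2) = Real.pi * SignType.sign a := by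
  have e : ∀ u : ℝ, a / (u ^ 2 + a ^ 2) = a⁻¹ * (1 + (u / a) ^ 2)⁻¹ := by
    intro u
    have : 0 < u ^ 2 + a ^ 2 := by positivity
    have h2 : 1 + (u / a) ^ 2 = (u ^ 2 + a ^ 2) / a ^ 2 := by field_simp; ring
    rw [h2]
    field_simp
  simp_rw [e]
  constructor
  · exact ((integrable_inv_one_add_sq).comp_div ha).const_mul _
  · rw [integral_const_mul, Measure.integral_comp_div (fun x : ℝ => (1 + x ^ 2)⁻¹),
      integral_univ_inv_one_add_sq]
    rcases lt_or_gt_of_ne ha with h | h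
    · rw [abs_of_neg h, sign_neg h]
      simp only [smul_eq_mul, SignType.coe_neg_one]; field_simp
    · rw [abs_of_pos h, sign_pos h]
      simp only [smul_eq_mul, SignType.coe_one]; field_simp

lemma ne_aux (a : ℝ) (ha : a ≠ 0) (u : ℝ) : (u : ℂ) - a * Complex.I ≠ 0 := by
  intro h
  have := congrArg Complex.im h
  simp at this; exact ha this

lemma two_pole (a b : ℝ) (ha : a ≠ 0) (hb : b ≠ 0) :
    Integrable (fun u : ℝ => 1 / ((u : ℂ) - a * Complex.I) - 1 / ((u : ℂ) - b * Complex.I)) ∧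
    ∫ u : ℝ, (1 / ((u : ℂ) - a * Complex.I) - 1 / ((u : ℂ) - b * Complex.I)) =
      Real.pi * Complex.I * (((SignType.sign a : ℝ) : ℂ) - ((SignType.sign b : ℝ) : ℂ)) := by
  set k : ℝ → ℂ := fun u => 1 / ((u : ℂ) - a * Complex.I) - 1 / ((u : ℂ) - b * Complex.I) with hk
  have nn : ∀ c : ℝ, c ≠ 0 → ∀ u : ℝ, min 1 |c| * (1 + |u|) / 2 ≤ ‖(u : ℂ) - c * Complex.I‖ := by
    intro c hc u
    have h1 : |u| ≤ ‖(u : ℂ) - c * Complex.I‖ := by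
      have := Complex.abs_re_le_norm ((u : ℂ) - c * Complex.I); simpa using this
    have h2 : |c| ≤ ‖(u : ℂ) - c * Complex.I‖ := by
      have := Complex.abs_im_le_norm ((u : ℂ) - c * Complex.I); simpa using this
    have h3 : min 1 |c| * (1 + |u|) ≤ |c| + |u| := by
      have := min_le_left 1 |c|
      have := min_le_right 1 |c|
      have := abs_nonneg u
      nlinarith
    linarith
  have hki : Integrable k := by
    have hcont : Continuous k := by
      have := ne_aux a ha
      have := ne_aux b hb
      apply Continuous.sub
      · exact Continuous.div continuous_const (by fun_prop) (by assumption)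
      · exact Continuous.div continuous_const (by fun_prop) (by assumption)
    refine Integrable.mono' (g := fun x : ℝ => (|a - b| * 4 / (min 1 |a| * min 1 |b|)) * (1 + x ^ 2)⁻¹)
      (integrable_inv_one_add_sq.const_mul _)
      hcont.aestronglyMeasurable (Eventually.of_forall fun u => ?_)
    have e : k u = ((a - b : ℝ) : ℂ) * Complex.I / (((u : ℂ) - a * Complex.I) * ((u : ℂ) - b * Complex.I)) := by
      simp only [hk]
      rw [div_sub_div _ _ (ne_aux a ha u) (ne_aux b hb u)]
      congr 1
      push_cast; ring
    rw [e, norm_div, norm_mul, norm_mul, Complex.norm_I, mul_one, Complex.norm_real, Real.norm_eq_abs]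
    have ha' : 0 < min 1 |a| := lt_min one_pos (abs_pos.mpr ha)
    have hb' : 0 < min 1 |b| := lt_min one_pos (abs_pos.mpr hb)
    have h4 : (min 1 |a| * (1 + |u|) / 2) * (min 1 |b| * (1 + |u|) / 2) ≤
      ‖(u : ℂ) - a * Complex.I‖ * ‖(u : ℂ) - b * Complex.I‖ := by
      gcongr
      · exact nn a ha u
      · exact nn b hb u
    have h5 : min 1 |a| * min 1 |b| * (1 + u ^ 2) / 4 ≤
      (min 1 |a| * (1 + |u|) / 2) * (min 1 |b| * (1 + |u|) / 2) := by
      have : 1 + u ^ 2 ≤ (1 + |u|) * (1 + |u|) := by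
        nlinarith [abs_nonneg u, sq_abs u]
      have hm : 0 < min 1 |a| * min 1 |b| := by positivity
      nlinarith
    calc _ ≤ |a - b| / (min 1 |a| * min 1 |b| * (1 + u ^ 2) / 4) := by
          gcongr
          exact h5.trans h4
      _ = _ := by field_simp
  refine ⟨hki, ?_⟩
  have h1 : ∫ u, k u = (1 / 2 : ℂ) * ∫ u, (k u + k (-u)) := by
    rw [integral_add hki hki.comp_neg, integral_neg_eq_self]
    ring
  have h2 : ∀ u, k u + k (-u) = 2 * Complex.I * ((a / (u ^ 2 + a ^ 2) : ℝ) : ℂ) -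
      2 * Complex.I * ((b / (u ^ 2 + b ^ 2) : ℝ) : ℂ) := by
    have key : ∀ c : ℝ, c ≠ 0 → ∀ u : ℝ, 1 / ((u : ℂ) - c * Complex.I) + 1 / (((-u : ℝ) : ℂ) - c * Complex.I)
      = 2 * Complex.I * ((c / (u ^ 2 + c ^ 2) : ℝ) : ℂ) := by
      intro c hc u
      have n1 := ne_aux c hc u
      have n2 := ne_aux c hc (-u)
      have n3 : ((u : ℂ) ^ 2 + c ^ 2) ≠ 0 := by
        have : 0 < u ^ 2 + c ^ 2 := by positivity
        exact_mod_cast this.ne'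
      rw [div_add_div _ _ n1 n2]
      push_cast at n2 ⊢
      rw [← mul_div_assoc, div_eq_div_iff (mul_ne_zero n1 n2) n3]
      linear_combination (-2*Complex.I*(c:ℂ)^3) * Complex.I_sq
    intro u
    simp only [hk]
    rw [← key a ha u, ← key b hb u]
    ring
  rw [h1]
  simp_rw [h2]
  rw [integral_sub, integral_const_mul, integral_const_mul, integral_complex_ofReal, integral_complex_ofReal,
    (cauchy_int a ha).2, (cauchy_int b hb).2]
  · push_cast; ring
  · exact ((cauchy_int a ha).1.ofReal).const_mul _
  · exact ((cauchy_int b hb).1.ofReal).const_mul _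

lemma residue_shift (N : ℂ → ℂ) (x0 : ℂ) (y1 y2 C : ℝ) (h1 : y1 < x0.im) (h2 : x0.im < y2)
    (hd : ∀ z : ℂ, z.im ∈ Set.Icc y1 y2 → DifferentiableAt ℂ N z)
    (hb : ∀ z : ℂ, z.im ∈ Set.Icc y1 y2 → 1 ≤ |z.re - x0.re| → ‖N z / (z - x0)‖ ≤ C / (1 + z.re ^ 2)) :
    (∫ x : ℝ, N (x + y1 * Complex.I) / (x + y1 * Complex.I - x0)) -
      (∫ x : ℝ, N (x + y2 * Complex.I) / (x + y2 * Complex.I - x0)) = 2 * Real.pi * Complex.I * N x0 := by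
  have h12 : y1 < y2 := h1.trans h2
  set x1 : ℂ := x0 - (x0.im - y1 + 1 : ℝ) * Complex.I with hx1
  have hx1re : x1.re = x0.re := by simp [hx1]
  have hx1im : x1.im = y1 - 1 := by simp [hx1]; ring
  have hn1 : ∀ z : ℂ, z.im ∈ Set.Icc y1 y2 → z - x1 ≠ 0 := by
    intro z hz h
    have := congrArg Complex.im h
    rw [Complex.sub_im, hx1im, Complex.zero_im] at this
    linarith [hz.1]
  set M : ℂ → ℂ := fun z => N z - N x0 * ((x0 - x1) / (z - x1)) with hM
  have hMd : ∀ z : ℂ, z.im ∈ Set.Icc y1 y2 → DifferentiableAt ℂ M z := by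
    intro z hz
    apply (hd z hz).sub
    apply DifferentiableAt.const_mul
    exact DifferentiableAt.div (by fun_prop) (by fun_prop) (hn1 z hz)
  have hM0 : M x0 = 0 := by
    simp only [hM]
    rw [div_self (hn1 x0 ⟨h1.le, h2.le⟩)]; ring
  set F := dslope M x0 with hF
  have hFne : ∀ z, z ≠ x0 → F z = M z / (z - x0) := by
    intro z hz
    rw [hF, dslope_of_ne _ hz, slope_def_field, hM0, sub_zero]
  have hFeq : ∀ z : ℂ, z.im ∈ Set.Icc y1 y2 → z ≠ x0 →
      N z / (z - x0) = F z + N x0 * (1 / (z - x0) - 1 / (z - x1)) := by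
    intro z hz hz0
    rw [hFne z hz0]
    simp only [hM]
    have n1 := hn1 z hz
    have n0 : z - x0 ≠ 0 := sub_ne_zero.mpr hz0
    field_simp
    ring
  have hFd : ∀ z : ℂ, z.im ∈ Set.Icc y1 y2 → DifferentiableAt ℂ F z := by
    intro z hz
    by_cases hz0 : z = x0
    · subst hz0
      have ho : IsOpen {w : ℂ | y1 < w.im ∧ w.im < y2} :=
        (isOpen_lt continuous_const Complex.continuous_im).inter
          (isOpen_lt Complex.continuous_im continuous_const)
      have hmem : {w : ℂ | y1 < w.im ∧ w.im < y2} ∈ 𝓝 z := ho.mem_nhds ⟨h1, h2⟩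
      have : DifferentiableOn ℂ F {w : ℂ | y1 < w.im ∧ w.im < y2} := by
        rw [hF, Complex.differentiableOn_dslope hmem]
        intro w hw
        exact (hMd w ⟨hw.1.le, hw.2.le⟩).differentiableWithinAt
      exact this.differentiableAt hmem
    · exact (differentiableAt_dslope_of_ne hz0).mpr (hMd z hz)
  -- bound
  have hcomp : IsCompact (Set.Icc (x0.re - 1) (x0.re + 1) ×ℂ Set.Icc y1 y2) :=
    isCompact_Icc.reProdIm isCompact_Icc
  have hbd : ∃ B, ∀ z ∈ (Set.Icc (x0.re - 1) (x0.re + 1) ×ℂ Set.Icc y1 y2), ‖F z * (1 + (z.re : ℂ) ^ 2)‖ ≤ B := by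
    apply hcomp.exists_bound_of_continuousOn
    apply ContinuousOn.mul
    · intro z hz
      exact (hFd z hz.2).continuousAt.continuousWithinAt
    · have : Continuous (fun z : ℂ => (1 + (z.re : ℂ) ^ 2)) := by
        have := Complex.continuous_re
        fun_prop
      exact this.continuousOn
  obtain ⟨B, hB⟩ := hbd
  have hFb : ∀ z : ℂ, z.im ∈ Set.Icc y1 y2 →
      ‖F z‖ ≤ (|B| + (|C| + ‖N x0‖ * ‖x0 - x1‖ * (3 + 2 * x0.re ^ 2))) / (1 + z.re ^ 2) := by
    intro z hz
    have hp : 0 < 1 + z.re ^ 2 := by positivity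
    rw [le_div_iff₀ hp]
    by_cases hc : 1 ≤ |z.re - x0.re|
    · have hz0 : z ≠ x0 := by rintro rfl; simp at hc; linarith
      have e := hFeq z hz hz0
      have hk : (1 / (z - x0) - 1 / (z - x1)) = (x0 - x1) / ((z - x0) * (z - x1)) := by
        rw [div_sub_div _ _ (sub_ne_zero.mpr hz0) (hn1 z hz)]; ring
      have e2 : F z = N z / (z - x0) - N x0 * ((x0 - x1) / ((z - x0) * (z - x1))) := by
        rw [e, hk]; ring
      have d0 : |z.re - x0.re| ≤ ‖z - x0‖ := by
        simpa using Complex.abs_re_le_norm (z - x0)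
      have d1 : |z.re - x0.re| ≤ ‖z - x1‖ := by
        rw [← hx1re]; simpa using Complex.abs_re_le_norm (z - x1)
      set d := |z.re - x0.re| with hdd
      have hd2 : d ^ 2 = (z.re - x0.re) ^ 2 := sq_abs _
      have q1 : 1 + z.re ^ 2 ≤ (3 + 2 * x0.re ^ 2) * d ^ 2 := by
        have : z.re ^ 2 ≤ 2 * d ^ 2 + 2 * x0.re ^ 2 := by rw [hd2]; nlinarith [sq_nonneg (z.re - 2 * x0.re)]
        have : 1 ≤ d ^ 2 := by nlinarith
        nlinarith [sq_nonneg x0.re]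
      have q2 : d ^ 2 ≤ ‖z - x0‖ * ‖z - x1‖ := by
        rw [sq]; gcongr
      have b1 := hb z hz hc
      rw [le_div_iff₀ hp] at b1
      have b2 : ‖N x0 * ((x0 - x1) / ((z - x0) * (z - x1)))‖ * (1 + z.re ^ 2) ≤
          ‖N x0‖ * ‖x0 - x1‖ * (3 + 2 * x0.re ^ 2) := by
        rw [norm_mul, norm_div, norm_mul]
        have hpos : 0 < ‖z - x0‖ * ‖z - x1‖ := by
          have : 0 < d ^ 2 := by positivity
          linarith
        rw [mul_div_assoc', div_mul_eq_mul_div, div_le_iff₀ hpos, mul_assoc (‖N x0‖ * ‖x0 - x1‖)]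
        gcongr
        calc 1 + z.re ^ 2 ≤ (3 + 2 * x0.re ^ 2) * d ^ 2 := q1
          _ ≤ _ := by gcongr
      rw [e2]
      have := norm_sub_le (N z / (z - x0)) (N x0 * ((x0 - x1) / ((z - x0) * (z - x1))))
      have b3 : C ≤ |C| := le_abs_self C
      have b4 : 0 ≤ |B| := abs_nonneg B
      nlinarith
    · push Not at hc
      rw [abs_lt] at hc
      have := hB z ⟨⟨by linarith, by linarith⟩, hz⟩
      rw [norm_mul] at this
      have e3 : ‖(1 + (z.re : ℂ) ^ 2)‖ = 1 + z.re ^ 2 := by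
        rw [show (1 + (z.re : ℂ) ^ 2) = ((1 + z.re ^ 2 : ℝ) : ℂ) by push_cast; ring, Complex.norm_real,
          Real.norm_of_nonneg hp.le]
      rw [e3] at this
      have b4 : B ≤ |B| := le_abs_self B
      have : 0 ≤ |C| + ‖N x0‖ * ‖x0 - x1‖ * (3 + 2 * x0.re ^ 2) := by positivity
      linarith
  have hsh := shift_lemma F y1 y2 _ h12.le hFd hFb
  -- kernel integrals
  have hker : ∀ y : ℝ, y ∈ Set.Icc y1 y2 → y ≠ x0.im →
      (∫ x : ℝ, N (x + y * Complex.I) / (x + y * Complex.I - x0)) =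
        (∫ x : ℝ, F (x + y * Complex.I)) + N x0 * (Real.pi * Complex.I *
          (((SignType.sign (x0.im - y) : ℝ) : ℂ) - (((-1 : ℝ)) : ℂ))) := by
    intro y hy hne
    have hFi := line_integrable F y _ (fun z hz => hFd z (by rw [hz]; exact hy))
      (fun z hz => hFb z (by rw [hz]; exact hy))
    have ha : x0.im - y ≠ 0 := sub_ne_zero.mpr (Ne.symm hne)
    have hb' : x1.im - y < 0 := by rw [hx1im]; linarith [hy.1]
    obtain ⟨k1, k2⟩ := two_pole (x0.im - y) (x1.im - y) ha hb'.ne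
    rw [sign_neg hb'] at k2
    have k1' := k1.comp_sub_right x0.re
    have k2' := integral_sub_right_eq_self (μ := volume) (fun u : ℝ => 1 / ((u : ℂ) - (x0.im - y : ℝ) * Complex.I)
      - 1 / ((u : ℂ) - (x1.im - y : ℝ) * Complex.I)) x0.re
    rw [k2] at k2'
    have e : ∀ x : ℝ, N (x + y * Complex.I) / (x + y * Complex.I - x0) =
        F (x + y * Complex.I) + N x0 * (1 / (((x - x0.re : ℝ) : ℂ) - (x0.im - y : ℝ) * Complex.I)
      - 1 / (((x - x0.re : ℝ) : ℂ) - (x1.im - y : ℝ) * Complex.I)) := by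
      intro x
      have z0 : (x + y * Complex.I : ℂ) ≠ x0 := by
        intro h; apply hne; rw [← h]; simp
      rw [hFeq _ (by simpa using hy) z0]
      have p1 : (x + y * Complex.I : ℂ) - x0 = ((x - x0.re : ℝ) : ℂ) - (x0.im - y : ℝ) * Complex.I := by
        apply Complex.ext <;> simp
      have p2 : (x + y * Complex.I : ℂ) - x1 = ((x - x0.re : ℝ) : ℂ) - (x1.im - y : ℝ) * Complex.I := by
        apply Complex.ext <;> simp [hx1re]
      rw [p1, p2]
    simp_rw [e]
    rw [integral_add hFi (k1'.const_mul _), integral_const_mul, k2']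
    simp
  rw [hker y1 ⟨le_rfl, h12.le⟩ h1.ne, hker y2 ⟨h12.le, le_rfl⟩ h2.ne', hsh,
    sign_pos (sub_pos.mpr h1), sign_neg (sub_neg.mpr h2)]
  simp
  ring

open scoped Classical
open Filter Topology MeasureTheory

noncomputable def fJ (b c : ℝ) (w t x : ℂ) : ℂ :=
  Complex.exp (-2 * t * x ^ 2 - b * t * x) / (1 - w * Complex.exp (-c * t * x))

noncomputable def GJ (b c : ℝ) (w t : ℂ) (β : ℝ) (x : ℂ) : ℂ :=
  fJ b c w t x * Complex.exp (2 * Real.pi * Complex.I * β * x)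

/-- the point with coordinates `(s,h)` -/
noncomputable def pt (t : ℂ) (s h : ℝ) : ℂ := s + Complex.I * h / t

lemma GJ_norm (b c : ℝ) (w t : ℂ) (ht : t ≠ 0) (β s h : ℝ) :
    ‖GJ b c w t β (pt t s h)‖ = Real.exp (-2 * t.re * s ^ 2 - b * t.re * s) *
      Real.exp ((2 * h ^ 2 - 2 * Real.pi * β * h) * (1 / t).re) /
      ‖1 - w * Complex.exp (-(c * h) * Complex.I) * Complex.exp (-c * t * s)‖ := by
  have e1 : -c * t * pt t s h = -(c * h) * Complex.I + -c * t * s := by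
    unfold pt; field_simp; ring
  have e2 : (-2 * t * (pt t s h) ^ 2 - b * t * (pt t s h)) + 2 * Real.pi * Complex.I * β * (pt t s h) =
      ((-2 * s ^ 2 - b * s : ℝ) : ℂ) * t + ((2 * h ^ 2 - 2 * Real.pi * β * h : ℝ) : ℂ) * (1 / t) +
      ((-4 * s * h - b * h + 2 * Real.pi * β * s : ℝ) : ℂ) * Complex.I := by
    unfold pt; push_cast; field_simp; ring_nf
    simp only [Complex.I_sq]
    ring
  rw [GJ, fJ, div_mul_eq_mul_div, ← Complex.exp_add, e2, e1, norm_div, Complex.norm_exp, Complex.exp_add,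
    ← Real.exp_add, ← mul_assoc]
  congr 2
  simp only [Complex.add_re, Complex.re_ofReal_mul, Complex.I_re]
  ring

lemma den_cone (K δ : ℝ) (hK : 0 ≤ K) (hδ : 0 < δ) : ∃ d > 0, ∀ u τ : ℂ, ‖u‖ = 1 → δ ≤ ‖1 - u‖ →
    |τ.im| ≤ K * |τ.re| → d ≤ ‖1 - u * Complex.exp (-τ)‖ := by
  obtain ⟨η, hη0, hη1, hη2⟩ : ∃ η : ℝ, 0 < η ∧ (1 + K) * η ≤ 1 ∧ 2 * ((1 + K) * η) ≤ δ / 2 := by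
    refine ⟨min 1 (δ / 4) / (1 + K), by positivity, ?_, ?_⟩
    · rw [mul_div_cancel₀ _ (by positivity)]; exact min_le_left _ _
    · rw [mul_div_cancel₀ _ (by positivity)]; have := min_le_right 1 (δ / 4); linarith
  refine ⟨min (δ / 2) (1 - Real.exp (-η)), ?_, ?_⟩
  · have : Real.exp (-η) < 1 := Real.exp_lt_one_iff.mpr (by linarith)
    exact lt_min (by linarith) (by linarith)
  intro u τ hu hδu hτ
  rcases lt_or_ge |τ.re| η with h | h
  · refine (min_le_left _ _).trans ?_
    have hn : ‖-τ‖ ≤ (1 + K) * η := by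
      rw [norm_neg]
      refine (Complex.norm_le_abs_re_add_abs_im τ).trans ?_
      nlinarith
    have h2 := Complex.norm_exp_sub_one_le (x := -τ) (hn.trans hη1)
    have e : 1 - u * Complex.exp (-τ) = (1 - u) - u * (Complex.exp (-τ) - 1) := by ring
    have h3 := norm_sub_norm_le (1 - u) (u * (Complex.exp (-τ) - 1))
    rw [norm_mul, hu, one_mul] at h3
    rw [e]
    linarith
  · refine (min_le_right _ _).trans ?_
    have hne : ‖u * Complex.exp (-τ)‖ = Real.exp (-τ.re) := by
      rw [norm_mul, hu, one_mul, Complex.norm_exp, Complex.neg_re]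
    have h4 := abs_norm_sub_norm_le (1 : ℂ) (u * Complex.exp (-τ))
    rw [hne, norm_one] at h4
    refine le_trans ?_ h4
    rcases le_or_gt 0 τ.re with hs | hs
    · rw [abs_of_nonneg hs] at h
      have : Real.exp (-τ.re) ≤ Real.exp (-η) := Real.exp_le_exp.mpr (by linarith)
      exact le_trans (by linarith) (le_abs_self _)
    · rw [abs_of_neg hs] at h
      have h5 : Real.exp η ≤ Real.exp (-τ.re) := Real.exp_le_exp.mpr (by linarith)
      refine le_trans ?_ (neg_le_abs _)
      have h6 : η + 1 ≤ Real.exp η := Real.add_one_le_exp _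
      have h7 : -η + 1 ≤ Real.exp (-η) := Real.add_one_le_exp _
      linarith

lemma den_strip (c : ℝ) (w : ℂ) (hw : ‖w‖ = 1) (h0 h1 K : ℝ) (hK : 0 ≤ K)
    (hp : ∀ h ∈ Set.Icc h0 h1, w * Complex.exp (-(c * h) * Complex.I) ≠ 1) :
    ∃ d > 0, ∀ t : ℂ, 0 < t.re → |t.im| ≤ K * t.re → ∀ h ∈ Set.Icc h0 h1, ∀ s : ℝ,
      d ≤ ‖1 - w * Complex.exp (-(c * h) * Complex.I) * Complex.exp (-c * t * s)‖ := by
  obtain ⟨δ, hδ, hδ'⟩ : ∃ δ > 0, ∀ h ∈ Set.Icc h0 h1, δ ≤ ‖1 - w * Complex.exp (-(c * h) * Complex.I)‖ := by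
    rcases (Set.Icc h0 h1).eq_empty_or_nonempty with he | hne
    · exact ⟨1, one_pos, fun h hh => by rw [he] at hh; exact hh.elim⟩
    have hcont : ContinuousOn (fun h : ℝ => ‖1 - w * Complex.exp (-(c * h) * Complex.I)‖) (Set.Icc h0 h1) := by fun_prop
    obtain ⟨m, hm, hmin⟩ := isCompact_Icc.exists_isMinOn hne hcont
    refine ⟨_, ?_, fun h hh => hmin hh⟩
    simp only [norm_pos_iff]
    exact sub_ne_zero.mpr (hp m hm).symm
  obtain ⟨d, hd, hd'⟩ := den_cone K δ hK hδ
  refine ⟨d, hd, fun t ht hti h hh s => ?_⟩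
  have := hd' (w * Complex.exp (-(c * h) * Complex.I)) (c * t * s) ?_ (hδ' h hh) ?_
  · simpa [neg_mul] using this
  · rw [norm_mul, hw, one_mul, Complex.norm_exp]; simp
  · have e1 : (c * t * s : ℂ) = ((c * s : ℝ) : ℂ) * t := by push_cast; ring
    rw [e1, Complex.re_ofReal_mul, Complex.im_ofReal_mul, abs_mul, abs_mul _ t.re, abs_of_pos ht]
    have : 0 ≤ |c * s| := abs_nonneg _
    nlinarith

lemma gauss_le (b σ s : ℝ) (hσ : 0 < σ) (hσ1 : σ ≤ 1) :
    Real.exp (-2 * σ * s ^ 2 - b * σ * s) ≤ Real.exp (b ^ 2 / 4) * Real.exp (-σ * s ^ 2) := by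
  rw [← Real.exp_add]
  apply Real.exp_le_exp.mpr
  have : 0 ≤ σ * (s + b / 2) ^ 2 := by positivity
  have : σ * (b ^ 2 / 4) ≤ b ^ 2 / 4 := mul_le_of_le_one_left (by positivity) hσ1
  nlinarith

/-- bound on the line integral -/
lemma J_line (b c : ℝ) (w : ℂ) (hw : ‖w‖ = 1) (h K : ℝ) (hK : 0 ≤ K)
    (hp : w * Complex.exp (-(c * h) * Complex.I) ≠ 1) :
    ∃ C > 0, ∀ t : ℂ, 0 < t.re → t.re ≤ 1 → |t.im| ≤ K * t.re → ∀ β : ℝ,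
      ‖∫ s : ℝ, GJ b c w t β (pt t s h)‖ ≤ C / Real.sqrt t.re *
        Real.exp ((2 * h ^ 2 - 2 * Real.pi * β * h) * (1 / t).re) := by
  obtain ⟨d, hd, hd'⟩ := den_strip c w hw h h K hK (by
    intro x hx; rw [Set.Icc_self, Set.mem_singleton_iff] at hx; rw [hx]; exact hp)
  refine ⟨Real.exp (b ^ 2 / 4) * Real.sqrt Real.pi / d, by positivity, fun t ht ht1 hti β => ?_⟩
  have ht0 : t ≠ 0 := by rintro rfl; simp at ht
  set E := Real.exp ((2 * h ^ 2 - 2 * Real.pi * β * h) * (1 / t).re) with hE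
  have hb : ∀ s : ℝ, ‖GJ b c w t β (pt t s h)‖ ≤ (Real.exp (b ^ 2 / 4) * E / d) * Real.exp (-t.re * s ^ 2) := by
    intro s
    rw [GJ_norm b c w t ht0]
    have h1 := hd' t ht hti h (by simp) s
    have h2 := gauss_le b t.re s ht ht1
    rw [← hE]
    calc _ ≤ (Real.exp (b ^ 2 / 4) * Real.exp (-t.re * s ^ 2)) * E / d := by gcongr
      _ = _ := by ring
  have hi : Integrable (fun s : ℝ => (Real.exp (b ^ 2 / 4) * E / d) * Real.exp (-t.re * s ^ 2)) :=
    (integrable_exp_neg_mul_sq ht).const_mul _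
  refine (norm_integral_le_of_norm_le hi (Eventually.of_forall hb)).trans (le_of_eq ?_)
  rw [integral_const_mul, integral_gaussian, Real.sqrt_div' _ ht.le]
  ring

lemma one_div_re (t : ℂ) (ht : 0 < t.re) : 0 < (1 / t).re := by
  rw [one_div, Complex.inv_re]
  have : t ≠ 0 := by rintro rfl; simp at ht
  have := Complex.normSq_pos.mpr this
  positivity

lemma pt_re (t : ℂ) (s h : ℝ) : (pt t s h).re = s - h * (1 / t).im := by
  have : pt t s h = s + Complex.I * h * (1 / t) := by unfold pt; ring
  rw [this]
  generalize 1 / t = y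
  simp; ring

lemma pt_im (t : ℂ) (s h : ℝ) : (pt t s h).im = h * (1 / t).re := by
  have : pt t s h = s + Complex.I * h * (1 / t) := by unfold pt; ring
  rw [this]
  generalize 1 / t = y
  simp

lemma pt_of (t : ℂ) (ht : 0 < t.re) (z : ℂ) :
    z = pt t (z.re + z.im / (1 / t).re * (1 / t).im) (z.im / (1 / t).re) := by
  have hp := one_div_re t ht
  apply Complex.ext
  · rw [pt_re]; ring
  · rw [pt_im]; field_simp

lemma decay_conv (σ a s x : ℝ) (hσ : 0 < σ) (hx : |x - s| ≤ a) :
    Real.exp (-σ * s ^ 2) ≤ (1 + 2 * a ^ 2 + 2 / σ) / (1 + x ^ 2) := by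
  have h1 : Real.exp (-σ * s ^ 2) ≤ 1 / (1 + σ * s ^ 2) := by
    have : σ * s ^ 2 + 1 ≤ Real.exp (σ * s ^ 2) := Real.add_one_le_exp _
    rw [neg_mul, Real.exp_neg, ← one_div]
    exact one_div_le_one_div_of_le (by positivity) (by linarith)
  refine h1.trans ?_
  have ha : (x - s) ^ 2 ≤ a ^ 2 := by
    rw [← sq_abs (x - s)]; exact pow_le_pow_left₀ (abs_nonneg _) hx 2
  have hx2 : x ^ 2 ≤ 2 * s ^ 2 + 2 * a ^ 2 := by nlinarith [sq_nonneg (x - 2 * s)]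
  rw [div_le_div_iff₀ (by positivity) (by positivity)]
  have e : (1 + 2 * a ^ 2 + 2 / σ) * (1 + σ * s ^ 2) = 1 + 2 * a ^ 2 + 2 / σ + (σ * s ^ 2) * (1 + 2 * a ^ 2) + 2 * s ^ 2 := by
    field_simp
    ring
  rw [e]
  have : 0 ≤ 2 / σ + (σ * s ^ 2) * (1 + 2 * a ^ 2) := by positivity
  linarith

lemma GJ_diff (b c : ℝ) (w t : ℂ) (β : ℝ) (z : ℂ) (h : 1 - w * Complex.exp (-c * t * z) ≠ 0) :
    DifferentiableAt ℂ (GJ b c w t β) z := by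
  unfold GJ fJ
  refine DifferentiableAt.mul (DifferentiableAt.div (by fun_prop) (by fun_prop) h) (by fun_prop)

lemma den_pt (c : ℝ) (w t : ℂ) (ht : t ≠ 0) (s h : ℝ) :
    w * Complex.exp (-c * t * pt t s h) = w * Complex.exp (-(c * h) * Complex.I) * Complex.exp (-c * t * s) := by
  have e1 : -c * t * pt t s h = -(c * h) * Complex.I + -c * t * s := by
    unfold pt; field_simp; ring
  rw [e1, Complex.exp_add, ← mul_assoc]

/-- real translation -/
lemma line_trans (F : ℂ → ℂ) (t : ℂ) (h : ℝ) :
    ∫ x : ℝ, F (x + (h * (1 / t).re : ℝ) * Complex.I) = ∫ s : ℝ, F (pt t s h) := by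
  rw [← integral_add_right_eq_self (fun x : ℝ => F (x + (h * (1 / t).re : ℝ) * Complex.I)) (-(h * (1 / t).im))]
  congr 1
  funext s
  congr 1
  apply Complex.ext
  · rw [pt_re]; generalize 1 / t = y; simp; ring
  · rw [pt_im]; generalize 1 / t = y; simp

/-- decay in the strip in terms of a lower bound of the denominator at the point -/
lemma GJ_decay (b c : ℝ) (w t : ℂ) (ht : 0 < t.re) (ht1 : t.re ≤ 1) (β h0 h1 : ℝ) (d : ℝ) (hd : 0 < d) :
    ∃ C : ℝ, ∀ z : ℂ, z.im ∈ Set.Icc (h0 * (1 / t).re) (h1 * (1 / t).re) →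
      d ≤ ‖1 - w * Complex.exp (-c * t * z)‖ → ‖GJ b c w t β z‖ ≤ C / (1 + z.re ^ 2) := by
  have hp := one_div_re t ht
  have ht0 : t ≠ 0 := by rintro rfl; simp at ht
  have hcont : ContinuousOn (fun h : ℝ => Real.exp ((2 * h ^ 2 - 2 * Real.pi * β * h) * (1 / t).re)) (Set.Icc h0 h1) := by fun_prop
  obtain ⟨M, hM⟩ := isCompact_Icc.exists_bound_of_continuousOn hcont
  obtain ⟨a, ha⟩ := isCompact_Icc.exists_bound_of_continuousOn
    (show ContinuousOn (fun h : ℝ => h * (1 / t).im) (Set.Icc h0 h1) by fun_prop)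
  refine ⟨Real.exp (b ^ 2 / 4) * M / d * (1 + 2 * a ^ 2 + 2 / t.re), fun z hz hdz => ?_⟩
  have hzz := pt_of t ht z
  set h := z.im / (1 / t).re with hh
  set s := z.re + h * (1 / t).im with hs
  have hmem : h ∈ Set.Icc h0 h1 := by
    rw [hh]; constructor
    · rw [le_div_iff₀ hp]; exact hz.1
    · rw [div_le_iff₀ hp]; exact hz.2
  have hM' := hM h hmem
  have ha' := ha h hmem
  rw [Real.norm_eq_abs] at hM' ha'
  have hx : |z.re - s| ≤ a := by
    rw [hs]; rw [show z.re - (z.re + h * (1 / t).im) = -(h * (1 / t).im) by ring, abs_neg]; exact ha'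
  have h1 := decay_conv t.re a s z.re ht hx
  rw [hzz, den_pt c w t ht0] at hdz
  have hn : ‖GJ b c w t β z‖ = _ := (congrArg (fun y => ‖GJ b c w t β y‖) hzz).trans (GJ_norm b c w t ht0 β s h)
  rw [hn]
  have hM'' := (le_abs_self _).trans hM'
  have hM0 : 0 ≤ M := (abs_nonneg _).trans hM'
  have h2 := gauss_le b t.re s ht ht1
  calc _ ≤ (Real.exp (b ^ 2 / 4) * ((1 + 2 * a ^ 2 + 2 / t.re) / (1 + z.re ^ 2))) * M / d := by
        gcongr
        exact h2.trans (by gcongr)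
    _ = _ := by ring

/-- shift of the line of integration -/
lemma J_shift (b c : ℝ) (w : ℂ) (hw : ‖w‖ = 1) (h0 h1 : ℝ) (h01 : h0 ≤ h1)
    (hp : ∀ h ∈ Set.Icc h0 h1, w * Complex.exp (-(c * h) * Complex.I) ≠ 1)
    (t : ℂ) (ht : 0 < t.re) (ht1 : t.re ≤ 1) (β : ℝ) :
    ∫ s : ℝ, GJ b c w t β (pt t s h0) = ∫ s : ℝ, GJ b c w t β (pt t s h1) := by
  have hpos := one_div_re t ht
  have ht0 : t ≠ 0 := by rintro rfl; simp at ht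
  obtain ⟨d, hd, hd'⟩ := den_strip c w hw h0 h1 (|t.im| / t.re) (by positivity) hp
  have hK : |t.im| ≤ |t.im| / t.re * t.re := by rw [div_mul_cancel₀ _ ht.ne']
  have hden : ∀ z : ℂ, z.im ∈ Set.Icc (h0 * (1 / t).re) (h1 * (1 / t).re) →
      d ≤ ‖1 - w * Complex.exp (-c * t * z)‖ := by
    intro z hz
    rw [pt_of t ht z, den_pt c w t ht0]
    refine hd' t ht hK _ ⟨?_, ?_⟩ _
    · rw [le_div_iff₀ hpos]; exact hz.1
    · rw [div_le_iff₀ hpos]; exact hz.2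
  obtain ⟨C, hC⟩ := GJ_decay b c w t ht ht1 β h0 h1 d hd
  have := shift_lemma (GJ b c w t β) (h0 * (1 / t).re) (h1 * (1 / t).re) C (by gcongr)
    (fun z hz => GJ_diff b c w t β z (norm_pos_iff.mp (hd.trans_le (hden z hz))))
    (fun z hz => hC z hz (hden z hz))
  rw [line_trans, line_trans] at this
  exact this

/-- Lemma A -/
lemma J_A (b c : ℝ) (w : ℂ) (hw : ‖w‖ = 1) (h1 K : ℝ) (hK : 0 ≤ K)
    (hp : ∀ h ∈ Set.uIcc 0 h1, w * Complex.exp (-(c * h) * Complex.I) ≠ 1) :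
    ∃ C > 0, ∀ t : ℂ, 0 < t.re → t.re ≤ 1 → |t.im| ≤ K * t.re → ∀ β : ℝ,
      ‖∫ s : ℝ, GJ b c w t β s‖ ≤ C / Real.sqrt t.re *
        Real.exp ((2 * h1 ^ 2 - 2 * Real.pi * β * h1) * (1 / t).re) := by
  obtain ⟨C, hC, hC'⟩ := J_line b c w hw h1 K hK (hp h1 Set.right_mem_uIcc)
  refine ⟨C, hC, fun t ht ht1 hti β => ?_⟩
  have h0 : ∫ s : ℝ, GJ b c w t β s = ∫ s : ℝ, GJ b c w t β (pt t s 0) := by simp [pt]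
  rw [h0]
  rcases le_total 0 h1 with h | h
  · rw [Set.uIcc_of_le h] at hp
    rw [J_shift b c w hw 0 h1 h hp t ht ht1 β]
    exact hC' t ht ht1 hti β
  · rw [Set.uIcc_of_ge h] at hp
    rw [← J_shift b c w hw h1 0 h hp t ht ht1 β]
    exact hC' t ht ht1 hti β

open scoped Classical
open Filter Topology MeasureTheory

lemma den_zero (c : ℝ) (hc : 0 < c) (w t : ℂ) (hw : ‖w‖ = 1) (ht : 0 < t.re) (s h : ℝ)
    (h0 : 1 - w * Complex.exp (-c * t * pt t s h) = 0) : s = 0 ∧ w * Complex.exp (-(c * h) * Complex.I) = 1 := by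
  have ht0 : t ≠ 0 := by rintro rfl; simp at ht
  rw [den_pt c w t ht0, sub_eq_zero] at h0
  have hn := congrArg norm h0
  have e1 : (-c * t * s : ℂ) = ((-c * s : ℝ) : ℂ) * t := by push_cast; ring
  have e2 : (-(c * h) * Complex.I : ℂ).re = 0 := by simp
  rw [norm_one, norm_mul, norm_mul, hw, Complex.norm_exp, Complex.norm_exp, e1, e2, Complex.re_ofReal_mul, Real.exp_zero,
    one_mul, one_mul, eq_comm, Real.exp_eq_one_iff] at hn
  have hs : s = 0 := by
    have h3 : c * t.re * s = 0 := by linarith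
    rcases mul_eq_zero.mp h3 with h4 | h4
    · have : 0 < c * t.re := by positivity
      linarith
    · exact h4
  refine ⟨hs, ?_⟩
  rw [hs] at h0
  simpa using h0.symm

lemma den_lower (c : ℝ) (hc : 0 < c) (w t : ℂ) (hw : ‖w‖ = 1) (ht : 0 < t.re) (h0 h1 hs : ℝ)
    (hp : ∀ h ∈ Set.Icc h0 h1, h ≠ hs → w * Complex.exp (-(c * h) * Complex.I) ≠ 1) :
    ∃ d > 0, ∀ z : ℂ, z.im ∈ Set.Icc (h0 * (1 / t).re) (h1 * (1 / t).re) →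
      1 ≤ |z.re - (pt t 0 hs).re| → d ≤ ‖1 - w * Complex.exp (-c * t * z)‖ := by
  have hpos := one_div_re t ht
  have ht0 : t ≠ 0 := by rintro rfl; simp at ht
  -- compact part
  let S : Set (ℝ × ℝ) := (Set.Icc (-1) 1 ×ˢ Set.Icc h0 h1) ∩ {p | 1 ≤ |(pt t p.1 p.2).re - (pt t 0 hs).re|}
  have hcp : Continuous (fun p : ℝ × ℝ => pt t p.1 p.2) := by unfold pt; fun_prop
  have hSc : IsCompact S := by
    refine (isCompact_Icc.prod isCompact_Icc).inter_right ?_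
    refine isClosed_le continuous_const ?_
    exact ((Complex.continuous_re.comp hcp).sub continuous_const).abs
  have hDc : Continuous (fun p : ℝ × ℝ => ‖1 - w * Complex.exp (-c * t * pt t p.1 p.2)‖) := by fun_prop
  obtain ⟨d1, hd1, hd1'⟩ : ∃ d > 0, ∀ p ∈ S, d ≤ ‖1 - w * Complex.exp (-c * t * pt t p.1 p.2)‖ := by
    rcases S.eq_empty_or_nonempty with he | hne
    · exact ⟨1, one_pos, fun h hh => by rw [he] at hh; exact hh.elim⟩
    obtain ⟨m, hm, hmin⟩ := hSc.exists_isMinOn hne hDc.continuousOn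
    refine ⟨_, ?_, fun h hh => hmin hh⟩
    simp only [norm_pos_iff]
    intro h
    obtain ⟨a1, a2⟩ := den_zero c hc w t hw ht _ _ h
    have : m.2 = hs := by
      by_contra hne
      exact hp _ hm.1.2 hne a2
    have h3 : 1 ≤ |(pt t m.1 m.2).re - (pt t 0 hs).re| := hm.2
    rw [a1, this] at h3
    simp at h3
    linarith
  have hd2 : 0 < 1 - Real.exp (-(c * t.re)) := by
    have : Real.exp (-(c * t.re)) < 1 := Real.exp_lt_one_iff.mpr (by have : 0 < c * t.re := by positivity
                                                                     linarith)
    linarith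
  refine ⟨min d1 (1 - Real.exp (-(c * t.re))), lt_min hd1 hd2, fun z hz hz1 => ?_⟩
  have hzz := pt_of t ht z
  set h := z.im / (1 / t).re with hh
  set s := z.re + h * (1 / t).im with hs
  have hmem : h ∈ Set.Icc h0 h1 := by
    rw [hh]; constructor
    · rw [le_div_iff₀ hpos]; exact hz.1
    · rw [div_le_iff₀ hpos]; exact hz.2
  rw [hzz] at hz1 ⊢
  by_cases hs1 : |s| ≤ 1
  · exact (min_le_left _ _).trans (hd1' (s, h) ⟨⟨abs_le.mp hs1, hmem⟩, hz1⟩)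
  · refine (min_le_right _ _).trans ?_
    rw [den_pt c w t ht0]
    have e1 : (-c * t * s : ℂ) = ((-c * s : ℝ) : ℂ) * t := by push_cast; ring
    have e2 : (-(c * h) * Complex.I : ℂ).re = 0 := by simp
    have h4 := abs_norm_sub_norm_le (1 : ℂ) (w * Complex.exp (-(c * h) * Complex.I) * Complex.exp (-c * t * s))
    rw [norm_one, norm_mul, norm_mul, hw, Complex.norm_exp, Complex.norm_exp, e1, e2, Complex.re_ofReal_mul, Real.exp_zero,
      one_mul, one_mul, ← e1] at h4
    refine le_trans ?_ h4
    have hct : 0 < c * t.re := by positivity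
    push Not at hs1
    rcases le_or_gt 0 s with h5 | h5
    · rw [abs_of_nonneg h5] at hs1
      have : Real.exp (-c * s * t.re) ≤ Real.exp (-(c * t.re)) := Real.exp_le_exp.mpr (by nlinarith)
      exact le_trans (by linarith) (le_abs_self _)
    · rw [abs_of_neg h5] at hs1
      have h6 : Real.exp (c * t.re) ≤ Real.exp (-c * s * t.re) := Real.exp_le_exp.mpr (by nlinarith)
      refine le_trans ?_ (neg_le_abs _)
      have h7 : c * t.re + 1 ≤ Real.exp (c * t.re) := Real.add_one_le_exp _
      have h8 : -(c * t.re) + 1 ≤ Real.exp (-(c * t.re)) := Real.add_one_le_exp _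
      linarith

lemma J_res (b c : ℝ) (hc : 0 < c) (w : ℂ) (hw : ‖w‖ = 1) (h0 h1 hs : ℝ) (hs0 : h0 < hs) (hs1 : hs < h1)
    (hws : w * Complex.exp (-(c * hs) * Complex.I) = 1)
    (hp : ∀ h ∈ Set.Icc h0 h1, h ≠ hs → w * Complex.exp (-(c * h) * Complex.I) ≠ 1)
    (t : ℂ) (ht : 0 < t.re) (ht1 : t.re ≤ 1) (β : ℝ) :
    (∫ s : ℝ, GJ b c w t β (pt t s h0)) - ∫ s : ℝ, GJ b c w t β (pt t s h1) =
      2 * Real.pi * Complex.I * (Complex.exp (-2 * t * (pt t 0 hs) ^ 2 - b * t * (pt t 0 hs)) *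
        Complex.exp (2 * Real.pi * Complex.I * β * pt t 0 hs) / (c * t)) := by
  have hpos := one_div_re t ht
  have ht0 : t ≠ 0 := by rintro rfl; simp at ht
  set x0 := pt t 0 hs with hx0
  let D : ℂ → ℂ := fun z => 1 - w * Complex.exp (-c * t * z)
  have hD0 : D x0 = 0 := by
    simp only [D]
    rw [hx0, den_pt c w t ht0, hws]; simp
  have hDd : Differentiable ℂ D := by intro z; simp only [D]; fun_prop
  have hD' : HasDerivAt D (c * t) x0 := by
    have h1 : HasDerivAt (fun z : ℂ => -c * t * z) (-c * t) x0 := by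
      simpa using (hasDerivAt_id x0).const_mul (-c * t)
    have h2 := ((h1.cexp).const_mul w).const_sub 1
    have h3 : w * Complex.exp (-c * t * x0) = 1 := by
      have := hD0; simp only [D] at this; linear_combination -this
    have e : -(w * (Complex.exp (-c * t * x0) * (-c * t))) = c * t := by
      linear_combination (c * t) * h3
    rw [e] at h2
    exact h2
  let E : ℂ → ℂ := dslope D x0
  have hE0 : E x0 = c * t := by simp only [E]; rw [dslope_same, hD'.deriv]
  have hEd : Differentiable ℂ E := by
    rw [← differentiableOn_univ]
    exact (Complex.differentiableOn_dslope univ_mem).mpr hDd.differentiableOn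
  have hED : ∀ z, D z = (z - x0) * E z := by
    intro z
    have := sub_smul_dslope D x0 z
    rw [hD0, sub_zero, smul_eq_mul] at this
    exact this.symm
  have hEne : ∀ z : ℂ, z.im ∈ Set.Icc (h0 * (1 / t).re) (h1 * (1 / t).re) → E z ≠ 0 := by
    intro z hz hE
    have hDz : D z = 0 := by rw [hED, hE, mul_zero]
    simp only [D] at hDz
    have hzz := pt_of t ht z
    rw [hzz] at hDz
    obtain ⟨a1, a2⟩ := den_zero c hc w t hw ht _ _ hDz
    have a3 : z.im / (1 / t).re = hs := by
      by_contra hne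
      refine hp _ ⟨?_, ?_⟩ hne a2
      · rw [le_div_iff₀ hpos]; exact hz.1
      · rw [div_le_iff₀ hpos]; exact hz.2
    rw [a1, a3] at hzz
    rw [hzz, ← hx0, hE0] at hE
    have : (c * t : ℂ) ≠ 0 := mul_ne_zero (by exact_mod_cast hc.ne') ht0
    exact this hE
  let g : ℂ → ℂ := fun z => Complex.exp (-2 * t * z ^ 2 - b * t * z) * Complex.exp (2 * Real.pi * Complex.I * β * z)
  have hgd : Differentiable ℂ g := by intro z; simp only [g]; fun_prop
  let N : ℂ → ℂ := fun z => g z / E z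
  have hN : ∀ z, N z / (z - x0) = GJ b c w t β z := by
    intro z
    simp only [N, g]
    rw [GJ, fJ, div_div, mul_comm (E z), ← hED]
    simp only [D]
    ring
  obtain ⟨d, hd, hd'⟩ := den_lower c hc w t hw ht h0 h1 hs hp
  obtain ⟨C, hC⟩ := GJ_decay b c w t ht ht1 β h0 h1 d hd
  have him : x0.im = hs * (1 / t).re := by rw [hx0, pt_im]
  have := residue_shift N x0 (h0 * (1 / t).re) (h1 * (1 / t).re) C (by rw [him]; gcongr) (by rw [him]; gcongr)
    (fun z hz => (hgd z).div (hEd z) (hEne z hz))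
    (fun z hz hz1 => by rw [hN]; exact hC z hz (hd' z hz hz1))
  simp only [hN] at this
  rw [line_trans, line_trans] at this
  rw [this]
  simp only [N, g, hE0]

open scoped Classical
open Filter Topology MeasureTheory

lemma GJ_real_decay (b c : ℝ) (w t : ℂ) (hw : ‖w‖ = 1) (hw1 : w ≠ 1) (ht : 0 < t.re) (ht1 : t.re ≤ 1) (β : ℝ) :
    (∃ C, ∀ x : ℝ, ‖GJ b c w t β x‖ ≤ C / (1 + x ^ 2)) ∧ Continuous (fun x : ℝ => GJ b c w t β x) := by
  have ht0 : t ≠ 0 := by rintro rfl; simp at ht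
  obtain ⟨d, hd, hd'⟩ := den_strip c w hw 0 0 (|t.im| / t.re) (by positivity) (by
    intro h hh; simp at hh; subst hh; simpa using hw1)
  have hK : |t.im| ≤ |t.im| / t.re * t.re := by rw [div_mul_cancel₀ _ ht.ne']
  have hden : ∀ x : ℝ, d ≤ ‖1 - w * Complex.exp (-c * t * x)‖ := by
    intro x
    have := hd' t ht hK 0 (by simp) x
    simpa using this
  obtain ⟨C, hC⟩ := GJ_decay b c w t ht ht1 β 0 0 d hd
  refine ⟨⟨C, fun x => ?_⟩, ?_⟩
  · have := hC x (by simp) (hden x)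
    simpa using this
  · rw [continuous_iff_continuousAt]
    intro x
    have h1 := (GJ_diff b c w t β x (norm_pos_iff.mp (hd.trans_le (hden x)))).continuousAt
    exact ContinuousAt.comp (f := fun x : ℝ => (x : ℂ)) h1 (by fun_prop)

lemma summable_of_decay (f : ℤ → ℂ) (C : ℝ) (h : ∀ j : ℤ, ‖f j‖ ≤ C / (1 + (j : ℝ) ^ 2)) : Summable f := by
  have hC : 0 ≤ C := by
    have := (norm_nonneg _).trans (h 0)
    simpa using this
  have h2 : Summable (fun j : ℤ => C * (1 / (j : ℝ) ^ 2)) :=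
    (Real.summable_one_div_int_pow.mpr (show 1 < 2 by norm_num)).mul_left C
  refine Summable.of_norm_bounded_eventually h2 ?_
  rw [Filter.eventually_cofinite]
  refine (Set.finite_singleton (0 : ℤ)).subset ?_
  intro j hj
  simp only [Set.mem_setOf_eq, not_le] at hj
  simp only [Set.mem_singleton_iff]
  by_contra hj0
  have : (0:ℝ) < (j:ℝ) ^ 2 := by positivity
  have h3 : C / (1 + (j : ℝ) ^ 2) ≤ C * (1 / (j : ℝ) ^ 2) := by
    rw [mul_one_div]; gcongr; linarith
  have := h j
  linarith

lemma poisson (b c : ℝ) (w t : ℂ) (hw : ‖w‖ = 1) (hw1 : w ≠ 1) (ht : 0 < t.re) (ht1 : t.re ≤ 1) (α : ℝ)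
    (hs : Summable (fun ν : ℤ => ∫ s : ℝ, GJ b c w t (α - ν) s)) :
    Summable (fun j : ℤ => GJ b c w t α j) ∧
      ∑' j : ℤ, GJ b c w t α j = ∑' ν : ℤ, ∫ s : ℝ, GJ b c w t (α - ν) s := by
  obtain ⟨⟨C, hC⟩, hcont⟩ := GJ_real_decay b c w t hw hw1 ht ht1 α
  have hfour : ∀ ν : ℤ, FourierTransform.fourier (fun x : ℝ => GJ b c w t α x) (ν : ℝ) =
      ∫ s : ℝ, GJ b c w t (α - ν) s := by
    intro ν
    rw [Real.fourier_eq']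
    congr 1
    funext x
    simp only [smul_eq_mul, RCLike.inner_apply, conj_trivial, GJ]
    rw [mul_comm, mul_assoc, ← Complex.exp_add]
    congr 2
    push_cast
    ring
  constructor
  · exact summable_of_decay _ C (fun j => by have := hC j; simpa using this)
  · have := Real.tsum_eq_tsum_fourier_of_rpow_decay_of_summable (f := fun x : ℝ => GJ b c w t α x) hcont
      (b := 2) (by norm_num) ?_ ?_ 0
    · simp only [hfour] at this
      simpa using this
    · refine Asymptotics.IsBigO.of_bound C ?_
      rw [Filter.eventually_iff]
      have : {x : ℝ | x ≠ 0} ∈ cocompact ℝ := by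
        have : ({0}ᶜ : Set ℝ) ∈ cocompact ℝ := isCompact_singleton.compl_mem_cocompact
        exact this
      filter_upwards [this] with x hx
      refine (hC x).trans ?_
      have hC0 : 0 ≤ C := by
        have := (norm_nonneg _).trans (hC 0)
        simpa using this
      have hx2 : (0:ℝ) < x ^ 2 := by have : x ≠ 0 := hx; positivity
      have e : ‖|x| ^ (-2 : ℝ)‖ = 1 / x ^ 2 := by
        rw [Real.norm_of_nonneg (by positivity), Real.rpow_neg (abs_nonneg _), one_div]
        norm_num
      rw [e, mul_one_div]
      gcongr
      linarith
    · simp only [hfour]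
      exact hs

open scoped Classical
open Filter Topology MeasureTheory

lemma summable_pow_natAbs {r : ℝ} (h0 : 0 ≤ r) (h1 : r < 1) : Summable (fun ν : ℤ => r ^ ν.natAbs) := by
  refine Summable.of_nat_of_neg ?_ ?_ <;> simpa using summable_geometric_of_lt_one h0 h1

lemma exp_I_eq_one {x : ℝ} (h : Complex.exp (x * Complex.I) = 1) (hx : |x| < 2 * Real.pi) : x = 0 := by
  obtain ⟨n, hn⟩ := Complex.exp_eq_one_iff.mp h
  have h2 : x = n * (2 * Real.pi) := by
    have := congrArg Complex.im hn
    simpa using this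
  rw [h2, abs_mul, abs_of_pos Real.two_pi_pos] at hx
  have h3 : |(n:ℝ)| < 1 := by
    by_contra h; push Not at h
    nlinarith [Real.pi_pos]
  have h4 : n = 0 := by
    have : |n| < 1 := by exact_mod_cast h3
    exact Int.abs_lt_one_iff.mp this
  rw [h2, h4]; simp

lemma zeta7_ne : zeta7 ≠ 1 := by
  intro h
  have : zeta7 = Complex.exp ((2 * Real.pi / 7 : ℝ) * Complex.I) := by
    rw [zeta7]; congr 1; push_cast; ring
  rw [this] at h
  have := exp_I_eq_one h (by rw [abs_of_pos (by positivity)]; linarith [Real.pi_pos])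
  linarith [Real.pi_pos]

lemma zeta7_sq_ne : zeta7 ^ 2 ≠ 1 := by
  intro h
  have : zeta7 ^ 2 = Complex.exp ((4 * Real.pi / 7 : ℝ) * Complex.I) := by
    rw [zeta7, ← Complex.exp_nat_mul]; congr 1; push_cast; ring
  rw [this] at h
  have := exp_I_eq_one h (by rw [abs_of_pos (by positivity)]; linarith [Real.pi_pos])
  linarith [Real.pi_pos]

lemma pole_a (h : ℝ) (h1 : -(Real.pi / 4) ≤ h) (h2 : h ≤ Real.pi / 4)
    (hz : zeta7 * Complex.exp (-((2:ℝ) * h) * Complex.I) = 1) : h = Real.pi / 7 := by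
  have : zeta7 * Complex.exp (-((2:ℝ) * h) * Complex.I) = Complex.exp ((2 * Real.pi / 7 - 2 * h : ℝ) * Complex.I) := by
    rw [zeta7, ← Complex.exp_add]; congr 1; push_cast; ring
  rw [this] at hz
  have := exp_I_eq_one hz (by rw [abs_lt]; constructor <;> linarith [Real.pi_pos])
  linarith

lemma pole_b (h : ℝ) (h1 : -(Real.pi / 8) ≤ h) (h2 : h ≤ Real.pi / 8) :
    zeta7 ^ 2 * Complex.exp (-((4:ℝ) * h) * Complex.I) ≠ 1 := by
  intro hz
  have : zeta7 ^ 2 * Complex.exp (-((4:ℝ) * h) * Complex.I) = Complex.exp ((4 * Real.pi / 7 - 4 * h : ℝ) * Complex.I) := by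
    rw [zeta7, ← Complex.exp_nat_mul, ← Complex.exp_add]; congr 1; push_cast; ring
  rw [this] at hz
  have := exp_I_eq_one hz (by rw [abs_lt]; constructor <;> linarith [Real.pi_pos])
  linarith [Real.pi_pos]

lemma rho_lower (K : ℝ) (t : ℂ) (ht : 0 < t.re) (hti : |t.im| ≤ K * t.re) :
    1 / ((1 + K ^ 2) * t.re) ≤ (1 / t).re := by
  rw [one_div t, Complex.inv_re, Complex.normSq_apply, div_le_div_iff₀ (by positivity) (by nlinarith [sq_nonneg t.im])]
  have : t.im * t.im ≤ K ^ 2 * t.re ^ 2 := by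
    have := mul_self_le_mul_self (abs_nonneg t.im) hti
    rw [abs_mul_abs_self] at this
    nlinarith
  nlinarith

lemma lz_a (t : ℂ) (j : ℤ) : lz zeta7 (Complex.exp (-t)) j = GJ 1 2 zeta7 t (1 / 2) j := by
  unfold lz GJ fJ
  have h1 : ((-1 : ℂ)) ^ j = Complex.exp (2 * Real.pi * Complex.I * ((1 / 2 : ℝ) : ℂ) * j) := by
    rw [← Complex.exp_pi_mul_I, ← Complex.exp_int_mul]; congr 1; push_cast; ring
  rw [h1, ← Complex.exp_int_mul, ← Complex.exp_int_mul]
  have e1 : (((2 * j ^ 2 + j : ℤ)) : ℂ) * -t = -2 * t * j ^ 2 - (1:ℝ) * t * j := by push_cast; ring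
  have e2 : (((2 * j : ℤ)) : ℂ) * -t = -(2:ℝ) * t * j := by push_cast; ring
  rw [e1, e2]; ring

/-- main term of the Lerch-type sum -/
noncomputable def mainT (t : ℂ) : ℂ :=
  2 * Real.pi * Real.sin (Real.pi / 7) / t * Complex.exp (-(5 * Real.pi ^ 2 / 49) / t)

lemma mainT_eq (t : ℂ) (ht : t ≠ 0) :
    (1 - zeta7) * (2 * Real.pi * Complex.I * (Complex.exp (-2 * t * (pt t 0 (Real.pi / 7)) ^ 2 - (1:ℝ) * t * (pt t 0 (Real.pi / 7))) *
        Complex.exp (2 * Real.pi * Complex.I * ((1 / 2 : ℝ) : ℂ) * pt t 0 (Real.pi / 7)) / ((2:ℝ) * t))) = mainT t := by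
  have e1 : (-2 * t * (pt t 0 (Real.pi / 7)) ^ 2 - (1:ℝ) * t * (pt t 0 (Real.pi / 7))) +
      (2 * Real.pi * Complex.I * ((1 / 2 : ℝ) : ℂ) * pt t 0 (Real.pi / 7)) =
      -((Real.pi / 7 : ℝ) : ℂ) * Complex.I + -(5 * Real.pi ^ 2 / 49) / t := by
    unfold pt
    push_cast
    field_simp
    ring_nf
    simp only [Complex.I_sq]
    ring
  have e2 : zeta7 = Complex.exp (((Real.pi / 7 : ℝ) : ℂ) * Complex.I) * Complex.exp (((Real.pi / 7 : ℝ) : ℂ) * Complex.I) := by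
    rw [zeta7, ← Complex.exp_add]; congr 1; push_cast; ring
  have e3 : Complex.exp (((Real.pi / 7 : ℝ) : ℂ) * Complex.I) * Complex.exp (-((Real.pi / 7 : ℝ) : ℂ) * Complex.I) = 1 := by
    rw [← Complex.exp_add]; simp
  rw [← Complex.exp_add, e1, Complex.exp_add, mainT, e2, Complex.ofReal_sin, Complex.sin]
  set A := Complex.exp (((Real.pi / 7 : ℝ) : ℂ) * Complex.I) with hA
  set B := Complex.exp (-((Real.pi / 7 : ℝ) : ℂ) * Complex.I) with hB
  have hBB : (1 - A * A) * B = B - A := by linear_combination (-A) * e3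
  push_cast
  field_simp
  linear_combination hBB

lemma Lam_a (K : ℝ) (hK : 0 ≤ K) : ∃ C > 0, ∀ t : ℂ, 0 < t.re → t.re ≤ 1 → |t.im| ≤ K * t.re →
    ‖(∑' j, cj zeta7 (Complex.exp (-t)) j * Complex.exp (-t) ^ (j * j)) - mainT t‖ ≤
      C / Real.sqrt t.re * Real.exp (-(Real.pi ^ 2 / 8) * (1 / t).re) := by
  have hpi := Real.pi_pos
  obtain ⟨C1, hC1, b1⟩ := J_A 1 2 zeta7 zeta7_norm (-(Real.pi / 4)) K hK (by
    intro h hh hz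
    rw [Set.uIcc_of_ge (by linarith)] at hh
    have := pole_a h hh.1 (by linarith [hh.2]) hz
    linarith [hh.2])
  obtain ⟨C2, hC2, b2⟩ := J_A 1 2 zeta7 zeta7_norm (Real.pi / 8) K hK (by
    intro h hh hz
    rw [Set.uIcc_of_le (by linarith)] at hh
    have := pole_a h (by linarith [hh.1]) (by linarith [hh.2]) hz
    linarith [hh.2])
  obtain ⟨C3, hC3, b3⟩ := J_line 1 2 zeta7 zeta7_norm (Real.pi / 4) K hK (by
    intro hz
    have := pole_a _ (by linarith) le_rfl hz
    linarith)
  set r0 := Real.exp (-(Real.pi ^ 2 / 4) / (1 + K ^ 2)) with hr0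
  have hr0p : 0 < r0 := Real.exp_pos _
  have hr01 : r0 < 1 := Real.exp_lt_one_iff.mpr (div_neg_of_neg_of_pos (by nlinarith) (by positivity))
  have hsum0 := summable_pow_natAbs hr0p.le hr01
  set S := ∑' ν : ℤ, r0 ^ ν.natAbs with hS
  have hS0 : 0 ≤ S := tsum_nonneg fun _ => by positivity
  refine ⟨‖1 - zeta7‖ * ((C1 + C2 + C3) / r0 * S) + 1, by positivity, fun t ht ht1 hti => ?_⟩
  have ht0 : t ≠ 0 := by rintro rfl; simp at ht
  set ρ := (1 / t).re with hρ
  have hρ1 : 1 / (1 + K ^ 2) ≤ ρ := by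
    refine le_trans ?_ (rho_lower K t ht hti)
    apply one_div_le_one_div_of_le (by positivity)
    have : (0:ℝ) < 1 + K ^ 2 := by positivity
    nlinarith
  have hρ0 : 0 < ρ := one_div_re t ht
  have hr0ρ : ∀ n : ℕ, Real.exp (-(Real.pi ^ 2 / 4) * ρ * n) ≤ r0 ^ n := by
    intro n
    rw [hr0, ← Real.exp_nat_mul]
    apply Real.exp_le_exp.mpr
    have : (Real.pi ^ 2 / 4) * (1 / (1 + K ^ 2)) ≤ (Real.pi ^ 2 / 4) * ρ := by gcongr
    have hn : (0:ℝ) ≤ n := by positivity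
    have e : (n:ℝ) * (-(Real.pi ^ 2 / 4) / (1 + K ^ 2)) = -(n * ((Real.pi ^ 2 / 4) * (1 / (1 + K ^ 2)))) := by ring
    rw [e]
    nlinarith
  set Res : ℂ := 2 * Real.pi * Complex.I * (Complex.exp (-2 * t * (pt t 0 (Real.pi / 7)) ^ 2 - (1:ℝ) * t * (pt t 0 (Real.pi / 7))) *
        Complex.exp (2 * Real.pi * Complex.I * ((1 / 2 : ℝ) : ℂ) * pt t 0 (Real.pi / 7)) / ((2:ℝ) * t)) with hRes
  set J : ℤ → ℂ := fun ν => ∫ s : ℝ, GJ 1 2 zeta7 t (1 / 2 - ν) s with hJ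
  set X := Real.exp (-(Real.pi ^ 2 / 8) * ρ) with hX
  have hsq : 0 < Real.sqrt t.re := Real.sqrt_pos.mpr ht
  set A := (C1 + C2 + C3) / r0 / Real.sqrt t.re * X with hA
  have hAp : 0 ≤ A := by positivity
  let G : ℤ → ℂ := fun ν => J ν - if ν = 0 then Res else 0
  have hG : ∀ ν, ‖G ν‖ ≤ A * r0 ^ ν.natAbs := by
    intro ν
    have key : ∀ (C' Y : ℝ) (m : ℕ), C' ≤ C1 + C2 + C3 → 0 ≤ C' → Y ≤ -(Real.pi ^ 2 / 8) * ρ + -(Real.pi ^ 2 / 4) * ρ * m →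
        C' / Real.sqrt t.re * Real.exp Y ≤ A * r0 ^ (m + 1) := by
      intro C' Y m h1 h2 h3
      have h4 : Real.exp Y ≤ X * r0 ^ m := by
        refine (Real.exp_le_exp.mpr h3).trans ?_
        rw [Real.exp_add]
        exact mul_le_mul_of_nonneg_left (hr0ρ m) (Real.exp_pos _).le
      calc C' / Real.sqrt t.re * Real.exp Y ≤ (C1 + C2 + C3) / Real.sqrt t.re * (X * r0 ^ m) := by gcongr
        _ = A * r0 ^ (m + 1) := by rw [hA, pow_succ]; field_simp
    rcases lt_trichotomy ν 0 with hν | hν | hν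
    · obtain ⟨m, hm⟩ : ∃ m : ℕ, ν = -((m + 1 : ℕ) : ℤ) := ⟨(-ν - 1).toNat, by omega⟩
      have h := b2 t ht ht1 hti (1 / 2 - ν)
      simp only [G, hν.ne, if_false, sub_zero]
      have hna : ν.natAbs = m + 1 := by omega
      rw [hna]
      refine h.trans (key C2 _ m (by linarith) hC2.le ?_)
      rw [hm]; push_cast
      have : 0 ≤ Real.pi ^ 2 * ρ := by positivity
      nlinarith
    · subst hν
      have hres := J_res 1 2 (by norm_num) zeta7 zeta7_norm 0 (Real.pi / 4) (Real.pi / 7) (by positivity)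
        (by linarith) (by
          rw [zeta7, ← Complex.exp_add]
          rw [show (2 * Real.pi * Complex.I / 7 + -(((2:ℝ):ℂ) * ((Real.pi / 7 : ℝ) : ℂ)) * Complex.I) = 0 by push_cast; ring]
          simp) (fun h hh hne hz => hne (pole_a h (by linarith [hh.1]) hh.2 hz)) t ht ht1 (1 / 2)
      have h := b3 t ht ht1 hti (1 / 2)
      have e : G 0 = ∫ s : ℝ, GJ 1 2 zeta7 t (1 / 2) (pt t s (Real.pi / 4)) := by
        simp only [G, hJ, if_true]
        have e0 : ∫ s : ℝ, GJ 1 2 zeta7 t (1 / 2 - ((0:ℤ) : ℝ)) s = ∫ s : ℝ, GJ 1 2 zeta7 t (1 / 2) (pt t s 0) := by simp [pt]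
        rw [e0, hRes, ← hres]; ring
      rw [e]
      refine h.trans ?_
      have h4 : Real.exp ((2 * (Real.pi / 4) ^ 2 - 2 * Real.pi * (1 / 2) * (Real.pi / 4)) * ρ) = X := by
        rw [hX]; congr 1; ring
      rw [h4, hA]
      simp only [Int.natAbs_zero, pow_zero, mul_one]
      gcongr
      rw [le_div_iff₀ hr0p]
      nlinarith
    · obtain ⟨m, hm⟩ : ∃ m : ℕ, ν = ((m + 1 : ℕ) : ℤ) := ⟨(ν - 1).toNat, by omega⟩
      have h := b1 t ht ht1 hti (1 / 2 - ν)
      simp only [G, hν.ne', if_false, sub_zero]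
      have hna : ν.natAbs = m + 1 := by omega
      rw [hna]
      refine h.trans (key C1 _ m (by linarith) hC1.le ?_)
      rw [hm]; push_cast
      have : 0 ≤ Real.pi ^ 2 * ρ := by positivity
      have : 0 ≤ Real.pi ^ 2 * ρ * m := by positivity
      nlinarith
  have hGs : Summable G := Summable.of_norm_bounded (hsum0.mul_left A) hG
  have hGn : ‖∑' ν, G ν‖ ≤ A * S := by
    refine tsum_of_norm_bounded ?_ hG
    exact hsum0.hasSum.mul_left A
  have hite : HasSum (fun ν : ℤ => if ν = 0 then Res else 0) Res := hasSum_ite_eq 0 Res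
  have hJs : HasSum J ((∑' ν, G ν) + Res) := by
    refine hasSum_cg (hGs.hasSum.add hite) (fun ν => ?_) rfl
    simp [G]
  obtain ⟨p1, p2⟩ := poisson 1 2 zeta7 t zeta7_norm zeta7_ne ht ht1 (1 / 2) hJs.summable
  have hlz : Summable (lz zeta7 (Complex.exp (-t))) := p1.congr fun j => (lz_a t j).symm
  have hq : ‖Complex.exp (-t)‖ < 1 := by
    rw [Complex.norm_exp]; exact Real.exp_lt_one_iff.mpr (by simpa using ht)
  rw [Lam_eq hq (Complex.exp_ne_zero _) zeta7_norm zeta7_ne hlz, tsum_congr (lz_a t), p2, hJs.tsum_eq,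
    ← mainT_eq t ht0, ← hRes, ← mul_sub, add_sub_cancel_right, norm_mul]
  calc ‖1 - zeta7‖ * ‖∑' ν, G ν‖ ≤ ‖1 - zeta7‖ * (A * S) := by gcongr
    _ = (‖1 - zeta7‖ * ((C1 + C2 + C3) / r0 * S)) / Real.sqrt t.re * X := by rw [hA]; ring
    _ ≤ _ := by gcongr; linarith

open scoped Classical
open Filter Topology MeasureTheory

lemma sum_b (b K : ℝ) (hK : 0 ≤ K) : ∃ C > 0, ∀ t : ℂ, 0 < t.re → t.re ≤ 1 → |t.im| ≤ K * t.re →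
    ∀ α : ℝ, |α| = 1 / 4 → Summable (fun j : ℤ => GJ b 4 (zeta7 ^ 2) t α j) ∧
    ‖∑' j : ℤ, GJ b 4 (zeta7 ^ 2) t α j‖ ≤ C / Real.sqrt t.re * Real.exp (-(Real.pi ^ 2 / 32) * (1 / t).re) := by
  have hpi := Real.pi_pos
  have hw : ‖zeta7 ^ 2‖ = 1 := by rw [norm_pow, zeta7_norm, one_pow]
  obtain ⟨C1, hC1, b1⟩ := J_A b 4 (zeta7 ^ 2) hw (-(Real.pi / 8)) K hK (by
    intro h hh
    rw [Set.uIcc_of_ge (by linarith)] at hh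
    exact pole_b h hh.1 (by linarith [hh.2]))
  obtain ⟨C2, hC2, b2⟩ := J_A b 4 (zeta7 ^ 2) hw (Real.pi / 8) K hK (by
    intro h hh
    rw [Set.uIcc_of_le (by linarith)] at hh
    exact pole_b h (by linarith [hh.1]) (by linarith [hh.2]))
  set r0 := Real.exp (-(Real.pi ^ 2 / 8) / (1 + K ^ 2)) with hr0
  have hr0p : 0 < r0 := Real.exp_pos _
  have hr01 : r0 < 1 := Real.exp_lt_one_iff.mpr (div_neg_of_neg_of_pos (by nlinarith) (by positivity))
  have hsum0 := summable_pow_natAbs hr0p.le hr01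
  set S := ∑' ν : ℤ, r0 ^ ν.natAbs with hS
  have hS0 : 0 ≤ S := tsum_nonneg fun _ => by positivity
  refine ⟨(C1 + C2) * S + 1, by positivity, fun t ht ht1 hti α hα => ?_⟩
  set ρ := (1 / t).re with hρ
  have hρ1 : 1 / (1 + K ^ 2) ≤ ρ := by
    refine le_trans ?_ (rho_lower K t ht hti)
    apply one_div_le_one_div_of_le (by positivity)
    have : (0:ℝ) < 1 + K ^ 2 := by positivity
    nlinarith
  have hρ0 : 0 < ρ := one_div_re t ht
  have hr0ρ : ∀ n : ℕ, Real.exp (-(Real.pi ^ 2 / 8) * ρ * n) ≤ r0 ^ n := by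
    intro n
    rw [hr0, ← Real.exp_nat_mul]
    apply Real.exp_le_exp.mpr
    have : (Real.pi ^ 2 / 8) * (1 / (1 + K ^ 2)) ≤ (Real.pi ^ 2 / 8) * ρ := by gcongr
    have hn : (0:ℝ) ≤ n := by positivity
    have e : (n:ℝ) * (-(Real.pi ^ 2 / 8) / (1 + K ^ 2)) = -(n * ((Real.pi ^ 2 / 8) * (1 / (1 + K ^ 2)))) := by ring
    rw [e]
    nlinarith
  set J : ℤ → ℂ := fun ν => ∫ s : ℝ, GJ b 4 (zeta7 ^ 2) t (α - ν) s with hJ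
  set X := Real.exp (-(Real.pi ^ 2 / 32) * ρ) with hX
  have hsq : 0 < Real.sqrt t.re := Real.sqrt_pos.mpr ht
  set A := (C1 + C2) / Real.sqrt t.re * X with hA
  have hAp : 0 ≤ A := by positivity
  have hG : ∀ ν, ‖J ν‖ ≤ A * r0 ^ ν.natAbs := by
    intro ν
    have hβ : 1 / 4 + (ν.natAbs : ℝ) / 2 ≤ |α - ν| := by
      have e1 : ((ν.natAbs : ℕ) : ℝ) = |(ν : ℝ)| := by rw [Nat.cast_natAbs, Int.cast_abs]
      rcases eq_or_ne ν 0 with rfl | h0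
      · simp [hα]
      · have h1 : (1:ℝ) ≤ |(ν:ℝ)| := by exact_mod_cast Int.one_le_abs h0
        have h2 := abs_sub_abs_le_abs_sub (ν:ℝ) α
        rw [abs_sub_comm] at h2
        rw [e1]; linarith
    have key : ∀ (C' Y : ℝ), C' ≤ C1 + C2 → 0 ≤ C' → Y = (Real.pi ^ 2 / 32 - |α - ν| * (Real.pi ^ 2 / 4)) * ρ →
        C' / Real.sqrt t.re * Real.exp Y ≤ A * r0 ^ ν.natAbs := by
      intro C' Y h1 h2 h3
      have h5 : Y ≤ -(Real.pi ^ 2 / 32) * ρ + -(Real.pi ^ 2 / 8) * ρ * ν.natAbs := by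
        rw [h3]
        have := mul_le_mul_of_nonneg_right hβ (by positivity : 0 ≤ Real.pi ^ 2 / 4 * ρ)
        linarith only [this]
      have h4 : Real.exp Y ≤ X * r0 ^ ν.natAbs := by
        refine (Real.exp_le_exp.mpr h5).trans ?_
        rw [Real.exp_add]
        exact mul_le_mul_of_nonneg_left (hr0ρ _) (Real.exp_pos _).le
      calc C' / Real.sqrt t.re * Real.exp Y ≤ (C1 + C2) / Real.sqrt t.re * (X * r0 ^ ν.natAbs) := by gcongr
        _ = A * r0 ^ ν.natAbs := by rw [hA]; ring
    rcases le_total 0 (α - ν) with hν | hν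
    · refine (b2 t ht ht1 hti (α - ν)).trans (key C2 _ (by linarith) hC2.le ?_)
      rw [abs_of_nonneg hν]; ring
    · refine (b1 t ht ht1 hti (α - ν)).trans (key C1 _ (by linarith) hC1.le ?_)
      rw [abs_of_nonpos hν]; ring
  have hJs : Summable J := Summable.of_norm_bounded (hsum0.mul_left A) hG
  have hGn : ‖∑' ν, J ν‖ ≤ A * S := by
    refine tsum_of_norm_bounded ?_ hG
    exact hsum0.hasSum.mul_left A
  obtain ⟨p1, p2⟩ := poisson b 4 (zeta7 ^ 2) t hw zeta7_sq_ne ht ht1 α hJs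
  refine ⟨p1, ?_⟩
  rw [p2]
  calc ‖∑' ν, J ν‖ ≤ A * S := hGn
    _ = ((C1 + C2) * S) / Real.sqrt t.re * X := by rw [hA]; ring
    _ ≤ _ := by gcongr; linarith

lemma lz_b (ε : ℝ) (hε : ε = 1 ∨ ε = -1) (t : ℂ) (ht : 0 < t.re) (j : ℤ) :
    lz zeta7 (Complex.exp (Real.pi * ε / 2 * Complex.I - t)) j =
      GJ 1 4 (zeta7 ^ 2) t (ε / 4) j + zeta7 * GJ 3 4 (zeta7 ^ 2) t (-ε / 4) j := by
  unfold lz GJ fJ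
  set ρ := Complex.exp (Real.pi * ε / 2 * Complex.I) with hρ
  have hρ2 : ρ * ρ = -1 := by
    rw [hρ, ← Complex.exp_add]
    rcases hε with h | h
    · rw [h, ← Complex.exp_pi_mul_I]; congr 1; push_cast; ring
    · rw [h, show (-1:ℂ) = (-1)⁻¹ by norm_num, ← Complex.exp_pi_mul_I, ← Complex.exp_neg]; congr 1; push_cast; ring
  have hρ0 : ρ ≠ 0 := Complex.exp_ne_zero _
  have hq : Complex.exp (Real.pi * ε / 2 * Complex.I - t) = ρ * Complex.exp (-t) := by
    rw [hρ, ← Complex.exp_add]; congr 1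
  have h1 : Complex.exp (2 * Real.pi * Complex.I * ((ε / 4 : ℝ) : ℂ) * j) = ρ ^ j := by
    rw [hρ, ← Complex.exp_int_mul]; congr 1; push_cast; ring
  have hinv : -ρ = ρ⁻¹ := by
    field_simp; linear_combination -hρ2
  have h2 : Complex.exp (2 * Real.pi * Complex.I * ((-ε / 4 : ℝ) : ℂ) * j) = (-ρ) ^ j := by
    rw [hinv, hρ, ← Complex.exp_neg, ← Complex.exp_int_mul]; congr 1; push_cast; ring
  have h3 : (-ρ) ^ j = (-1) ^ j * ρ ^ j := by rw [← mul_zpow]; simp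
  set s : ℂ := (-1) ^ j with hs
  have hss : s * s = 1 := by rw [hs, ← mul_zpow]; simp
  have hp2 : ρ ^ (2 * j) = s := by rw [zpow_mul, zpow_two, hρ2]
  have hpj : ρ ^ (2 * j ^ 2 + j) = s * ρ ^ j := by
    rw [zpow_add₀ hρ0, zpow_mul, zpow_two, hρ2, hs]
    congr 1
    rcases Int.even_or_odd j with h | h
    · rw [h.neg_one_zpow, (by simpa [Int.even_pow] using h : Even (j ^ 2)).neg_one_zpow]
    · rw [h.neg_one_zpow, h.pow.neg_one_zpow]
  rw [h1, h2, hq, mul_zpow, mul_zpow, hp2, hpj, h3, ← Complex.exp_int_mul (-t), ← Complex.exp_int_mul (-t)]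
  set u := Complex.exp (((2 * j : ℤ) : ℂ) * -t) with hu
  have e1 : (((2 * j ^ 2 + j : ℤ)) : ℂ) * -t = -2 * t * j ^ 2 - (1:ℝ) * t * j := by push_cast; ring
  have e3 : Complex.exp (-2 * t * j ^ 2 - (3:ℝ) * t * j) = Complex.exp (-2 * t * j ^ 2 - (1:ℝ) * t * j) * u := by
    rw [hu, ← Complex.exp_add]; congr 1; push_cast; ring
  have e4 : Complex.exp (-(4:ℝ) * t * j) = u * u := by
    rw [hu, ← Complex.exp_add]; congr 1; push_cast; ring
  rw [e1, e3, e4]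
  have hne : 1 - (zeta7 * u) ^ 2 ≠ 0 := by
    intro h
    have h' : (zeta7 * u) ^ 2 = 1 := by linear_combination -h
    have hn := congrArg norm h'
    rw [norm_pow, norm_mul, zeta7_norm, one_mul, norm_one, hu, Complex.norm_exp, ← Real.exp_nat_mul, Real.exp_eq_one_iff] at hn
    have hj : j = 0 := by
      simp at hn
      rcases hn with h | h
      · exact h
      · exact absurd h ht.ne'
    rw [hu, hj] at h'
    simp at h'
    exact zeta7_sq_ne (by simpa using h')
  have hd : 1 - zeta7 ^ 2 * (u * u) ≠ 0 := by intro h; apply hne; linear_combination h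
  have hd2 : 1 - zeta7 * (s * u) ≠ 0 := by
    intro h; apply hne
    linear_combination (1 + zeta7 * (s * u)) * h + (zeta7 * u) ^ 2 * hss
  generalize Complex.exp (-2 * t * j ^ 2 - (1:ℝ) * t * j) = E
  generalize ρ ^ j = P
  rw [div_mul_eq_mul_div, div_mul_eq_mul_div, mul_div_assoc', ← add_div, div_eq_div_iff hd2 hd]
  linear_combination (E * P) * hss

lemma Lam_b (K : ℝ) (hK : 0 ≤ K) : ∃ C > 0, ∀ t : ℂ, 0 < t.re → t.re ≤ 1 → |t.im| ≤ K * t.re →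
    ∀ ε : ℝ, (ε = 1 ∨ ε = -1) → ∀ q : ℂ, q = Complex.exp (Real.pi * ε / 2 * Complex.I - t) →
    ‖∑' j, cj zeta7 q j * q ^ (j * j)‖ ≤
      C / Real.sqrt t.re * Real.exp (-(Real.pi ^ 2 / 32) * (1 / t).re) := by
  obtain ⟨C1, hC1, b1⟩ := sum_b 1 K hK
  obtain ⟨C3, hC3, b3⟩ := sum_b 3 K hK
  refine ⟨‖1 - zeta7‖ * (C1 + C3) + 1, by positivity, fun t ht ht1 hti ε hε q hq => ?_⟩
  have ha : |ε / 4| = 1 / 4 := by rcases hε with rfl | rfl <;> norm_num [abs_div]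
  have hb : |-ε / 4| = 1 / 4 := by rcases hε with rfl | rfl <;> norm_num [abs_div]
  obtain ⟨s1, n1⟩ := b1 t ht ht1 hti _ ha
  obtain ⟨s3, n3⟩ := b3 t ht ht1 hti _ hb
  have hsum := s1.hasSum.add (s3.hasSum.mul_left zeta7)
  have hs : HasSum (lz zeta7 q) _ := hasSum_cg hsum (fun j => by rw [hq]; exact lz_b ε hε t ht j) rfl
  have hqn : ‖q‖ < 1 := by
    rw [hq, Complex.norm_exp]; exact Real.exp_lt_one_iff.mpr (by
      have : (Real.pi * ε / 2 * Complex.I : ℂ) = ((Real.pi * ε / 2 : ℝ) : ℂ) * Complex.I := by push_cast; ring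
      rw [this]; simpa using ht)
  rw [Lam_eq hqn (by rw [hq]; exact Complex.exp_ne_zero _) zeta7_norm zeta7_ne hs.summable, hs.tsum_eq, norm_mul]
  set X := Real.exp (-(Real.pi ^ 2 / 32) * (1 / t).re)
  calc _ ≤ ‖1 - zeta7‖ * (C1 / Real.sqrt t.re * X + 1 * (C3 / Real.sqrt t.re * X)) := by
        gcongr
        refine (norm_add_le _ _).trans ?_
        rw [norm_mul, zeta7_norm]
        gcongr
    _ = (‖1 - zeta7‖ * (C1 + C3)) / Real.sqrt t.re * X := by ring
    _ ≤ _ := by gcongr; linarith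

open scoped Classical
open Filter Topology MeasureTheory

lemma lz0_term (t : ℂ) (j : ℤ) : lz 0 (Complex.exp (-t)) j =
    jacobiTheta₂_term j (1 / 2 + Complex.I * t / (2 * Real.pi)) (2 * Complex.I * t / Real.pi) := by
  unfold lz jacobiTheta₂_term
  have hp : (Real.pi : ℂ) ≠ 0 := by exact_mod_cast Real.pi_ne_zero
  have h1 : ((-1 : ℂ)) ^ j = Complex.exp (j * (Real.pi * Complex.I)) := by
    rw [← Complex.exp_pi_mul_I, ← Complex.exp_int_mul]
  rw [h1, ← Complex.exp_int_mul, zero_mul, sub_zero, div_one, ← Complex.exp_add]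
  congr 1
  push_cast
  field_simp
  ring_nf
  simp only [Complex.I_sq]
  ring

/-- the transformed theta series -/
noncomputable def thE (t : ℂ) : ℂ := jacobiTheta₂ (1 / 4 - Complex.I * Real.pi / (4 * t)) (Complex.I * Real.pi / (2 * t))

lemma theta_eq (t : ℂ) (ht : 0 < t.re) :
    Summable (lz 0 (Complex.exp (-t))) ∧
    ∑' j : ℤ, lz 0 (Complex.exp (-t)) j = 1 / (2 * t / Real.pi) ^ (1 / 2 : ℂ) *
      Complex.exp (-(Real.pi ^ 2 / 8) / t - Complex.I * Real.pi / 4 + t / 8) * thE t := by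
  have hp : (Real.pi : ℂ) ≠ 0 := by exact_mod_cast Real.pi_ne_zero
  have ht0 : t ≠ 0 := by rintro rfl; simp at ht
  have him : 0 < (2 * Complex.I * t / Real.pi).im := by
    have : 2 * Complex.I * t / Real.pi = ((2 / Real.pi : ℝ) : ℂ) * (Complex.I * t) := by push_cast; ring
    rw [this, Complex.im_ofReal_mul]
    have := Real.pi_pos
    simp; positivity
  have hs := hasSum_jacobiTheta₂_term (1 / 2 + Complex.I * t / (2 * Real.pi)) him
  have hs2 : HasSum (lz 0 (Complex.exp (-t))) _ := hasSum_cg hs (fun j => lz0_term t j) rfl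
  refine ⟨hs2.summable, ?_⟩
  rw [hs2.tsum_eq, jacobiTheta₂_functional_equation, thE]
  congr 1
  · congr 1
    · congr 2
      field_simp; ring_nf; simp only [Complex.I_sq]; ring
    · congr 1
      field_simp; ring_nf; simp only [Complex.I_sq]; ring
  · congr 1
    · field_simp; ring_nf; simp only [Complex.I_sq]; ring
    · field_simp; ring_nf; simp only [Complex.I_sq]

lemma thE_term (t : ℂ) (ht : t ≠ 0) (n : ℤ) : jacobiTheta₂_term n (1 / 4 - Complex.I * Real.pi / (4 * t)) (Complex.I * Real.pi / (2 * t))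
    = Complex.I ^ n * Complex.exp (((-(Real.pi ^ 2) * (n * (n - 1) / 2) : ℝ) : ℂ) * (1 / t)) := by
  have h1 : Complex.I ^ n = Complex.exp (n * (Real.pi / 2 * Complex.I)) := by
    rw [Complex.exp_int_mul, Complex.exp_pi_div_two_mul_I]
  rw [h1, ← Complex.exp_add, jacobiTheta₂_term]
  congr 1
  push_cast
  field_simp
  ring_nf
  simp only [Complex.I_sq]
  ring

lemma thE_bound : ∃ C > 0, ∀ t : ℂ, 0 < t.re → 1 ≤ (1 / t).re →
    ‖thE t - (1 + Complex.I)‖ ≤ C * Real.exp (-(Real.pi ^ 2 / 2) * (1 / t).re) := by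
  have hpi := Real.pi_pos
  set r0 := Real.exp (-(Real.pi ^ 2 / 4)) with hr0
  have hr0p : 0 < r0 := Real.exp_pos _
  have hr01 : r0 < 1 := Real.exp_lt_one_iff.mpr (by nlinarith)
  have hsum0 := summable_pow_natAbs hr0p.le hr01
  set S := ∑' ν : ℤ, r0 ^ ν.natAbs with hS
  have hS0 : 0 ≤ S := tsum_nonneg fun _ => by positivity
  refine ⟨S + 1, by positivity, fun t ht hρ => ?_⟩
  have ht0 : t ≠ 0 := by rintro rfl; simp at ht
  set ρ := (1 / t).re with hρd
  have him : 0 < (Complex.I * Real.pi / (2 * t)).im := by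
    have : Complex.I * Real.pi / (2 * t) = ((Real.pi / 2 : ℝ) : ℂ) * (Complex.I * (1 / t)) := by push_cast; field_simp
    rw [this, Complex.im_ofReal_mul, Complex.I_mul_im, ← hρd]
    positivity
  have hs := hasSum_jacobiTheta₂_term (1 / 4 - Complex.I * Real.pi / (4 * t)) him
  have h2 : HasSum (fun n : ℤ => (if n = 0 then (1:ℂ) else 0) + if n = 1 then Complex.I else 0) (1 + Complex.I) :=
    (hasSum_ite_eq 0 1).add (hasSum_ite_eq 1 Complex.I)
  have h3 := hs.sub h2
  set X := Real.exp (-(Real.pi ^ 2 / 2) * ρ) with hX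
  have hG : ∀ n : ℤ, ‖jacobiTheta₂_term n (1 / 4 - Complex.I * Real.pi / (4 * t)) (Complex.I * Real.pi / (2 * t)) -
      ((if n = 0 then (1:ℂ) else 0) + if n = 1 then Complex.I else 0)‖ ≤ X * r0 ^ n.natAbs := by
    intro n
    rw [thE_term t ht0]
    by_cases hn0 : n = 0
    · subst hn0; simp; positivity
    by_cases hn1 : n = 1
    · subst hn1; simp; positivity
    rw [if_neg hn0, if_neg hn1, add_zero, sub_zero, norm_mul, norm_zpow, Complex.norm_I, one_zpow, one_mul,
      Complex.norm_exp, Complex.re_ofReal_mul, ← hρd, hX, hr0, ← Real.exp_nat_mul, ← Real.exp_add]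
    apply Real.exp_le_exp.mpr
    have hm : 1 / 2 + (n.natAbs : ℝ) / 4 ≤ n * (n - 1) / 2 := by
      have : (2:ℤ) + n.natAbs ≤ 2 * (n * (n - 1)) := by
        rcases le_or_gt 0 n with h | h
        · have : (n.natAbs : ℤ) = n := by omega
          rw [this]
          have : 2 ≤ n := by omega
          nlinarith
        · have : (n.natAbs : ℤ) = -n := by omega
          rw [this]; nlinarith
      have : (2:ℝ) + n.natAbs ≤ 2 * (n * (n - 1)) := by
        have e1 : ((n.natAbs : ℕ) : ℝ) = (((n.natAbs : ℕ) : ℤ) : ℝ) := by simp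
        rw [e1]; exact_mod_cast this
      linarith
    have hm0 : (0:ℝ) ≤ n.natAbs := by positivity
    generalize (n.natAbs : ℝ) = m at hm hm0
    generalize ((n:ℝ) * (n - 1) / 2) = k at hm
    have hpp : 0 < Real.pi ^ 2 := by positivity
    generalize Real.pi ^ 2 = p at hpp
    have a1 := mul_le_mul_of_nonneg_left hm (by positivity : 0 ≤ p * ρ)
    have a2 := mul_le_mul_of_nonneg_left hρ (by positivity : 0 ≤ p * m)
    nlinarith
  have : ‖thE t - (1 + Complex.I)‖ ≤ X * S := by
    have e : thE t - (1 + Complex.I) = ∑' n : ℤ, (jacobiTheta₂_term n (1 / 4 - Complex.I * Real.pi / (4 * t)) (Complex.I * Real.pi / (2 * t)) -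
      ((if n = 0 then (1:ℂ) else 0) + if n = 1 then Complex.I else 0)) := h3.tsum_eq.symm
    rw [e]
    exact tsum_of_norm_bounded (hsum0.hasSum.mul_left X) hG
  have hX0 : 0 < X := Real.exp_pos _
  nlinarith

open scoped Classical
open Filter Topology MeasureTheory

noncomputable def Rq (q : ℂ) : ℂ := Pq q * ∑' j, cj zeta7 q j * q ^ (j * j)

noncomputable def kap : ℝ := 9 * Real.pi ^ 2 / 392

noncomputable def Fm (t : ℂ) : ℂ := Rq (Complex.exp (-t)) * Complex.exp (-(kap / t) + t / 8)

lemma sqrt_scale {r : ℝ} (hr : 0 < r) {x : ℂ} (hx : x ≠ 0) :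
    ((r : ℂ) * x) ^ (1 / 2 : ℂ) = Real.sqrt r * x ^ (1 / 2 : ℂ) := by
  have hr0 : (r : ℂ) ≠ 0 := by exact_mod_cast hr.ne'
  rw [Complex.cpow_def_of_ne_zero (mul_ne_zero hr0 hx), Complex.log_ofReal_mul hr hx, add_mul, Complex.exp_add,
    Complex.cpow_def_of_ne_zero hx, Real.sqrt_eq_rpow, Real.rpow_def_of_pos hr]
  push_cast; rfl

lemma cpow_half_sq (x : ℂ) : x ^ (1 / 2 : ℂ) * x ^ (1 / 2 : ℂ) = x := by
  have := Complex.cpow_nat_mul x 2 (1 / 2)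
  rw [← pow_two, ← this]; norm_num

/-- the correction term -/
noncomputable def Er (t : ℂ) : ℂ := t * ((∑' j, cj zeta7 (Complex.exp (-t)) j * Complex.exp (-t) ^ (j * j)) - mainT t) *
  Complex.exp ((5 * Real.pi ^ 2 / 49) / t)

lemma Fm_eq (t : ℂ) (ht : 0 < t.re) :
    Real.sqrt t.re * Fm t = Real.sqrt (2 / Real.pi) * ((t / t.re) ^ (1 / 2 : ℂ) / (t / t.re)) *
      (Complex.exp (Complex.I * Real.pi / 4) / thE t) * (2 * Real.pi * Real.sin (Real.pi / 7) + Er t) := by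
  have hp : (Real.pi : ℂ) ≠ 0 := by exact_mod_cast Real.pi_ne_zero
  have ht0 : t ≠ 0 := by rintro rfl; simp at ht
  have hσ0 : (t.re : ℂ) ≠ 0 := by exact_mod_cast ht.ne'
  have hq : ‖Complex.exp (-t)‖ < 1 := by
    rw [Complex.norm_exp]; exact Real.exp_lt_one_iff.mpr (by simpa using ht)
  obtain ⟨hs, he⟩ := theta_eq t ht
  have hP := theta_P hq
  rw [tet_eq hs, he] at hP
  have hx0 : t / t.re ≠ 0 := div_ne_zero ht0 hσ0
  have hS : (2 * t / Real.pi : ℂ) ^ (1 / 2 : ℂ) = Real.sqrt (2 * t.re / Real.pi) * (t / t.re) ^ (1 / 2 : ℂ) := by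
    rw [← sqrt_scale (by have := Real.pi_pos; positivity) hx0]
    congr 1; push_cast; field_simp
  have hsq : Real.sqrt (2 * t.re / Real.pi) * Real.sqrt t.re = t.re * Real.sqrt (2 / Real.pi) := by
    rw [show 2 * t.re / Real.pi = t.re * (2 / Real.pi) by ring, Real.sqrt_mul ht.le]
    have := Real.mul_self_sqrt ht.le
    linear_combination Real.sqrt (2 / Real.pi) * this
  have hsqC : (Real.sqrt (2 * t.re / Real.pi) : ℂ) * Real.sqrt t.re = t.re * Real.sqrt (2 / Real.pi) := by exact_mod_cast hsq
  have hS0 : (2 * t / Real.pi : ℂ) ^ (1 / 2 : ℂ) ≠ 0 := by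
    rw [Complex.cpow_def_of_ne_zero (div_ne_zero (mul_ne_zero two_ne_zero ht0) hp)]; exact Complex.exp_ne_zero _
  have hth : thE t ≠ 0 := by intro h; rw [h] at hP; simp at hP
  set Λ := ∑' j, cj zeta7 (Complex.exp (-t)) j * Complex.exp (-t) ^ (j * j) with hΛ
  have hPq : Pq (Complex.exp (-t)) = (2 * t / Real.pi : ℂ) ^ (1 / 2 : ℂ) / thE t *
      Complex.exp ((Real.pi ^ 2 / 8) / t + Complex.I * Real.pi / 4 - t / 8) := by
    have e : Complex.exp (-(Real.pi ^ 2 / 8) / t - Complex.I * Real.pi / 4 + t / 8) =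
      (Complex.exp ((Real.pi ^ 2 / 8) / t + Complex.I * Real.pi / 4 - t / 8))⁻¹ := by
      rw [← Complex.exp_neg]; congr 1; ring
    rw [e] at hP
    have := Complex.exp_ne_zero ((Real.pi ^ 2 / 8) / t + Complex.I * Real.pi / 4 - t / 8)
    field_simp at hP ⊢
    linear_combination hP
  have hE : 2 * Real.pi * Real.sin (Real.pi / 7) + Er t = t * Λ * Complex.exp ((5 * Real.pi ^ 2 / 49) / t) := by
    rw [Er, ← hΛ, mainT]
    have e : Complex.exp (-(5 * Real.pi ^ 2 / 49) / t) = (Complex.exp ((5 * Real.pi ^ 2 / 49) / t))⁻¹ := by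
      rw [← Complex.exp_neg]; congr 1; ring
    rw [e]
    have := Complex.exp_ne_zero ((5 * Real.pi ^ 2 / 49) / t)
    field_simp
    ring
  have hexp : Complex.exp ((Real.pi ^ 2 / 8) / t + Complex.I * Real.pi / 4 - t / 8) * Complex.exp (-(kap / t) + t / 8) =
      Complex.exp (Complex.I * Real.pi / 4) * Complex.exp ((5 * Real.pi ^ 2 / 49) / t) := by
    rw [← Complex.exp_add, ← Complex.exp_add]; congr 1
    rw [kap]; push_cast; field_simp; ring
  rw [hE, Fm, Rq, ← hΛ, hPq, hS]
  generalize (t / t.re : ℂ) ^ (1 / 2 : ℂ) = y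
  generalize Complex.exp ((Real.pi ^ 2 / 8) / t + Complex.I * Real.pi / 4 - t / 8) = E1 at *
  generalize Complex.exp (-(kap / t) + t / 8) = E2 at *
  generalize Complex.exp (Complex.I * Real.pi / 4) = E3 at *
  generalize Complex.exp ((5 * Real.pi ^ 2 / 49) / t) = E4 at *
  generalize (Real.sqrt (2 / Real.pi) : ℂ) = s2 at *
  generalize (Real.sqrt (2 * t.re / Real.pi) : ℂ) = s3 at *
  field_simp
  linear_combination (y * Λ * E1 * E2) * hsqC + (y * Λ * t.re * s2) * hexp

lemma Er_bound (K : ℝ) (hK : 0 ≤ K) : ∃ C > 0, ∀ t : ℂ, 0 < t.re → t.re ≤ 1 → |t.im| ≤ K * t.re →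
    ‖Er t‖ ≤ C * Real.sqrt t.re := by
  obtain ⟨C, hC, hb⟩ := Lam_a K hK
  refine ⟨(1 + K) * C, by positivity, fun t ht ht1 hti => ?_⟩
  have h := hb t ht ht1 hti
  have hρ := one_div_re t ht
  have hsq : 0 < Real.sqrt t.re := Real.sqrt_pos.mpr ht
  have htn : ‖t‖ ≤ (1 + K) * t.re := by
    refine (Complex.norm_le_abs_re_add_abs_im t).trans ?_
    rw [abs_of_pos ht]; linarith
  have he : ‖Complex.exp ((5 * Real.pi ^ 2 / 49) / t)‖ = Real.exp ((5 * Real.pi ^ 2 / 49) * (1 / t).re) := by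
    rw [Complex.norm_exp]
    have : (5 * Real.pi ^ 2 / 49 : ℂ) / t = ((5 * Real.pi ^ 2 / 49 : ℝ) : ℂ) * (1 / t) := by push_cast; ring
    rw [this, Complex.re_ofReal_mul]
  rw [Er, norm_mul, norm_mul, he]
  have hx : Real.exp (-(Real.pi ^ 2 / 8) * (1 / t).re) * Real.exp ((5 * Real.pi ^ 2 / 49) * (1 / t).re) ≤ 1 := by
    rw [← Real.exp_add, Real.exp_le_one_iff]
    have : 0 < Real.pi ^ 2 * (1 / t).re := by have := Real.pi_pos; positivity
    linarith
  calc _ ≤ ((1 + K) * t.re) * (C / Real.sqrt t.re * Real.exp (-(Real.pi ^ 2 / 8) * (1 / t).re)) *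
        Real.exp ((5 * Real.pi ^ 2 / 49) * (1 / t).re) := by gcongr
    _ = (1 + K) * C * (t.re / Real.sqrt t.re) * (Real.exp (-(Real.pi ^ 2 / 8) * (1 / t).re) * Real.exp ((5 * Real.pi ^ 2 / 49) * (1 / t).re)) := by ring
    _ ≤ (1 + K) * C * (t.re / Real.sqrt t.re) * 1 := by gcongr
    _ = _ := by rw [Real.div_sqrt, mul_one]

lemma rho_ge (K : ℝ) : ∀ M : ℝ, ∃ σ0 > 0, ∀ t : ℂ, 0 < t.re → t.re ≤ σ0 → |t.im| ≤ K * t.re → M ≤ (1 / t).re := by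
  intro M
  refine ⟨1 / ((1 + K ^ 2) * (|M| + 1)), by positivity, fun t ht ht1 hti => ?_⟩
  refine le_trans ?_ (rho_lower K t ht hti)
  rw [le_div_iff₀ (by positivity)] at ht1 ⊢
  have h1 : (0:ℝ) < (1 + K ^ 2) * t.re := by positivity
  have := le_abs_self M
  nlinarith

lemma thE_lower (K : ℝ) : ∃ σ0 > 0, ∀ t : ℂ, 0 < t.re → t.re ≤ σ0 → |t.im| ≤ K * t.re → 1 / 2 ≤ ‖thE t‖ := by
  obtain ⟨C, hC, hb⟩ := thE_bound
  obtain ⟨σ0, h0, h1⟩ := rho_ge K (max 1 (2 * C))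
  refine ⟨σ0, h0, fun t ht ht1 hti => ?_⟩
  have hρ := h1 t ht ht1 hti
  have hρ1 := (le_max_left _ _).trans hρ
  have hρ2 := (le_max_right _ _).trans hρ
  have h2 := hb t ht hρ1
  have hpi := Real.pi_gt_three
  have h3 : C * Real.exp (-(Real.pi ^ 2 / 2) * (1 / t).re) ≤ 1 / 2 := by
    have : Real.exp (-(Real.pi ^ 2 / 2) * (1 / t).re) ≤ 1 / (2 * C) := by
      have a1 : 2 * C ≤ Real.exp ((1 / t).re) := hρ2.trans (by linarith [Real.add_one_le_exp (1 / t).re])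
      have a2 : Real.exp (-(Real.pi ^ 2 / 2) * (1 / t).re) ≤ Real.exp (-(1 / t).re) := by
        apply Real.exp_le_exp.mpr
        have : 1 ≤ Real.pi ^ 2 / 2 := by nlinarith
        nlinarith
      refine a2.trans ?_
      rw [Real.exp_neg, ← one_div]
      exact one_div_le_one_div_of_le (by positivity) a1
    calc _ ≤ C * (1 / (2 * C)) := by gcongr
      _ = 1 / 2 := by field_simp
  have h4 : 1 ≤ ‖1 + Complex.I‖ := by
    have := Complex.abs_re_le_norm (1 + Complex.I); simpa using this
  have h5 := norm_sub_norm_le (1 + Complex.I) (thE t)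
  rw [norm_sub_rev] at h5
  linarith

lemma Fm_bound (K : ℝ) (hK : 0 ≤ K) : ∃ C > 0, ∃ σ0 > 0, ∀ t : ℂ, 0 < t.re → t.re ≤ σ0 → |t.im| ≤ K * t.re →
    ‖(Real.sqrt t.re : ℂ) * Fm t‖ ≤ C := by
  obtain ⟨C, hC, hb⟩ := Er_bound K hK
  obtain ⟨σ0, h0, h1⟩ := thE_lower K
  refine ⟨1 * 1 * 2 * (2 * Real.pi + C), by have := Real.pi_pos; positivity, min σ0 1, by positivity, fun t ht ht1 hti => ?_⟩
  have hl := h1 t ht (ht1.trans (min_le_left _ _)) hti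
  have hle : t.re ≤ 1 := ht1.trans (min_le_right _ _)
  have he := hb t ht hle hti
  have ht0 : t ≠ 0 := by rintro rfl; simp at ht
  have hpi := Real.pi_gt_three
  have hσ0 : (t.re : ℂ) ≠ 0 := by exact_mod_cast ht.ne'
  rw [Fm_eq t ht, norm_mul, norm_mul, norm_mul]
  have n1 : ‖(Real.sqrt (2 / Real.pi) : ℂ)‖ ≤ 1 := by
    rw [Complex.norm_real, Real.norm_of_nonneg (Real.sqrt_nonneg _), Real.sqrt_le_one, div_le_one (by positivity)]
    linarith
  have hx1 : 1 ≤ ‖t / t.re‖ := by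
    rw [norm_div, Complex.norm_real, Real.norm_of_nonneg ht.le, one_le_div ht]
    exact (le_abs_self _).trans (Complex.abs_re_le_norm t)
  have n2 : ‖(t / t.re : ℂ) ^ (1 / 2 : ℂ)‖ / ‖t / t.re‖ ≤ 1 := by
    rw [div_le_one (by linarith)]
    have := congrArg norm (cpow_half_sq (t / t.re))
    rw [norm_mul] at this
    have h3 := norm_nonneg ((t / t.re : ℂ) ^ (1 / 2 : ℂ))
    nlinarith
  have n3 : ‖Complex.exp (Complex.I * Real.pi / 4)‖ / ‖thE t‖ ≤ 2 := by
    have : Complex.I * Real.pi / 4 = ((Real.pi / 4 : ℝ) : ℂ) * Complex.I := by push_cast; ring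
    rw [this, Complex.norm_exp_ofReal_mul_I, div_le_iff₀ (by linarith)]
    linarith
  have n4 : ‖(2 * Real.pi * Real.sin (Real.pi / 7) + Er t : ℂ)‖ ≤ 2 * Real.pi + C := by
    refine (norm_add_le _ _).trans ?_
    have : ‖(2 * Real.pi * Real.sin (Real.pi / 7) : ℂ)‖ ≤ 2 * Real.pi := by
      have e : (2 * Real.pi * Real.sin (Real.pi / 7) : ℂ) = ((2 * Real.pi * Real.sin (Real.pi / 7) : ℝ) : ℂ) := by push_cast; ring
      rw [e, Complex.norm_real, Real.norm_eq_abs, abs_mul, abs_of_pos (by positivity : 0 < 2 * Real.pi)]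
      have := Real.abs_sin_le_one (Real.pi / 7)
      nlinarith
    have h6 : Real.sqrt t.re ≤ 1 := Real.sqrt_le_one.mpr hle
    have : C * Real.sqrt t.re ≤ C * 1 := by gcongr
    linarith
  rw [← norm_div] at n2 n3
  gcongr

lemma Fm_lim {ι : Type*} (l : Filter ι) (t : ι → ℂ) (h1 : ∀ᶠ i in l, 0 < (t i).re)
    (h2 : Tendsto (fun i => (t i).re) l (𝓝 0)) (h3 : Tendsto (fun i => t i / (t i).re) l (𝓝 1)) :
    Tendsto (fun i => (Real.sqrt (t i).re : ℂ) * Fm (t i)) l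
      (𝓝 ((2 * Real.sqrt Real.pi * Real.sin (Real.pi / 7) : ℝ) : ℂ)) := by
  have hpi := Real.pi_pos
  have hcone : ∀ᶠ i in l, |(t i).im| ≤ 1 * (t i).re := by
    have h4 : Tendsto (fun i => (t i / (t i).re).im) l (𝓝 0) := by
      have := (Complex.continuous_im.tendsto 1).comp h3
      rw [Complex.one_im] at this
      exact this
    have h5 := h4.abs
    rw [abs_zero] at h5
    filter_upwards [h5.eventually_lt_const (by norm_num : (0:ℝ) < 1), h1] with i hi hp
    rw [Complex.div_ofReal_im, abs_div, abs_of_pos hp, div_lt_one hp] at hi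
    linarith
  have hsq : Tendsto (fun i => Real.sqrt (t i).re) l (𝓝 0) := by
    have := (Real.continuous_sqrt.tendsto 0).comp h2
    rw [Real.sqrt_zero] at this
    exact this
  have hEr : Tendsto (fun i => Er (t i)) l (𝓝 0) := by
    obtain ⟨C, hC, hb⟩ := Er_bound 1 zero_le_one
    refine squeeze_zero_norm' (a := fun i => C * Real.sqrt (t i).re) ?_ (by simpa using hsq.const_mul C)
    filter_upwards [hcone, h1, h2.eventually_lt_const (by norm_num : (0:ℝ) < 1)] with i a b c
    exact hb _ b c.le a
  have hth : Tendsto (fun i => thE (t i)) l (𝓝 (1 + Complex.I)) := by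
    obtain ⟨C, hC, hb⟩ := thE_bound
    have hρ : Tendsto (fun i => (1 / t i).re) l atTop := by
      rw [tendsto_atTop]
      intro M
      obtain ⟨σ0, s0, s1⟩ := rho_ge 1 M
      filter_upwards [hcone, h1, h2.eventually_lt_const s0] with i a b c
      exact s1 _ b c.le a
    rw [tendsto_iff_norm_sub_tendsto_zero]
    refine squeeze_zero' (g := fun i => C * Real.exp (-(Real.pi ^ 2 / 2) * (1 / t i).re)) (Eventually.of_forall fun _ => norm_nonneg _) ?_ ?_
    · filter_upwards [h1, hρ.eventually_ge_atTop 1] with i a b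
      exact hb _ a b
    · have : Tendsto (fun i => -(Real.pi ^ 2 / 2) * (1 / t i).re) l atBot :=
        hρ.const_mul_atTop_of_neg (by nlinarith)
      simpa using (Real.tendsto_exp_atBot.comp this).const_mul C
  have hne : (1 + Complex.I) ≠ 0 := by
    intro h; have := congrArg Complex.re h; simp at this
  have hcp : Tendsto (fun i => (t i / (t i).re) ^ (1 / 2 : ℂ)) l (𝓝 1) := by
    have := (continuousAt_cpow_const (a := 1) (b := (1 / 2 : ℂ)) Complex.one_mem_slitPlane).tendsto.comp h3
    rw [Complex.one_cpow] at this
    exact this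
  have hmain := ((((hcp.div h3 one_ne_zero).const_mul (Real.sqrt (2 / Real.pi) : ℂ)).mul
    ((tendsto_const_nhds (x := Complex.exp (Complex.I * Real.pi / 4))).div hth hne)).mul
    (hEr.const_add (2 * Real.pi * Real.sin (Real.pi / 7) : ℂ)))
  have hval : (Real.sqrt (2 / Real.pi) : ℂ) * (1 / 1) * (Complex.exp (Complex.I * Real.pi / 4) / (1 + Complex.I)) *
      (2 * Real.pi * Real.sin (Real.pi / 7) + 0) = ((2 * Real.sqrt Real.pi * Real.sin (Real.pi / 7) : ℝ) : ℂ) := by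
    have e1 : Complex.exp (Complex.I * Real.pi / 4) = (Real.sqrt 2 / 2 : ℝ) * (1 + Complex.I) := by
      have : Complex.I * Real.pi / 4 = ((Real.pi / 4 : ℝ) : ℂ) * Complex.I := by push_cast; ring
      rw [this, Complex.exp_mul_I, ← Complex.ofReal_cos, ← Complex.ofReal_sin, Real.cos_pi_div_four, Real.sin_pi_div_four]
      ring
    rw [e1, mul_div_assoc, div_self hne]
    have e2 : Real.sqrt (2 / Real.pi) * (Real.sqrt 2 / 2) * (2 * Real.pi) = 2 * Real.sqrt Real.pi := by
      rw [Real.sqrt_div (by norm_num)]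
      have a := Real.mul_self_sqrt (by norm_num : (0:ℝ) ≤ 2)
      have b := Real.mul_self_sqrt hpi.le
      have c : Real.sqrt Real.pi ≠ 0 := (Real.sqrt_pos.mpr hpi).ne'
      field_simp
      nlinarith
    rw [show 2 * Real.sqrt Real.pi = _ from e2.symm]
    push_cast; ring
  rw [hval] at hmain
  refine hmain.congr' ?_
  filter_upwards [h1] with i hi
  exact (Fm_eq (t i) hi).symm

open scoped Classical
open Filter Topology MeasureTheory

lemma dist_lem (s θ : ℝ) (hs : 0 ≤ s) (hθ : |θ| ≤ Real.pi) :
    2 / Real.pi * |θ| - s ≤ ‖Complex.exp (-(s + θ * Complex.I)) - 1‖ := by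
  have h1 : ‖Complex.exp (Complex.I * ((-θ : ℝ) : ℂ)) - 1‖ = ‖2 * Real.sin (-θ / 2)‖ := Complex.norm_exp_I_mul_ofReal_sub_one _
  have h2 : 2 / Real.pi * |-θ / 2| ≤ |Real.sin (-θ / 2)| := Real.mul_abs_le_abs_sin (by
    rw [abs_div, abs_neg, abs_two]; linarith)
  have h3 : 2 / Real.pi * |θ| ≤ ‖Complex.exp (Complex.I * ((-θ : ℝ) : ℂ)) - 1‖ := by
    rw [h1, norm_mul, Real.norm_eq_abs, Real.norm_eq_abs, abs_two]
    rw [abs_div, abs_neg, abs_two] at h2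
    linarith
  set u := Complex.exp (Complex.I * ((-θ : ℝ) : ℂ)) with hu
  have hun : ‖u‖ = 1 := by rw [hu, mul_comm, Complex.norm_exp_ofReal_mul_I]
  have e : Complex.exp (-(s + θ * Complex.I)) = (Real.exp (-s) : ℂ) * u := by
    rw [hu, Complex.ofReal_exp, ← Complex.exp_add]; congr 1; push_cast; ring
  have h4 : ‖u - 1‖ ≤ ‖(Real.exp (-s) : ℂ) * u - 1‖ + ‖((1 - Real.exp (-s) : ℝ) : ℂ) * u‖ := by
    refine le_trans (le_of_eq ?_) (norm_add_le _ _)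
    congr 1; push_cast; ring
  rw [norm_mul, hun, Complex.norm_real, mul_one, Real.norm_eq_abs, abs_of_nonneg (by
    have : Real.exp (-s) ≤ 1 := Real.exp_le_one_iff.mpr (by linarith)
    linarith)] at h4
  rw [e]
  have := Real.add_one_le_exp (-s)
  linarith

lemma tau2_near (t : ℂ) (ht : 0 < t.re) (hn : ‖t‖ ≤ 1 / 4) (q : ℂ) (hq : q ^ 2 = -Complex.exp (-(2 * t))) :
    (tauq q 2).re ≤ 1 / 4 * (1 / t).re + 1 := by
  have ht0 : t ≠ 0 := by rintro rfl; simp at ht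
  set z := 2 * t with hz
  have hz0 : z ≠ 0 := mul_ne_zero two_ne_zero ht0
  have hzn : ‖z‖ ≤ 1 / 2 := by rw [hz, norm_mul]; simp; linarith
  have hzp : 0 < ‖z‖ := norm_pos_iff.mpr hz0
  have h1 := Complex.norm_exp_sub_one_sub_id_le (x := z) (by linarith)
  have h2 : ‖z‖ / 2 ≤ ‖Complex.exp z - 1‖ := by
    have h3 := norm_sub_norm_le z (Complex.exp z - 1)
    rw [norm_sub_rev z] at h3
    nlinarith
  have hne : Complex.exp z - 1 ≠ 0 := by
    intro h; rw [h, norm_zero] at h2; linarith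
  have h4 : ‖1 / (Complex.exp z - 1) - 1 / z‖ ≤ 2 := by
    rw [div_sub_div _ _ hne hz0, norm_div, norm_mul, div_le_iff₀ (by positivity)]
    have e : 1 * z - (Complex.exp z - 1) * 1 = -(Complex.exp z - 1 - z) := by ring
    rw [e, norm_neg]
    nlinarith
  have h5 : tauq q 2 = 1 / 2 * (1 / (Complex.exp z - 1)) := by
    have e : (-q) ^ 2 = -Complex.exp (-z) := by rw [neg_sq, hq]
    have hE := Complex.exp_ne_zero z
    rw [tauq, e, Complex.exp_neg]
    have hd : 1 + -(Complex.exp z)⁻¹ ≠ 0 := by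
      intro h; apply hne
      field_simp at h
      linear_combination h
    push_cast
    have e2 : 1 + -(Complex.exp z)⁻¹ = (Complex.exp z - 1) / Complex.exp z := by field_simp; ring
    rw [e2]
    field_simp
  have h6 : tauq q 2 = ((1 / 4 : ℝ) : ℂ) * (1 / t) + ((1 / 2 : ℝ) : ℂ) * (1 / (Complex.exp z - 1) - 1 / z) := by
    rw [h5, hz]; push_cast; field_simp; ring
  rw [h6, Complex.add_re, Complex.re_ofReal_mul, Complex.re_ofReal_mul]
  have := (Complex.re_le_norm (1 / (Complex.exp z - 1) - 1 / z)).trans h4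
  linarith

lemma minor : ∃ C > 0, ∃ σ0 > 0, ∀ σ φ : ℝ, 0 < σ → σ ≤ σ0 → |φ| ≤ Real.pi → 10 ^ 6 * σ ≤ |φ| →
    ‖Rq (Complex.exp (-(σ + φ * Complex.I)))‖ ≤ C / σ ^ 3 * Real.exp (0.2225 / σ) := by
  obtain ⟨C, hC, hb⟩ := Lam_b (10 ^ 6) (by positivity)
  refine ⟨C * Real.exp 1 + 64, by positivity, 1 / 10 ^ 8, by positivity, fun σ φ hσ hσ1 hφ hφ2 => ?_⟩
  have hpi := Real.pi_pos
  have hpi4 := Real.pi_lt_d2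
  have hpi3 := Real.pi_gt_d2
  set q := Complex.exp (-(σ + φ * Complex.I)) with hq
  have hre : (-(σ + φ * Complex.I) : ℂ).re = -σ := by simp
  have hqn : ‖q‖ = Real.exp (-σ) := by rw [hq, Complex.norm_exp, hre]
  have hq1 : ‖q‖ < 1 := by rw [hqn]; exact Real.exp_lt_one_iff.mpr (by linarith)
  have hf : (0.63 : ℝ) ≤ 2 / Real.pi := by rw [le_div_iff₀ hpi]; linarith
  have hd := dist_lem σ φ hσ.le hφ
  rw [← hq] at hd
  have h1 : 300000 * σ ≤ ‖q - 1‖ := by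
    have : 0.63 * |φ| ≤ 2 / Real.pi * |φ| := by gcongr
    linarith
  have hP := Pq_upper hqn hσ (by linarith) h1
  obtain ⟨ε, hε, hψ⟩ : ∃ ε : ℝ, (ε = 1 ∨ ε = -1) ∧ |2 * (φ + Real.pi * ε / 2)| ≤ Real.pi := by
    rw [abs_le] at hφ
    rcases le_total φ 0 with h | h
    · exact ⟨1, Or.inl rfl, by rw [abs_le]; constructor <;> linarith⟩
    · exact ⟨-1, Or.inr rfl, by rw [abs_le]; constructor <;> linarith⟩
  set ψ := φ + Real.pi * ε / 2 with hψd
  have hmone : Complex.exp (Real.pi * ε * Complex.I) = -1 := by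
    rcases hε with h | h
    · rw [h, ← Complex.exp_pi_mul_I]; congr 1; push_cast; ring
    · rw [h, show (-1:ℂ) = (-1)⁻¹ by norm_num, ← Complex.exp_pi_mul_I, ← Complex.exp_neg]; congr 1; push_cast; ring
  rw [Rq, norm_mul]
  set Λ := ∑' j, cj zeta7 q j * q ^ (j * j) with hΛ
  have hexp0 : 0 < Real.exp (0.2225 / σ) := Real.exp_pos _
  have hmono : ∀ a : ℝ, a ≤ 0.2225 → Real.exp (a / σ) ≤ Real.exp (0.2225 / σ) := by
    intro a ha; apply Real.exp_le_exp.mpr; gcongr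
  have hq2 : q ^ 2 = -Complex.exp (-((2 * σ : ℝ) + (2 * ψ : ℝ) * Complex.I)) := by
    have : q ^ 2 = Complex.exp (-((2 * σ : ℝ) + (2 * ψ : ℝ) * Complex.I)) * Complex.exp (Real.pi * ε * Complex.I) := by
      rw [hq, ← Complex.exp_nat_mul, ← Complex.exp_add]; congr 1; rw [hψd]; push_cast; ring
    rw [this, hmone]; ring
  rcases le_or_gt |ψ| (10 ^ 6 * σ) with hn | hf2
  · -- near plus or minus i
    set t : ℂ := σ + ψ * Complex.I with htd
    have htre : t.re = σ := by simp [htd]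
    have htim : t.im = ψ := by simp [htd]
    have hqt : q = Complex.exp (Real.pi * ε / 2 * Complex.I - t) := by
      rw [hq, htd]; congr 1; rw [hψd]; push_cast; ring
    have hL := hb t (by rw [htre]; exact hσ) (by rw [htre]; linarith) (by rw [htre, htim]; exact hn) ε hε q hqt
    have htn : ‖t‖ ≤ 1 / 4 := by
      refine (Complex.norm_le_abs_re_add_abs_im t).trans ?_
      rw [htre, htim, abs_of_pos hσ]; linarith
    have hτ := tau2_near t (by rw [htre]; exact hσ) htn q (by
      rw [hq2, htd]; congr 3; push_cast; ring)
    have hρ := one_div_re t (by rw [htre]; exact hσ)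
    rw [htre] at hL
    rw [← hΛ] at hL
    set ρ := (1 / t).re with hρd
    have hsq : σ ^ 3 ≤ Real.sqrt σ := by
      have : σ ≤ Real.sqrt σ := by
        rw [Real.le_sqrt hσ.le hσ.le]; nlinarith
      nlinarith [pow_pos hσ 2]
    have e1 : Real.exp ((tauq q 2).re + 0.2195 / σ) * Real.exp (-(Real.pi ^ 2 / 32) * ρ) ≤ Real.exp 1 * Real.exp (0.2225 / σ) := by
      rw [← Real.exp_add, ← Real.exp_add]
      apply Real.exp_le_exp.mpr
      have : 0.2195 / σ ≤ 0.2225 / σ := by gcongr; norm_num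
      have : 1 / 4 ≤ Real.pi ^ 2 / 32 := by nlinarith
      nlinarith
    calc ‖Pq q‖ * ‖Λ‖ ≤ Real.exp ((tauq q 2).re + 0.2195 / σ) * (C / Real.sqrt σ * Real.exp (-(Real.pi ^ 2 / 32) * ρ)) := by gcongr
      _ = C / Real.sqrt σ * (Real.exp ((tauq q 2).re + 0.2195 / σ) * Real.exp (-(Real.pi ^ 2 / 32) * ρ)) := by ring
      _ ≤ C / σ ^ 3 * (Real.exp 1 * Real.exp (0.2225 / σ)) := by gcongr
      _ = (C * Real.exp 1) / σ ^ 3 * Real.exp (0.2225 / σ) := by ring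
      _ ≤ _ := by gcongr; linarith
  · have hd2 := dist_lem (2 * σ) (2 * ψ) (by linarith) hψ
    have hg : 100 * ((2:ℕ):ℝ) * σ ≤ ‖1 + (-q) ^ 2‖ := by
      have e : 1 + (-q) ^ 2 = -(Complex.exp (-((2 * σ : ℝ) + (2 * ψ : ℝ) * Complex.I)) - 1) := by
        rw [neg_sq, hq2]; ring
      rw [e, norm_neg]
      rw [abs_mul, abs_two] at hd2
      have : 0.63 * (2 * |ψ|) ≤ 2 / Real.pi * (2 * |ψ|) := by gcongr
      push_cast
      push_cast at hd2
      linarith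
    have hτ := tau_good hq1 hσ (by norm_num : (0:ℝ) < 100) 2 hg
    have hτ2 : (tauq q 2).re ≤ 0.0025 / σ := by
      refine ((Complex.re_le_norm _).trans hτ).trans (le_of_eq ?_)
      push_cast; field_simp; norm_num
    have hL := Lam_trivial hq1 zeta7_norm
    rw [← hΛ] at hL
    have h1q : σ / 2 ≤ 1 - ‖q‖ := by
      rw [hqn]
      have h5 := Real.add_one_le_exp σ
      have h6 : Real.exp (-σ) ≤ 1 / (σ + 1) := by
        rw [Real.exp_neg, ← one_div]; exact one_div_le_one_div_of_le (by linarith) h5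
      have h7 : 1 / (σ + 1) ≤ 1 - σ / 2 := by
        rw [div_le_iff₀ (by linarith)]; nlinarith
      linarith
    have hL2 : ‖Λ‖ ≤ 64 / σ ^ 3 := by
      refine hL.trans ?_
      calc 8 / (1 - ‖q‖) ^ 3 ≤ 8 / (σ / 2) ^ 3 := by gcongr
        _ = 64 / σ ^ 3 := by field_simp; norm_num
    have hP2 : ‖Pq q‖ ≤ Real.exp (0.2225 / σ) := by
      refine hP.trans ((Real.exp_le_exp.mpr ?_).trans (hmono 0.222 (by norm_num)))
      have : 0.222 / σ = 0.0025 / σ + 0.2195 / σ := by rw [← add_div]; norm_num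
      linarith
    calc ‖Pq q‖ * ‖Λ‖ ≤ Real.exp (0.2225 / σ) * (64 / σ ^ 3) := by gcongr
      _ = 64 / σ ^ 3 * Real.exp (0.2225 / σ) := by ring
      _ ≤ _ := by
        gcongr
        have : 0 < C * Real.exp 1 := by positivity
        linarith

open scoped Classical
open Filter Topology MeasureTheory

lemma Rq_hasSum (t : ℂ) (ht : 0 < t.re) : HasSum (fun n : ℕ => Acoef 1 7 n * Complex.exp (-t) ^ n) (Rq (Complex.exp (-t))) := by
  have hq : ‖Complex.exp (-t)‖ < 1 := by
    rw [Complex.norm_exp]; exact Real.exp_lt_one_iff.mpr (by simpa using ht)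
  exact (Acoef_gen hq).2

lemma norm_exp_line (σ φ : ℝ) : ‖Complex.exp (-(σ + φ * Complex.I))‖ = Real.exp (-σ) := by
  rw [Complex.norm_exp]; simp

lemma Acoef_summable (σ : ℝ) (hσ : 0 < σ) : Summable (fun n : ℕ => ‖Acoef 1 7 n‖ * Real.exp (-σ) ^ n) := by
  have hq : ‖(Real.exp (-σ) : ℂ)‖ < 1 := by
    rw [Complex.norm_real, Real.norm_of_nonneg (Real.exp_pos _).le]; exact Real.exp_lt_one_iff.mpr (by linarith)
  refine (Acoef_gen hq).1.congr fun n => ?_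
  rw [norm_mul, norm_pow, Complex.norm_real, Real.norm_of_nonneg (Real.exp_pos _).le]

lemma Rq_cont (σ : ℝ) (hσ : 0 < σ) : Continuous (fun φ : ℝ => Rq (Complex.exp (-(σ + φ * Complex.I)))) := by
  have h : (fun φ : ℝ => Rq (Complex.exp (-(σ + φ * Complex.I)))) =
      fun φ : ℝ => ∑' n : ℕ, Acoef 1 7 n * Complex.exp (-(σ + φ * Complex.I)) ^ n := by
    funext φ
    exact (Rq_hasSum (σ + φ * Complex.I) (by simpa using hσ)).tsum_eq.symm
  rw [h]
  refine continuous_tsum (fun n => by fun_prop) (Acoef_summable σ hσ) (fun n φ => ?_)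
  rw [norm_mul, norm_pow, norm_exp_line]

lemma int_exp_orth (m n : ℕ) : ∫ φ in (-Real.pi)..Real.pi, Complex.exp (((n : ℂ) - m) * Complex.I * φ) =
    if m = n then (2 * Real.pi : ℂ) else 0 := by
  by_cases h : m = n
  · subst h; simp; ring
  · rw [if_neg h]
    have hc : ((n : ℂ) - m) * Complex.I ≠ 0 := by
      refine mul_ne_zero (sub_ne_zero.mpr ?_) Complex.I_ne_zero
      exact_mod_cast Ne.symm h
    rw [integral_exp_mul_complex hc, div_eq_zero_iff]
    left
    rw [sub_eq_zero, Complex.exp_eq_exp_iff_exists_int]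
    exact ⟨(n : ℤ) - m, by push_cast; ring⟩

lemma cauchy_A (σ : ℝ) (hσ : 0 < σ) (n : ℕ) : Acoef 1 7 n * (2 * Real.pi) =
    ∫ φ in (-Real.pi)..Real.pi, Rq (Complex.exp (-(σ + φ * Complex.I))) * Complex.exp (n * (σ + φ * Complex.I)) := by
  have hs : HasSum (fun m : ℕ => ∫ φ in (-Real.pi)..Real.pi, Acoef 1 7 m * Complex.exp (-(σ + φ * Complex.I)) ^ m * Complex.exp (n * (σ + φ * Complex.I)))
      (∫ φ in (-Real.pi)..Real.pi, Rq (Complex.exp (-(σ + φ * Complex.I))) * Complex.exp (n * (σ + φ * Complex.I))) := by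
    refine intervalIntegral.hasSum_integral_of_dominated_convergence
      (fun m φ => ‖Acoef 1 7 m‖ * Real.exp (-σ) ^ m * Real.exp (n * σ)) (fun m => ?_) (fun m => ?_) ?_ ?_ ?_
    · exact Continuous.aestronglyMeasurable (by fun_prop)
    · refine Eventually.of_forall fun φ _ => le_of_eq ?_
      rw [norm_mul, norm_mul, norm_pow, norm_exp_line, Complex.norm_exp]
      congr 2
      simp
    · exact Eventually.of_forall fun φ _ => (Acoef_summable σ hσ).mul_right _
    · exact intervalIntegrable_const
    · exact Eventually.of_forall fun φ _ => (Rq_hasSum (σ + φ * Complex.I) (by simpa using hσ)).mul_right _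
  have h2 : HasSum (fun m : ℕ => if m = n then Acoef 1 7 n * (2 * Real.pi) else 0) (Acoef 1 7 n * (2 * Real.pi)) := hasSum_ite_eq n _
  refine h2.unique (hasSum_cg hs (fun m => ?_) rfl)
  have e : ∀ φ : ℝ, Acoef 1 7 m * Complex.exp (-(σ + φ * Complex.I)) ^ m * Complex.exp (n * (σ + φ * Complex.I)) =
      Acoef 1 7 m * Complex.exp (((n : ℂ) - m) * σ) * Complex.exp (((n : ℂ) - m) * Complex.I * φ) := by
    intro φ
    rw [← Complex.exp_nat_mul, mul_assoc, mul_assoc, ← Complex.exp_add, ← Complex.exp_add]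
    congr 2; ring
  simp only [e]
  rw [intervalIntegral.integral_const_mul, int_exp_orth]
  by_cases h : m = n
  · subst h; simp
  · simp [h]

open scoped Classical
open Filter Topology MeasureTheory

lemma kap_pos : 0 < kap := by unfold kap; have := Real.pi_pos; positivity

/-- rescaled variable -/
noncomputable def xw (L w : ℝ) : ℂ := 1 + ((w / Real.sqrt L : ℝ) : ℂ) * Complex.I

noncomputable def HH (L w : ℝ) : ℂ :=
  (Real.sqrt (kap / L) : ℂ) * Fm ((kap / L : ℝ) * xw L w) * Complex.exp (-((w : ℂ) ^ 2) / xw L w)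

noncomputable def arcI (L : ℝ) : ℂ := ∫ φ in (-(10 ^ 6 * (kap / L)))..(10 ^ 6 * (kap / L)),
  Rq (Complex.exp (-((kap / L : ℝ) + φ * Complex.I))) * Complex.exp (((L ^ 2 / kap + 1 / 8 : ℝ) : ℂ) * ((kap / L : ℝ) + φ * Complex.I))

lemma xw_re (L w : ℝ) : (xw L w).re = 1 := by simp [xw]
lemma xw_im (L w : ℝ) : (xw L w).im = w / Real.sqrt L := by simp [xw]
lemma xw_ne (L w : ℝ) : xw L w ≠ 0 := by
  intro h; have := congrArg Complex.re h; rw [xw_re] at this; simp at this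

lemma arc_integrand (L w : ℝ) (hL : 0 < L) :
    (L * Real.exp (-2 * L) : ℝ) * (((kap / L) / Real.sqrt L : ℝ) : ℂ) *
    (Rq (Complex.exp (-((kap / L : ℝ) + ((w * ((kap / L) / Real.sqrt L) : ℝ) : ℂ) * Complex.I))) *
      Complex.exp (((L ^ 2 / kap + 1 / 8 : ℝ) : ℂ) * ((kap / L : ℝ) + ((w * ((kap / L) / Real.sqrt L) : ℝ) : ℂ) * Complex.I))) =
    (Real.sqrt kap : ℂ) * HH L w := by
  have hk := kap_pos
  have hx := xw_ne L w
  have hLs : 0 < Real.sqrt L := Real.sqrt_pos.mpr hL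
  have hLs2 : Real.sqrt L * Real.sqrt L = L := Real.mul_self_sqrt hL.le
  have hkC : (kap : ℂ) ≠ 0 := by exact_mod_cast hk.ne'
  have hLC : (L : ℂ) ≠ 0 := by exact_mod_cast hL.ne'
  have hLsC : (Real.sqrt L : ℂ) ≠ 0 := by exact_mod_cast hLs.ne'
  have hLs2C : (Real.sqrt L : ℂ) * Real.sqrt L = L := by exact_mod_cast hLs2
  have ht : ((kap / L : ℝ) : ℂ) + ((w * ((kap / L) / Real.sqrt L) : ℝ) : ℂ) * Complex.I = (kap / L : ℝ) * xw L w := by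
    rw [xw]; push_cast; ring
  rw [ht, HH, Fm]
  set x := xw L w with hxd
  have hx2 : (L : ℂ) * (x - 1) ^ 2 = -(w : ℂ) ^ 2 := by
    rw [hxd, xw]; push_cast
    field_simp
    ring_nf
    simp only [Complex.I_sq]
    rw [← hLs2C]; ring
  have he : Complex.exp (((L ^ 2 / kap + 1 / 8 : ℝ) : ℂ) * ((kap / L : ℝ) * x)) =
      Complex.exp (-(kap / (((kap / L : ℝ) : ℂ) * x)) + ((kap / L : ℝ) * x) / 8) * Complex.exp (-((w : ℂ) ^ 2) / x) * Complex.exp (2 * L) := by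
    rw [← Complex.exp_add, ← Complex.exp_add]; congr 1
    rw [← hx2]; push_cast; field_simp; ring
  have hs : (L * Real.exp (-2 * L) : ℝ) * (((kap / L) / Real.sqrt L : ℝ) : ℂ) * Complex.exp (2 * L) = Real.sqrt kap * Real.sqrt (kap / L) := by
    have : L * Real.exp (-2 * L) * ((kap / L) / Real.sqrt L) * Real.exp (2 * L) = Real.sqrt kap * Real.sqrt (kap / L) := by
      rw [Real.sqrt_div hk.le]
      have e1 : Real.exp (-2 * L) * Real.exp (2 * L) = 1 := by rw [← Real.exp_add]; simp
      have e2 := Real.mul_self_sqrt hk.le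
      calc _ = kap / Real.sqrt L * (Real.exp (-2 * L) * Real.exp (2 * L)) := by field_simp
        _ = _ := by rw [e1, mul_one]; nth_rewrite 1 [← e2]; ring
    have h2 : (Real.exp (2 * L) : ℂ) = Complex.exp (2 * L) := by push_cast; rfl
    rw [← h2]; exact_mod_cast this
  rw [he]
  linear_combination (Rq (Complex.exp (-(((kap / L : ℝ) : ℂ) * x))) * Complex.exp (-(kap / (((kap / L : ℝ) : ℂ) * x)) + ((kap / L : ℝ) * x) / 8) *
    Complex.exp (-((w : ℂ) ^ 2) / x)) * hs

lemma arcI_eq (L : ℝ) (hL : 0 < L) : (L * Real.exp (-2 * L) : ℝ) * arcI L =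
    (Real.sqrt kap : ℂ) * ∫ w : ℝ, (Set.Ioc (-(10 ^ 6 * Real.sqrt L)) (10 ^ 6 * Real.sqrt L)).indicator (HH L) w := by
  have hLs : 0 < Real.sqrt L := Real.sqrt_pos.mpr hL
  rw [integral_indicator measurableSet_Ioc, ← intervalIntegral.integral_of_le (by linarith),
    ← intervalIntegral.integral_const_mul, arcI]
  have h := intervalIntegral.smul_integral_comp_mul_right (a := -(10 ^ 6 * Real.sqrt L)) (b := 10 ^ 6 * Real.sqrt L)
    (fun φ : ℝ => Rq (Complex.exp (-((kap / L : ℝ) + φ * Complex.I))) * Complex.exp (((L ^ 2 / kap + 1 / 8 : ℝ) : ℂ) * ((kap / L : ℝ) + φ * Complex.I)))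
    ((kap / L) / Real.sqrt L)
  have e1 : -(10 ^ 6 * Real.sqrt L) * ((kap / L) / Real.sqrt L) = -(10 ^ 6 * (kap / L)) := by field_simp
  have e2 : (10 ^ 6 * Real.sqrt L) * ((kap / L) / Real.sqrt L) = (10 ^ 6 * (kap / L)) := by field_simp
  rw [e1, e2] at h
  rw [← h, Complex.real_smul, ← mul_assoc, ← intervalIntegral.integral_const_mul]
  refine intervalIntegral.integral_congr fun w _ => ?_
  exact arc_integrand L w hL

lemma HH_cont (L : ℝ) (hL : 0 < L) : Continuous (HH L) := by
  have hk := kap_pos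
  have hc := Rq_cont (kap / L) (by positivity)
  have hx : Continuous (fun w => xw L w) := by unfold xw; fun_prop
  have e : HH L = fun w : ℝ => (Real.sqrt (kap / L) : ℂ) * (Rq (Complex.exp (-((kap / L : ℝ) + ((w * ((kap / L) / Real.sqrt L) : ℝ) : ℂ) * Complex.I))) *
      Complex.exp (-(kap / ((kap / L : ℝ) * xw L w)) + ((kap / L : ℝ) * xw L w) / 8)) * Complex.exp (-((w : ℂ) ^ 2) / xw L w) := by
    funext w
    rw [HH, Fm]
    congr 5
    rw [xw]; push_cast; ring
  rw [e]
  have h1 : Continuous (fun w : ℝ => Rq (Complex.exp (-((kap / L : ℝ) + ((w * ((kap / L) / Real.sqrt L) : ℝ) : ℂ) * Complex.I)))) :=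
    hc.comp (by fun_prop : Continuous fun w : ℝ => w * ((kap / L) / Real.sqrt L))
  have hkL : ((kap / L : ℝ) : ℂ) ≠ 0 := by
    have : 0 < kap / L := by positivity
    exact_mod_cast this.ne'
  have h2 : Continuous (fun w : ℝ => (kap : ℂ) / ((kap / L : ℝ) * xw L w)) :=
    continuous_const.div (by fun_prop) (fun w => mul_ne_zero hkL (xw_ne L w))
  have h3 : Continuous (fun w : ℝ => -((w : ℂ) ^ 2) / xw L w) :=
    Continuous.div (by fun_prop) hx (fun w => xw_ne L w)
  fun_prop

lemma main_arc : Tendsto (fun L : ℝ => (L * Real.exp (-2 * L) : ℝ) * arcI L) atTop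
    (𝓝 ((Real.sqrt kap * (2 * Real.pi * Real.sin (Real.pi / 7)) : ℝ) : ℂ)) := by
  have hk := kap_pos
  have hpi := Real.pi_pos
  set c : ℂ := ((2 * Real.sqrt Real.pi * Real.sin (Real.pi / 7) : ℝ) : ℂ) with hc
  have key : Tendsto (fun L : ℝ => ∫ w : ℝ, (Set.Ioc (-(10 ^ 6 * Real.sqrt L)) (10 ^ 6 * Real.sqrt L)).indicator (HH L) w) atTop
      (𝓝 (∫ w : ℝ, c * ((Real.exp (-1 * w ^ 2) : ℝ) : ℂ))) := by
    obtain ⟨C, hC, σ0, hσ0, hb⟩ := Fm_bound (10 ^ 6) (by positivity)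
    refine tendsto_integral_filter_of_dominated_convergence
      (fun w => C * Real.exp (-(1 / (1 + (10 ^ 6) ^ 2)) * w ^ 2)) ?_ ?_ ?_ ?_
    · filter_upwards [eventually_gt_atTop 0] with L hL
      exact ((HH_cont L hL).measurable.indicator measurableSet_Ioc).aestronglyMeasurable
    · filter_upwards [eventually_gt_atTop 0, eventually_ge_atTop (kap / σ0)] with L hL hL2
      refine Eventually.of_forall fun w => ?_
      by_cases hw : w ∈ Set.Ioc (-(10 ^ 6 * Real.sqrt L)) (10 ^ 6 * Real.sqrt L)
      · rw [Set.indicator_of_mem hw]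
        have hLs : 0 < Real.sqrt L := Real.sqrt_pos.mpr hL
        have hwa : |w / Real.sqrt L| ≤ 10 ^ 6 := by
          rw [abs_div, abs_of_pos hLs, div_le_iff₀ hLs, abs_le]
          exact ⟨hw.1.le, hw.2⟩
        have hkL : 0 < kap / L := by positivity
        have htre : (((kap / L : ℝ) : ℂ) * xw L w).re = kap / L := by rw [Complex.re_ofReal_mul, xw_re, mul_one]
        have htim : (((kap / L : ℝ) : ℂ) * xw L w).im = kap / L * (w / Real.sqrt L) := by rw [Complex.im_ofReal_mul, xw_im]
        have h1 := hb (((kap / L : ℝ) : ℂ) * xw L w) (by rw [htre]; exact hkL)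
          (by rw [htre, div_le_iff₀ hL]; rw [div_le_iff₀ hσ0] at hL2; linarith)
          (by rw [htre, htim, abs_mul, abs_of_pos hkL, mul_comm]; gcongr)
        rw [htre] at h1
        rw [HH, norm_mul]
        have h2 : ‖Complex.exp (-((w : ℂ) ^ 2) / xw L w)‖ ≤ Real.exp (-(1 / (1 + (10 ^ 6) ^ 2)) * w ^ 2) := by
          rw [Complex.norm_exp]
          apply Real.exp_le_exp.mpr
          have e : -((w : ℂ) ^ 2) / xw L w = ((-(w ^ 2) : ℝ) : ℂ) * (1 / xw L w) := by push_cast; ring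
          rw [e, Complex.re_ofReal_mul]
          have h3 := rho_lower (10 ^ 6) (xw L w) (by rw [xw_re]; norm_num) (by rw [xw_re, xw_im, mul_one]; exact hwa)
          rw [xw_re, mul_one] at h3
          have := mul_le_mul_of_nonneg_left h3 (sq_nonneg w)
          linarith
        gcongr
      · rw [Set.indicator_of_notMem hw, norm_zero]; positivity
    · exact (integrable_exp_neg_mul_sq (by positivity)).const_mul C
    · refine Eventually.of_forall fun w => ?_
      have hsq : Tendsto (fun L : ℝ => Real.sqrt L) atTop atTop := Real.tendsto_sqrt_atTop
      have hx : Tendsto (fun L : ℝ => xw L w) atTop (𝓝 1) := by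
        have h1 : Tendsto (fun L : ℝ => w / Real.sqrt L) atTop (𝓝 0) := hsq.const_div_atTop w
        have h2 : Tendsto (fun L : ℝ => ((w / Real.sqrt L : ℝ) : ℂ)) atTop (𝓝 ((0 : ℝ) : ℂ)) :=
          (Complex.continuous_ofReal.tendsto 0).comp h1
        have := (h2.mul_const Complex.I).const_add 1
        simpa [xw] using this
      have hre : ∀ L : ℝ, (((kap / L : ℝ) : ℂ) * xw L w).re = kap / L := fun L => by
        rw [Complex.re_ofReal_mul, xw_re, mul_one]
      have hF := Fm_lim atTop (fun L : ℝ => ((kap / L : ℝ) : ℂ) * xw L w)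
        (by filter_upwards [eventually_gt_atTop 0] with L hL; rw [hre]; positivity)
        (by simp only [hre]; exact tendsto_id.const_div_atTop kap)
        (by
          refine hx.congr' ?_
          filter_upwards [eventually_gt_atTop 0] with L hL
          rw [hre]
          have : ((kap / L : ℝ) : ℂ) ≠ 0 := by
            have : 0 < kap / L := by positivity
            exact_mod_cast this.ne'
          field_simp)
      simp only [hre] at hF
      have hE : Tendsto (fun L : ℝ => Complex.exp (-((w : ℂ) ^ 2) / xw L w)) atTop (𝓝 (Complex.exp (-((w : ℂ) ^ 2) / 1))) :=
        (Complex.continuous_exp.tendsto _).comp (tendsto_const_nhds.div hx one_ne_zero)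
      have hH := hF.mul hE
      have hval : Complex.exp (-((w : ℂ) ^ 2) / 1) = ((Real.exp (-1 * w ^ 2) : ℝ) : ℂ) := by
        push_cast; congr 1; ring
      rw [hval] at hH
      refine hH.congr' ?_
      filter_upwards [hsq.eventually_gt_atTop |w|] with L hL
      have hw : w ∈ Set.Ioc (-(10 ^ 6 * Real.sqrt L)) (10 ^ 6 * Real.sqrt L) := by
        have h0 := abs_nonneg w
        have := abs_le.mp hL.le
        constructor <;> linarith
      rw [Set.indicator_of_mem hw, HH]
  have h_gauss : (∫ w : ℝ, c * ((Real.exp (-1 * w ^ 2) : ℝ) : ℂ)) = c * (Real.sqrt Real.pi : ℂ) := by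
    rw [integral_const_mul, integral_complex_ofReal, integral_gaussian, div_one]
  rw [h_gauss] at key
  have h2 := key.const_mul (Real.sqrt kap : ℂ)
  have hval : (Real.sqrt kap : ℂ) * (c * (Real.sqrt Real.pi : ℂ)) = ((Real.sqrt kap * (2 * Real.pi * Real.sin (Real.pi / 7)) : ℝ) : ℂ) := by
    rw [hc]
    have : Real.sqrt kap * (2 * Real.sqrt Real.pi * Real.sin (Real.pi / 7) * Real.sqrt Real.pi) = Real.sqrt kap * (2 * Real.pi * Real.sin (Real.pi / 7)) := by
      have := Real.mul_self_sqrt hpi.le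
      linear_combination (Real.sqrt kap * 2 * Real.sin (Real.pi / 7)) * this
    exact_mod_cast this
  rw [hval] at h2
  refine h2.congr' ?_
  filter_upwards [eventually_gt_atTop 0] with L hL
  exact (arcI_eq L hL).symm

open scoped Classical
open Filter Topology MeasureTheory

lemma kap_lo : 0.2263 ≤ kap := by
  unfold kap; have := Real.pi_gt_d2; nlinarith only [this]

lemma kap_hi : kap ≤ 1 := by
  unfold kap; have := Real.pi_lt_d2; have := Real.pi_pos; nlinarith

lemma arc_diff : ∃ C > 0, ∃ L0 : ℝ, ∀ L : ℝ, L0 ≤ L → ∀ n : ℕ, (n : ℝ) = L ^ 2 / kap + 1 / 8 →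
    ‖Acoef 1 7 n * (2 * Real.pi) - arcI L‖ ≤ C * (L ^ 3 * Real.exp (1.99 * L)) := by
  obtain ⟨C, hC, σ0, hσ0, hm⟩ := minor
  have hk := kap_pos
  have hk1 := kap_lo
  have hk2 := kap_hi
  refine ⟨2 * (C / kap ^ 3 * Real.pi), by have := Real.pi_pos; positivity, max (10 ^ 6) (1 / σ0), fun L hL n hn => ?_⟩
  have hL1 : 10 ^ 6 ≤ L := le_trans (le_max_left _ _) hL
  have hL2 : 1 / σ0 ≤ L := le_trans (le_max_right _ _) hL
  have hL0 : 0 < L := by linarith only [hL1]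
  have hπ := Real.pi_gt_three
  set σ := kap / L with hσd
  have hσ : 0 < σ := by positivity
  have hσL : σ * L = kap := by rw [hσd]; field_simp
  have hσle : σ ≤ σ0 := by
    rw [hσd, div_le_iff₀ hL0]
    rw [div_le_iff₀ hσ0] at hL2
    linarith only [hL2, hk2]
  have hσπ : 10 ^ 6 * σ ≤ Real.pi := by
    have : 10 ^ 6 * σ ≤ 1 := by
      rw [hσd, ← mul_div_assoc, div_le_one hL0]; linarith only [hL1, hk2]
    linarith only [this, hπ]
  set f : ℝ → ℂ := fun φ => Rq (Complex.exp (-(σ + φ * Complex.I))) * Complex.exp (n * (σ + φ * Complex.I)) with hf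
  have hfc : Continuous f := (Rq_cont σ hσ).mul (by fun_prop)
  have hnc : ((L ^ 2 / kap + 1 / 8 : ℝ) : ℂ) = (n : ℂ) := by rw [← hn]; simp
  have harc : arcI L = ∫ φ in (-(10 ^ 6 * σ))..(10 ^ 6 * σ), f φ := by
    unfold arcI; rw [hnc]
  rw [cauchy_A σ hσ n, harc]
  have hsplit : (∫ φ in (-Real.pi)..Real.pi, f φ) - (∫ φ in (-(10 ^ 6 * σ))..(10 ^ 6 * σ), f φ) =
      (∫ φ in (-Real.pi)..(-(10 ^ 6 * σ)), f φ) + ∫ φ in (10 ^ 6 * σ)..Real.pi, f φ := by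
    rw [← intervalIntegral.integral_add_adjacent_intervals (hfc.intervalIntegrable (-Real.pi) (-(10 ^ 6 * σ))) (hfc.intervalIntegrable (-(10 ^ 6 * σ)) Real.pi),
      ← intervalIntegral.integral_add_adjacent_intervals (hfc.intervalIntegrable (-(10 ^ 6 * σ)) (10 ^ 6 * σ)) (hfc.intervalIntegrable (10 ^ 6 * σ) Real.pi)]
    ring
  rw [hsplit]
  have hb : ∀ φ : ℝ, |φ| ≤ Real.pi → 10 ^ 6 * σ ≤ |φ| → ‖f φ‖ ≤ C / kap ^ 3 * (L ^ 3 * Real.exp (1.99 * L)) := by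
    intro φ h1 h2
    have h3 := hm σ φ hσ hσle h1 h2
    have h4 : ‖Complex.exp (n * (σ + φ * Complex.I))‖ = Real.exp (n * σ) := by
      rw [Complex.norm_exp]; congr 1; simp
    rw [hf]; simp only [norm_mul]
    rw [h4]
    have h5 : 0.2225 / σ + n * σ ≤ 1.99 * L := by
      have e1 : 0.2225 / σ = 0.2225 / kap * L := by rw [hσd]; field_simp
      have e2 : n * σ = L + σ / 8 := by rw [hn, hσd]; field_simp
      have e3 : (0.2225 : ℝ) / kap ≤ 0.985 := by rw [div_le_iff₀ hk]; linarith only [hk1]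
      have e4 : 0.2225 / kap * L ≤ 0.985 * L := mul_le_mul_of_nonneg_right e3 hL0.le
      rw [e1, e2]; linarith only [e4, hσπ, hL1, Real.pi_lt_d2]
    calc _ ≤ C / σ ^ 3 * Real.exp (0.2225 / σ) * Real.exp (n * σ) := by gcongr
      _ = C / σ ^ 3 * Real.exp (0.2225 / σ + n * σ) := by rw [Real.exp_add]; ring
      _ ≤ C / σ ^ 3 * Real.exp (1.99 * L) := by gcongr
      _ = _ := by rw [hσd]; field_simp
  have hX : 0 ≤ C / kap ^ 3 * (L ^ 3 * Real.exp (1.99 * L)) := by positivity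
  have i1 : ‖∫ φ in (-Real.pi)..(-(10 ^ 6 * σ)), f φ‖ ≤ C / kap ^ 3 * (L ^ 3 * Real.exp (1.99 * L)) * |-(10 ^ 6 * σ) - (-Real.pi)| := by
    refine intervalIntegral.norm_integral_le_of_norm_le_const fun φ hφ => ?_
    rw [Set.uIoc_of_le (by linarith only [hσπ])] at hφ
    have := abs_of_nonpos (a := φ) (by linarith only [hφ.2, hσ])
    exact hb φ (by rw [this]; linarith only [hφ.1]) (by rw [this]; linarith only [hφ.2])
  have i2 : ‖∫ φ in (10 ^ 6 * σ)..Real.pi, f φ‖ ≤ C / kap ^ 3 * (L ^ 3 * Real.exp (1.99 * L)) * |Real.pi - 10 ^ 6 * σ| := by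
    refine intervalIntegral.norm_integral_le_of_norm_le_const fun φ hφ => ?_
    rw [Set.uIoc_of_le hσπ] at hφ
    have := abs_of_nonneg (a := φ) (by linarith only [hφ.1, hσ])
    exact hb φ (by rw [this]; linarith only [hφ.2]) (by rw [this]; linarith only [hφ.1])
  have a1 : |-(10 ^ 6 * σ) - (-Real.pi)| ≤ Real.pi := by
    rw [abs_of_nonneg (by linarith only [hσπ])]; linarith only [hσ]
  have a2 : |Real.pi - 10 ^ 6 * σ| ≤ Real.pi := by
    rw [abs_of_nonneg (by linarith only [hσπ])]; linarith only [hσ]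
  calc _ ≤ _ := norm_add_le _ _
    _ ≤ C / kap ^ 3 * (L ^ 3 * Real.exp (1.99 * L)) * Real.pi + C / kap ^ 3 * (L ^ 3 * Real.exp (1.99 * L)) * Real.pi :=
      add_le_add (i1.trans (mul_le_mul_of_nonneg_left a1 hX)) (i2.trans (mul_le_mul_of_nonneg_left a2 hX))
    _ = _ := by ring

noncomputable def Ln (n : ℕ) : ℝ := Real.sqrt (kap * (n - 1 / 8))

lemma Ln_tendsto : Tendsto Ln atTop atTop := by
  unfold Ln
  refine Real.tendsto_sqrt_atTop.comp ?_
  refine Tendsto.const_mul_atTop kap_pos ?_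
  exact tendsto_atTop_add_const_right _ _ tendsto_natCast_atTop_atTop

lemma Ln_sq (n : ℕ) (hn : 1 ≤ n) : (n : ℝ) = Ln n ^ 2 / kap + 1 / 8 := by
  have h : (1 : ℝ) ≤ n := by exact_mod_cast hn
  have hk := kap_pos
  unfold Ln
  rw [Real.sq_sqrt (mul_nonneg hk.le (by linarith))]
  field_simp; ring

lemma decay_lim : Tendsto (fun L : ℝ => L ^ 4 * Real.exp (-(0.01 * L))) atTop (𝓝 0) := by
  have h := (Real.tendsto_pow_mul_exp_neg_atTop_nhds_zero 4).comp
    (Tendsto.const_mul_atTop (r := (0.01 : ℝ)) (by norm_num) tendsto_id)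
  have h2 := h.const_mul (100 ^ 4 : ℝ)
  rw [mul_zero] at h2
  refine h2.congr fun L => ?_
  simp only [Function.comp, id]; ring

lemma A_lim : Tendsto (fun n : ℕ => (Ln n * Real.exp (-2 * Ln n) : ℝ) * (Acoef 1 7 n * (2 * Real.pi))) atTop
    (𝓝 ((Real.sqrt kap * (2 * Real.pi * Real.sin (Real.pi / 7)) : ℝ) : ℂ)) := by
  obtain ⟨C, hC, L0, h⟩ := arc_diff
  have h1 := main_arc.comp Ln_tendsto
  have h2 : Tendsto (fun n : ℕ => ((Ln n * Real.exp (-2 * Ln n) : ℝ) : ℂ) * (Acoef 1 7 n * (2 * Real.pi) - arcI (Ln n))) atTop (𝓝 0) := by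
    have h3 := (decay_lim.comp Ln_tendsto).const_mul C
    rw [mul_zero] at h3
    refine squeeze_zero_norm' ?_ h3
    filter_upwards [Ln_tendsto.eventually_ge_atTop L0, Ln_tendsto.eventually_ge_atTop 0, eventually_ge_atTop 1] with n hn1 hn2 hn3
    have h4 := h (Ln n) hn1 n (Ln_sq n hn3)
    rw [norm_mul, Complex.norm_real, Real.norm_of_nonneg (by positivity)]
    calc _ ≤ Ln n * Real.exp (-2 * Ln n) * (C * (Ln n ^ 3 * Real.exp (1.99 * Ln n))) := by gcongr
      _ = C * (Ln n ^ 4 * (Real.exp (-2 * Ln n) * Real.exp (1.99 * Ln n))) := by ring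
      _ = _ := by
        rw [← Real.exp_add]; simp only [Function.comp]
        congr 3; ring
  have h5 := h1.add h2
  rw [add_zero] at h5
  refine h5.congr fun n => ?_
  simp only [Function.comp]
  ring

lemma cosh_lim : Tendsto (fun n : ℕ => Real.exp (2 * Ln n) / (2 * Real.cosh (2 * Ln n))) atTop (𝓝 1) := by
  have h1 : Tendsto (fun n : ℕ => Real.exp (-(4 * Ln n))) atTop (𝓝 0) :=
    Real.tendsto_exp_neg_atTop_nhds_zero.comp (Tendsto.const_mul_atTop (by norm_num) Ln_tendsto)
  have h2 : Tendsto (fun n : ℕ => 1 / (1 + Real.exp (-(4 * Ln n)))) atTop (𝓝 (1 / (1 + 0))) :=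
    tendsto_const_nhds.div (tendsto_const_nhds.add h1) (by norm_num)
  rw [add_zero, div_one] at h2
  refine h2.congr fun n => ?_
  have e : Real.exp (-(4 * Ln n)) = Real.exp (-(2 * Ln n)) / Real.exp (2 * Ln n) := by
    rw [← Real.exp_sub]; congr 1; ring
  have hp := Real.exp_pos (2 * Ln n)
  have hp2 := Real.exp_pos (-(2 * Ln n))
  rw [e, Real.cosh_eq]
  field_simp

lemma sqrt_rel (n : ℕ) (hn : 1 ≤ n) : Real.sqrt (8 * (n : ℝ) - 1) * Real.sqrt kap = 2 * Real.sqrt 2 * Ln n := by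
  have h : (1 : ℝ) ≤ n := by exact_mod_cast hn
  have hk := kap_pos
  have e : 2 * Real.sqrt 2 = Real.sqrt 8 := by
    rw [show (8 : ℝ) = 2 ^ 2 * 2 by norm_num, Real.sqrt_mul (by norm_num), Real.sqrt_sq (by norm_num)]
  unfold Ln
  rw [e, ← Real.sqrt_mul (by linarith), ← Real.sqrt_mul (by norm_num)]
  congr 1; ring

lemma sqrt_kap : Real.sqrt kap = 3 * Real.pi * Real.sqrt 2 / 28 := by
  have hπ := Real.pi_pos
  rw [show kap = (3 * Real.pi * Real.sqrt 2 / 28) ^ 2 by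
    unfold kap; rw [div_pow, mul_pow, Real.sq_sqrt (by norm_num)]; ring]
  exact Real.sqrt_sq (by positivity)

lemma arg_rel (n : ℕ) (hn : 1 ≤ n) : 3 * Real.pi * Real.sqrt (8 * (n : ℝ) - 1) / 28 = 2 * Ln n := by
  have h := sqrt_rel n hn
  rw [sqrt_kap] at h
  have h2 : Real.sqrt 2 ≠ 0 := by positivity
  apply mul_left_cancel₀ h2
  linarith only [h]

theorem Acoef_one_seventh_asymptotic :
    Filter.Tendsto
      (fun n : ℕ =>
        Acoef 1 7 n * ((Real.sqrt (8 * (n : ℝ) - 1) : ℝ) : ℂ) /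
          (((4 * Real.sqrt 2 * Real.sin (Real.pi / 7) : ℝ) : ℂ) *
            ((Real.cosh (3 * Real.pi * Real.sqrt (8 * (n : ℝ) - 1) / 28) : ℝ) : ℂ)))
      Filter.atTop (nhds 1) := by
  have hs : 0 < Real.sin (Real.pi / 7) := Real.sin_pos_of_pos_of_lt_pi (by have := Real.pi_pos; positivity) (by have := Real.pi_pos; linarith)
  have hk : 0 < Real.sqrt kap := Real.sqrt_pos.mpr kap_pos
  have hπ := Real.pi_pos
  set K : ℝ := Real.sqrt kap * (2 * Real.pi * Real.sin (Real.pi / 7)) with hK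
  have hKp : K ≠ 0 := by positivity
  have h1 := (A_lim.div_const (K : ℂ)).mul (Complex.continuous_ofReal.continuousAt.tendsto.comp cosh_lim)
  rw [← hK, div_self (by exact_mod_cast hKp), Complex.ofReal_one, mul_one] at h1
  refine h1.congr' ?_
  filter_upwards [eventually_ge_atTop 1] with n hn
  rw [arg_rel n hn]
  have e1 : Real.sqrt (8 * (n : ℝ) - 1) = 2 * Real.sqrt 2 * Ln n / Real.sqrt kap := by
    rw [eq_div_iff hk.ne']; exact sqrt_rel n hn
  rw [e1, hK]
  simp only [Function.comp]
  have e2 : Real.exp (-2 * Ln n) = (Real.exp (2 * Ln n))⁻¹ := by rw [← Real.exp_neg]; congr 1; ring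
  rw [e2]
  have n1 : (Real.exp (2 * Ln n) : ℂ) ≠ 0 := by exact_mod_cast (Real.exp_pos _).ne'
  have n2 : (Real.cosh (2 * Ln n) : ℂ) ≠ 0 := by exact_mod_cast (Real.cosh_pos _).ne'
  have n3 : (Real.sqrt kap : ℂ) ≠ 0 := by exact_mod_cast hk.ne'
  have n4 : (Real.sin (Real.pi / 7) : ℂ) ≠ 0 := by exact_mod_cast hs.ne'
  have n5 : (Real.sqrt 2 : ℂ) ≠ 0 := by exact_mod_cast (by positivity : Real.sqrt 2 ≠ 0)
  have n6 : (Real.pi : ℂ) ≠ 0 := by exact_mod_cast hπ.ne'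
  simp only [Complex.ofReal_mul, Complex.ofReal_div, Complex.ofReal_inv, Complex.ofReal_ofNat]
  field_simp
  ring
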